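/- arXiv:2006.02783 — 5 statements merged into one kernel-verified Lean document; each statement's English description precedes it below -/
import Mathlib

section
/- Let S(x) denote the number of positive integers n ≤ x that can be written as a sum of two squares of nonnegative integers. Assume there is a constant c > 0 such that S(x) ≤ c·x/√(log x) for all x ≥ 2. Then for every positive integer g and every B_2[g] set A consisting of squares of positive integers, there is a constant C such that A(x) ≤ C·√x/(log x)^{1/4} for all x ≥ 2. -/
/-- `Rstar A h n` : number of representations `n = a_1 + ... + a_h`
with `a_1 ≤ a_2 ≤ ... ≤ a_h`, all terms in `A`. -/
noncomputable def Rstar (A : Set ℕ) (h n : ℕ) : ℕ :=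
  {f : Fin h → ℕ | Monotone f ∧ (∀ i, f i ∈ A) ∧ ∑ i, f i = n}.ncard

/-- `countBelow A x` : the counting function `A(x) = #{a ∈ A : a ≤ x}`. -/
noncomputable def countBelow (A : Set ℕ) (x : ℝ) : ℕ :=
  {a ∈ A | (a : ℝ) ≤ x}.ncard

/-- `S x` : the number of positive integers `n ≤ x` that are sums of two squares. -/
noncomputable def sumTwoSquaresCount (x : ℝ) : ℕ :=
  {n : ℕ | 1 ≤ n ∧ (n : ℝ) ≤ x ∧ ∃ a b : ℕ, a ^ 2 + b ^ 2 = n}.ncard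

theorem finite_setOf_monotone_sum_eq (A : Set ℕ) (h n : ℕ) :
    {f : Fin h → ℕ | Monotone f ∧ (∀ i, f i ∈ A) ∧ ∑ i, f i = n}.Finite := by
  refine (Set.finite_Icc (0 : Fin h → ℕ) (fun _ => n)).subset ?_
  rintro f ⟨-, -, hf⟩
  refine ⟨fun i => Nat.zero_le _, fun i => ?_⟩
  rw [← hf]
  exact Finset.single_le_sum (f := f) (fun _ _ => Nat.zero_le _) (Finset.mem_univ i)

theorem card_filter_le_Rstar (A : Set ℕ) (n : ℕ) (s : Finset (ℕ × ℕ))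
    (hs : ∀ p ∈ s, p.1 ∈ A ∧ p.2 ∈ A ∧ p.1 ≤ p.2 ∧ p.1 + p.2 = n) :
    s.card ≤ Rstar A 2 n := by
  rw [← Set.ncard_coe_finset, Rstar]
  refine Set.ncard_le_ncard_of_injOn (fun p => ![p.1, p.2]) ?_ ?_
    (finite_setOf_monotone_sum_eq A 2 n)
  · intro p hp
    obtain ⟨h1, h2, h3, h4⟩ := hs p hp
    refine ⟨?_, ?_, ?_⟩
    · intro i j hij
      fin_cases i <;> fin_cases j <;> simp_all
    · intro i
      fin_cases i <;> simpa
    · simpa [Fin.sum_univ_two] using h4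
  · intro p _ q _ hpq
    have h0 := congrFun hpq 0
    have h1 := congrFun hpq 1
    exact Prod.ext (by simpa using h0) (by simpa using h1)

/-- At most `2 g` ordered pairs from a `B_2[g]` set share the same positive sum. -/
theorem card_sq_le_of_Rstar_le {A : Set ℕ} {g : ℕ} (hB : ∀ n : ℕ, 1 ≤ n → Rstar A 2 n ≤ g)
    (F T : Finset ℕ) (hF : ∀ a ∈ F, a ∈ A) (hT : ∀ n ∈ T, 1 ≤ n)
    (hFT : ∀ a ∈ F, ∀ b ∈ F, a + b ∈ T) :
    F.card * F.card ≤ 2 * g * T.card := by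
  classical
  rw [← Finset.card_product]
  refine Finset.card_le_mul_card_image_of_maps_to (f := fun p : ℕ × ℕ => p.1 + p.2)
    (fun p hp => ?_) (2 * g) (fun n hn => ?_)
  · rw [Finset.mem_product] at hp
    exact hFT _ hp.1 _ hp.2
  · set s := (F ×ˢ F).filter (fun p => p.1 + p.2 = n) with hs
    have key : ∀ p ∈ s, p.1 ∈ A ∧ p.2 ∈ A ∧ p.1 + p.2 = n := by
      intro p hp
      rw [hs, Finset.mem_filter, Finset.mem_product] at hp
      exact ⟨hF _ hp.1.1, hF _ hp.1.2, hp.2⟩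
    have h1 : (s.filter (fun p => p.1 ≤ p.2)).card ≤ g := by
      refine (card_filter_le_Rstar A n _ fun p hp => ?_).trans (hB n (hT n hn))
      rw [Finset.mem_filter] at hp
      obtain ⟨h1, h2, h3⟩ := key p hp.1
      exact ⟨h1, h2, hp.2, h3⟩
    have h2 : (s.filter (fun p => ¬ p.1 ≤ p.2)).card ≤ g := by
      rw [← Finset.card_image_of_injective _ Prod.swap_injective]
      refine (card_filter_le_Rstar A n _ fun p hp => ?_).trans (hB n (hT n hn))
      obtain ⟨q, hq, rfl⟩ := Finset.mem_image.1 hp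
      rw [Finset.mem_filter] at hq
      obtain ⟨h1, h2, h3⟩ := key q hq.1
      simp only [Prod.fst_swap, Prod.snd_swap]
      exact ⟨h2, h1, by omega, by omega⟩
    have h3 := Finset.card_filter_add_card_filter_not (s := s) (fun p => p.1 ≤ p.2)
    omega

theorem finite_setOf_natCast_le (x : ℝ) : {n : ℕ | (n : ℝ) ≤ x}.Finite :=
  (Set.finite_Iic ⌊x⌋₊).subset fun _ hn => Nat.le_floor hn

theorem countBelow_sq_le {A : Set ℕ} {g : ℕ}
    (hA : A ⊆ {m | ∃ j : ℕ, 1 ≤ j ∧ m = j ^ 2})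
    (hB : ∀ n : ℕ, 1 ≤ n → Rstar A 2 n ≤ g) (x : ℝ) :
    countBelow A x ^ 2 ≤ 2 * g * sumTwoSquaresCount (2 * x) := by
  have hFfin : {a ∈ A | (a : ℝ) ≤ x}.Finite :=
    (finite_setOf_natCast_le x).subset fun _ ha => ha.2
  have hTfin : {n : ℕ | 1 ≤ n ∧ (n : ℝ) ≤ 2 * x ∧ ∃ a b : ℕ, a ^ 2 + b ^ 2 = n}.Finite :=
    (finite_setOf_natCast_le (2 * x)).subset fun _ hn => hn.2.1
  rw [countBelow, sumTwoSquaresCount, Set.ncard_eq_toFinset_card _ hFfin,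
    Set.ncard_eq_toFinset_card _ hTfin, sq]
  refine card_sq_le_of_Rstar_le hB _ _ (fun a ha => ?_) (fun n hn => ?_) (fun a ha b hb => ?_)
  · exact ((hFfin.mem_toFinset).1 ha).1
  · exact ((hTfin.mem_toFinset).1 hn).1
  · obtain ⟨haA, hax⟩ := (hFfin.mem_toFinset).1 ha
    obtain ⟨hbA, hbx⟩ := (hFfin.mem_toFinset).1 hb
    obtain ⟨i, hi, rfl⟩ := hA haA
    obtain ⟨j, hj, rfl⟩ := hA hbA
    refine (hTfin.mem_toFinset).2 ⟨?_, ?_, i, j, rfl⟩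
    · have := Nat.one_le_pow 2 i hi
      omega
    · push_cast at hax hbx ⊢
      linarith

theorem stmt2 (c : ℝ) (hc : 0 < c)
    (hS : ∀ x : ℝ, 2 ≤ x →
      (sumTwoSquaresCount x : ℝ) ≤ c * x / Real.sqrt (Real.log x))
    (g : ℕ) (hg : 1 ≤ g) (A : Set ℕ)
    (hA : A ⊆ {m | ∃ j : ℕ, 1 ≤ j ∧ m = j ^ 2})
    (hB : ∀ n : ℕ, 1 ≤ n → Rstar A 2 n ≤ g) :
    ∃ C : ℝ, ∀ x : ℝ, 2 ≤ x →
      (countBelow A x : ℝ) ≤ C * Real.sqrt x / (Real.log x) ^ ((1 : ℝ) / 4) := by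
  refine ⟨Real.sqrt (4 * g * c), fun x hx => ?_⟩
  have hlog : 0 < Real.log x := Real.log_pos (by linarith)
  refine le_of_sq_le_sq ?_ (by positivity)
  have hcount : (countBelow A x : ℝ) ^ 2 ≤ 2 * g * sumTwoSquaresCount (2 * x) := by
    exact_mod_cast countBelow_sq_le hA hB x
  have hrpow : (Real.log x ^ ((1 : ℝ) / 4)) ^ 2 = Real.sqrt (Real.log x) := by
    rw [← Real.rpow_natCast, ← Real.rpow_mul hlog.le, Real.sqrt_eq_rpow]
    norm_num
  rw [div_pow, mul_pow, hrpow, Real.sq_sqrt (by positivity), Real.sq_sqrt (by linarith)]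
  calc (countBelow A x : ℝ) ^ 2
      ≤ 2 * g * sumTwoSquaresCount (2 * x) := hcount
    _ ≤ 2 * g * (c * (2 * x) / Real.sqrt (Real.log (2 * x))) := by
        gcongr
        exact hS _ (by linarith)
    _ ≤ 2 * g * (c * (2 * x) / Real.sqrt (Real.log x)) := by
        gcongr
        linarith
    _ = 4 * g * c * x / Real.sqrt (Real.log x) := by ring
end

section
/- (Theorem of Vu.) For every fixed integer k ≥ 2 there is a constant m_0(k) such that for every integer m > m_0(k) there exist a set A ⊆ ℕ^k = {0^k, 1^k, 2^k, …} and a constant C with the following properties: every nonnegative integer n can be written as n = a_1 + a_2 + … + a_m with a_1, …, a_m ∈ A (repetitions allowed), and A(x) ≤ C·x^{1/m}·(log x)^{1/m} for all real x ≥ 2. -/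
/-! ### A Janson-type inequality for random subsets -/

section Janson

variable {V : Type*} [DecidableEq V]

/-- The mean of `f` over a random subset of `U` containing each element independently with
probability `p`. -/
noncomputable def subsetMean (U : Finset V) (p : ℝ) (f : Finset V → ℝ) : ℝ :=
  ∑ S ∈ U.powerset, p ^ S.card * (1 - p) ^ (U \ S).card * f S

lemma subsetMean_mono {U : Finset V} {p : ℝ} (hp0 : 0 ≤ p) (hp1 : p ≤ 1)
    {f g : Finset V → ℝ} (h : ∀ S, f S ≤ g S) : subsetMean U p f ≤ subsetMean U p g := by
  unfold subsetMean
  have : 0 ≤ 1 - p := by linarith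
  gcongr with S hS
  exact h S

lemma subsetMean_nonneg {U : Finset V} {p : ℝ} (hp0 : 0 ≤ p) (hp1 : p ≤ 1)
    {f : Finset V → ℝ} (h : ∀ S, 0 ≤ f S) : 0 ≤ subsetMean U p f := by
  have := subsetMean_mono (U := U) hp0 hp1 (f := fun _ => 0) (g := f) h
  simpa [subsetMean] using this

lemma subsetMean_sub (U : Finset V) (p : ℝ) (f g : Finset V → ℝ) :
    subsetMean U p (fun S => f S - g S) = subsetMean U p f - subsetMean U p g := by
  simp [subsetMean, mul_sub]

lemma subsetMean_add (U : Finset V) (p : ℝ) (f g : Finset V → ℝ) :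
    subsetMean U p (fun S => f S + g S) = subsetMean U p f + subsetMean U p g := by
  simp [subsetMean, mul_add, Finset.sum_add_distrib]

lemma subsetMean_smul (U : Finset V) (p c : ℝ) (f : Finset V → ℝ) :
    subsetMean U p (fun S => c * f S) = c * subsetMean U p f := by
  simp only [subsetMean, Finset.mul_sum]
  exact Finset.sum_congr rfl fun _ _ => by ring

lemma subsetMean_sum {ι : Type*} (U : Finset V) (p : ℝ) (s : Finset ι) (f : ι → Finset V → ℝ) :
    subsetMean U p (fun S => ∑ i ∈ s, f i S) = ∑ i ∈ s, subsetMean U p (f i) := by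
  simp only [subsetMean, Finset.mul_sum]
  exact Finset.sum_comm

lemma subsetMean_one (U : Finset V) (p : ℝ) : subsetMean U p (fun _ => 1) = 1 := by
  have := Finset.prod_add (fun _ : V => p) (fun _ => 1 - p) U
  simp only [Finset.prod_const] at this
  simp only [subsetMean, mul_one]
  rw [← this]
  simp

lemma subsetMean_mem {U : Finset V} (p : ℝ) {x : V} (hx : x ∈ U) (f : Finset V → ℝ) :
    subsetMean U p (fun S => if x ∈ S then f S else 0)
      = p * subsetMean U p (fun S => f (insert x S)) := by
  obtain ⟨W, hxW, rfl⟩ : ∃ W, x ∉ W ∧ insert x W = U :=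
    ⟨U.erase x, by simp, Finset.insert_erase hx⟩
  unfold subsetMean
  rw [Finset.sum_powerset_insert hxW, Finset.sum_powerset_insert hxW]
  have key : ∀ S ∈ W.powerset, x ∉ S := fun S hS h => hxW (Finset.mem_powerset.1 hS h)
  rw [Finset.sum_eq_zero (s := W.powerset)
    (fun S hS => by simp only [if_neg (key S hS), mul_zero]), zero_add,
    ← Finset.sum_add_distrib, Finset.mul_sum]
  refine Finset.sum_congr rfl fun S hS => ?_
  have hxS := key S hS
  have h1 : insert x W \ insert x S = W \ S := by
    ext a; simp only [Finset.mem_sdiff, Finset.mem_insert]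
    constructor
    · rintro ⟨h | h, h'⟩ <;> tauto
    · rintro ⟨h, h'⟩
      refine ⟨Or.inr h, ?_⟩
      rintro (rfl | h2)
      · exact hxW h
      · exact h' h2
  have h2 : (insert x W \ S).card = (W \ S).card + 1 := by
    rw [Finset.insert_sdiff_of_notMem _ hxS, Finset.card_insert_of_notMem]
    simp [hxW]
  simp only [if_pos (Finset.mem_insert_self x S), h1, h2, Finset.insert_idem,
    Finset.card_insert_of_notMem hxS]
  ring

lemma subsetMean_subset {U : Finset V} (p : ℝ) {γ : Finset V} (hγ : γ ⊆ U)
    (f : Finset V → ℝ) :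
    subsetMean U p (fun S => if γ ⊆ S then f S else 0)
      = p ^ γ.card * subsetMean U p (fun S => f (γ ∪ S)) := by
  induction γ using Finset.induction_on generalizing f with
  | empty => simp
  | insert x γ hx ih =>
    have hxU : x ∈ U := hγ (Finset.mem_insert_self _ _)
    have hγU : γ ⊆ U := fun y hy => hγ (Finset.mem_insert_of_mem hy)
    have h1 : (fun S : Finset V => if insert x γ ⊆ S then f S else 0)
        = fun S => if γ ⊆ S then (if x ∈ S then f S else 0) else 0 := by
      funext S
      by_cases h1 : x ∈ S <;> by_cases h2 : γ ⊆ S <;> simp [Finset.insert_subset_iff, h1, h2]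
    rw [h1, ih hγU, Finset.card_insert_of_notMem hx]
    have h2 : (fun S : Finset V => if x ∈ γ ∪ S then f (γ ∪ S) else 0)
        = fun S => if x ∈ S then f (γ ∪ S) else 0 := by
      funext S; simp [hx]
    rw [h2, subsetMean_mem p hxU (fun S => f (γ ∪ S))]
    simp only [Finset.union_insert, Finset.insert_union]
    ring

lemma subsetMean_card (U : Finset V) (p : ℝ) :
    subsetMean U p (fun S => ((S ∩ U).card : ℝ)) = p * U.card := by
  have h : (fun S : Finset V => ((S ∩ U).card : ℝ))
      = fun S => ∑ x ∈ U, if x ∈ S then (1 : ℝ) else 0 := by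
    funext S
    rw [Finset.sum_boole, Finset.filter_mem_eq_inter, Finset.inter_comm]
  rw [h, subsetMean_sum]
  rw [Finset.sum_congr rfl fun x hx => subsetMean_mem p hx (fun _ => 1)]
  simp [subsetMean_one, mul_comm]

/-- The indicator of the event that `S` contains no member of `F`. -/
noncomputable def avoids (F : Finset (Finset V)) (S : Finset V) : ℝ :=
  if ∃ α ∈ F, α ⊆ S then 0 else 1

lemma avoids_nonneg (F : Finset (Finset V)) (S : Finset V) : 0 ≤ avoids F S := by
  unfold avoids; split_ifs <;> norm_num

lemma avoids_le_one (F : Finset (Finset V)) (S : Finset V) : avoids F S ≤ 1 := by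
  unfold avoids; split_ifs <;> norm_num

lemma avoids_anti {F G : Finset (Finset V)} {S T : Finset V} (hF : F ⊆ G) (hS : S ⊆ T) :
    avoids G T ≤ avoids F S := by
  unfold avoids
  split_ifs with h1 h2 h2
  · exact le_rfl
  · norm_num
  · obtain ⟨α, hα, hαS⟩ := h2
    exact absurd ⟨α, hF hα, hαS.trans hS⟩ h1
  · exact le_rfl

lemma avoids_union_of_disjoint {F : Finset (Finset V)} {α : Finset V}
    (h : ∀ β ∈ F, Disjoint α β) (S : Finset V) : avoids F (α ∪ S) = avoids F S := by
  refine le_antisymm (avoids_anti subset_rfl Finset.subset_union_right) ?_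
  unfold avoids
  split_ifs with h1 h2 h2
  · exact le_rfl
  · norm_num
  · obtain ⟨β, hβ, hβS⟩ := h2
    refine absurd ⟨β, hβ, fun x hx => ?_⟩ h1
    rcases Finset.mem_union.1 (hβS hx) with h3 | h3
    · exact absurd hx (Finset.disjoint_left.1 (h β hβ) h3)
    · exact h3
  · exact le_rfl

lemma janson_step {U : Finset V} {p : ℝ} (hp0 : 0 ≤ p) (hp1 : p ≤ 1)
    {F : Finset (Finset V)} (hF : ∀ β ∈ F, β ⊆ U) {α : Finset V} (hα : α ⊆ U)
    (hsum : ∑ β ∈ F with ¬ Disjoint α β, p ^ (α ∪ β).card ≤ p ^ α.card / 2) :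
    subsetMean U p (avoids (insert α F))
      ≤ (1 - p ^ α.card / 2) * subsetMean U p (avoids F) := by
  set F₁ := F.filter (fun β => ¬ Disjoint α β) with hF₁
  set F₀ := F.filter (fun β => Disjoint α β) with hF₀
  have hpt : ∀ S, avoids (insert α F) S ≤ avoids F S -
      ((if α ⊆ S then avoids F₀ S else 0)
        - ∑ β ∈ F₁, if α ∪ β ⊆ S then avoids F₀ S else 0) := by
    intro S
    have hs0 : 0 ≤ ∑ β ∈ F₁, if α ∪ β ⊆ S then avoids F₀ S else 0 :=
      Finset.sum_nonneg fun β _ => by split_ifs; exacts [avoids_nonneg _ _, le_rfl]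
    by_cases hS : α ⊆ S
    · have h0 : avoids (insert α F) S = 0 := by
        unfold avoids; rw [if_pos ⟨α, Finset.mem_insert_self _ _, hS⟩]
      rw [h0, if_pos hS]
      by_cases h1 : ∃ β ∈ F₁, β ⊆ S
      · obtain ⟨β, hβ, hβS⟩ := h1
        have : avoids F₀ S ≤ ∑ β ∈ F₁, if α ∪ β ⊆ S then avoids F₀ S else 0 := by
          refine le_trans ?_ (Finset.single_le_sum (fun β _ => ?_) hβ)
          · rw [if_pos (Finset.union_subset hS hβS)]
          · split_ifs; exacts [avoids_nonneg _ _, le_rfl]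
        linarith [avoids_nonneg F S]
      · have : avoids F₀ S ≤ avoids F S := by
          unfold avoids
          split_ifs with h2 h3 h3
          · exact le_rfl
          · norm_num
          · obtain ⟨β, hβ, hβS⟩ := h3
            by_cases hd : Disjoint α β
            · exact absurd ⟨β, Finset.mem_filter.2 ⟨hβ, hd⟩, hβS⟩ h2
            · exact absurd ⟨β, Finset.mem_filter.2 ⟨hβ, hd⟩, hβS⟩ h1
          · exact le_rfl
        linarith
    · rw [if_neg hS]
      have := avoids_anti (Finset.subset_insert α F) (subset_refl S)
      linarith
  have h1 := subsetMean_mono (U := U) hp0 hp1 hpt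
  rw [subsetMean_sub, subsetMean_sub, subsetMean_sum, subsetMean_subset p hα] at h1
  simp only [avoids_union_of_disjoint (F := F₀) (α := α)
    (fun β hβ => (Finset.mem_filter.1 hβ).2)] at h1
  have h2 : ∑ β ∈ F₁, subsetMean U p (fun S => if α ∪ β ⊆ S then avoids F₀ S else 0)
      ≤ ∑ β ∈ F₁, p ^ (α ∪ β).card * subsetMean U p (avoids F₀) := by
    refine Finset.sum_le_sum fun β hβ => ?_
    rw [subsetMean_subset p (Finset.union_subset hα (hF β (Finset.mem_filter.1 hβ).1))]
    gcongr
    exact subsetMean_mono hp0 hp1 fun S => avoids_anti subset_rfl Finset.subset_union_right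
  rw [← Finset.sum_mul] at h2
  have h3 : subsetMean U p (avoids F) ≤ subsetMean U p (avoids F₀) :=
    subsetMean_mono hp0 hp1 fun S => avoids_anti (Finset.filter_subset _ _) subset_rfl
  have h4 : 0 ≤ subsetMean U p (avoids F₀) :=
    subsetMean_nonneg hp0 hp1 fun S => avoids_nonneg _ _
  have h5 := mul_le_mul_of_nonneg_right hsum h4
  have h6 := mul_le_mul_of_nonneg_left h3 (show 0 ≤ p ^ α.card / 2 by positivity)
  linarith

/-- A weak form of Janson's inequality. -/
lemma janson {U : Finset V} {p : ℝ} (hp0 : 0 ≤ p) (hp1 : p ≤ 1)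
    {I : Finset (Finset V)} (hI : ∀ α ∈ I, α ⊆ U)
    (hsum : ∀ α ∈ I, ∑ β ∈ I with β ≠ α ∧ ¬ Disjoint α β, p ^ (α ∪ β).card ≤ p ^ α.card / 2) :
    subsetMean U p (avoids I) ≤ Real.exp (-(∑ α ∈ I, p ^ α.card / 2)) := by
  suffices H : ∀ F ⊆ I, subsetMean U p (avoids F) ≤ Real.exp (-(∑ α ∈ F, p ^ α.card / 2)) from
    H I subset_rfl
  intro F
  induction F using Finset.induction_on with
  | empty =>
    intro _
    simpa [subsetMean_one] using
      subsetMean_mono (U := U) hp0 hp1 (g := fun _ => 1) (avoids_le_one ∅)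
  | insert α F hα ih =>
    intro hF
    have hαI : α ∈ I := hF (Finset.mem_insert_self _ _)
    have hFI : F ⊆ I := fun β hβ => hF (Finset.mem_insert_of_mem hβ)
    have hstep := janson_step hp0 hp1 (fun β hβ => hI β (hFI hβ)) (hI α hαI) (F := F) (by
      refine le_trans (Finset.sum_le_sum_of_subset_of_nonneg ?_ ?_) (hsum α hαI)
      · intro β hβ
        rw [Finset.mem_filter] at hβ ⊢
        exact ⟨hFI hβ.1, fun h => hα (h ▸ hβ.1), hβ.2⟩
      · intros; positivity)
    rw [Finset.sum_insert hα, neg_add, Real.exp_add]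
    refine hstep.trans (mul_le_mul ?_ (ih hFI)
      (subsetMean_nonneg hp0 hp1 fun S => avoids_nonneg _ _) (Real.exp_pos _).le)
    have := Real.add_one_le_exp (-(p ^ α.card / 2))
    linarith

end Janson

/-! ### Exponential sums -/

section ExpSums

open Finset

/-- The additive character `x ↦ exp (2πix)` of the real line. -/
noncomputable def expi (x : ℝ) : ℂ := Complex.exp (2 * Real.pi * x * Complex.I)

lemma expi_add (x y : ℝ) : expi (x + y) = expi x * expi y := by
  unfold expi; rw [← Complex.exp_add]; push_cast; ring_nf

lemma expi_zero : expi 0 = 1 := by simp [expi]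

lemma norm_expi (x : ℝ) : ‖expi x‖ = 1 := by
  unfold expi
  have := Complex.norm_exp_ofReal_mul_I (2 * Real.pi * x)
  push_cast at this
  exact this

lemma conj_expi (x : ℝ) : (starRingEnd ℂ) (expi x) = expi (-x) := by
  unfold expi; rw [← Complex.exp_conj]; simp [Complex.conj_ofNat]

lemma expi_intCast (n : ℤ) : expi n = 1 := by
  unfold expi
  rw [Complex.exp_eq_one_iff]
  exact ⟨n, by push_cast; ring⟩

lemma expi_sub_intCast (x : ℝ) (n : ℤ) : expi (x - n) = expi x := by
  have h := expi_add (x - n) n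
  rw [expi_intCast, mul_one, sub_add_cancel] at h
  exact h.symm

@[fun_prop]
lemma continuous_expi : Continuous expi := by unfold expi; fun_prop

lemma expi_sum {ι : Type*} (s : Finset ι) (f : ι → ℝ) :
    expi (∑ i ∈ s, f i) = ∏ i ∈ s, expi (f i) := by
  classical
  induction s using Finset.induction_on with
  | empty => simp [expi_zero]
  | insert a s ha ih => rw [sum_insert ha, prod_insert ha, expi_add, ih]

lemma integral_expi (n : ℤ) : ∫ α in (0 : ℝ)..1, expi (α * n) = if n = 0 then 1 else 0 := by
  split_ifs with h
  · simp [h, expi_zero]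
  · have hc : (2 * Real.pi * n * Complex.I : ℂ) ≠ 0 := by
      simp [Real.pi_ne_zero, h]
    have h2 := integral_exp_mul_complex (a := 0) (b := 1) hc
    have h3 : (fun α : ℝ => expi (α * n))
        = fun α : ℝ => Complex.exp (2 * Real.pi * n * Complex.I * α) := by
      funext α; unfold expi; push_cast; ring_nf
    rw [h3, h2]
    have h4 := expi_intCast n
    unfold expi at h4
    push_cast at h4
    simp [h4]

lemma integral_sum_expi {ι : Type*} (s : Finset ι) (w : ι → ℂ) (N : ι → ℤ) :
    ∫ α in (0 : ℝ)..1, ∑ i ∈ s, w i * expi (α * N i) = ∑ i ∈ s with N i = 0, w i := by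
  rw [intervalIntegral.integral_finsetSum]
  · rw [sum_filter]
    refine sum_congr rfl fun i _ => ?_
    rw [intervalIntegral.integral_const_mul, integral_expi]
    simp
  · intro i _
    exact Continuous.intervalIntegrable (by fun_prop) _ _

/-- Weyl's differencing step. -/
lemma norm_sq_expSum_le (S : Finset ℤ) (f : ℤ → ℝ) (u : ℤ) (P : ℕ) (hS : S ⊆ Ico u (u + P)) :
    ‖∑ x ∈ S, expi (f x)‖ ^ 2 ≤ S.card + 2 * ∑ h ∈ Ico 1 P,
      ‖∑ x ∈ S with x + (h : ℤ) ∈ S, expi (f (x + (h : ℤ)) - f x)‖ := by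
  set E : ℤ × ℤ → ℂ := fun z => expi (f z.2 - f z.1) with hE
  set D : ℕ → ℂ := fun h => ∑ x ∈ S with x + (h : ℤ) ∈ S, expi (f (x + (h : ℤ)) - f x) with hD
  have h1 : (‖∑ x ∈ S, expi (f x)‖ ^ 2 : ℂ) = ∑ z ∈ S ×ˢ S, E z := by
    rw [← Complex.conj_mul', map_sum, sum_mul_sum, sum_product]
    refine sum_congr rfl fun x _ => sum_congr rfl fun y _ => ?_
    rw [conj_expi, ← expi_add, hE]
    ring_nf
  have hlt : ∑ z ∈ S ×ˢ S with z.1 < z.2, E z = ∑ h ∈ Ico 1 P, D h := by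
    rw [hD, sum_sigma']
    refine sum_bij' (fun z _ => ⟨(z.2 - z.1).toNat, z.1⟩) (fun w _ => (w.2, w.2 + (w.1 : ℤ)))
      ?_ ?_ ?_ ?_ ?_
    · rintro ⟨x, y⟩ hz
      simp only [mem_filter, mem_product] at hz
      have hx := mem_Ico.1 (hS hz.1.1)
      have hy := mem_Ico.1 (hS hz.1.2)
      have : x + ((y - x).toNat : ℤ) = y := by omega
      simp only [mem_sigma, mem_Ico, mem_filter, this]
      refine ⟨by omega, hz.1⟩
    · rintro ⟨h, x⟩ hz
      simp only [mem_sigma, mem_Ico, mem_filter] at hz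
      simp only [mem_filter, mem_product]
      exact ⟨hz.2, by omega⟩
    · rintro ⟨x, y⟩ hz
      simp only [mem_filter, mem_product] at hz
      have : x + max (y - x) 0 = y := by omega
      simp [this]
    · rintro ⟨h, x⟩ hz
      simp
    · rintro ⟨x, y⟩ hz
      simp only [mem_filter, mem_product] at hz
      have : x + max (y - x) 0 = y := by omega
      simp [hE, this]
  have hgt : ∑ z ∈ S ×ˢ S with z.2 < z.1, E z = (starRingEnd ℂ) (∑ h ∈ Ico 1 P, D h) := by
    rw [← hlt, map_sum]
    refine sum_bij' (fun z _ => (z.2, z.1)) (fun z _ => (z.2, z.1)) ?_ ?_ ?_ ?_ ?_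
    · rintro ⟨x, y⟩ hz; simp only [mem_filter, mem_product] at hz ⊢; tauto
    · rintro ⟨x, y⟩ hz; simp only [mem_filter, mem_product] at hz ⊢; tauto
    · simp
    · simp
    · rintro ⟨x, y⟩ hz
      simp [hE, conj_expi]
  have heq : ∑ z ∈ S ×ˢ S with z.1 = z.2, E z = S.card := by
    rw [← mul_one (S.card : ℂ), ← nsmul_eq_mul, ← sum_const]
    refine sum_bij' (fun z _ => z.1) (fun x _ => (x, x)) ?_ ?_ ?_ ?_ ?_
    · rintro ⟨x, y⟩ hz; simp only [mem_filter, mem_product] at hz ⊢; tauto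
    · intro x hx; simp [hx]
    · rintro ⟨x, y⟩ hz
      simp only [mem_filter, mem_product] at hz
      simp [hz.2]
    · simp
    · rintro ⟨x, y⟩ hz
      simp only [mem_filter, mem_product] at hz
      simp [hE, hz.2, expi_zero]
  have hsplit : ∑ z ∈ S ×ˢ S, E z = S.card + ∑ h ∈ Ico 1 P, D h
      + (starRingEnd ℂ) (∑ h ∈ Ico 1 P, D h) := by
    rw [← hgt, ← hlt, ← heq, sum_filter, sum_filter, sum_filter, ← sum_add_distrib,
      ← sum_add_distrib]
    refine sum_congr rfl fun z _ => ?_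
    rcases lt_trichotomy z.1 z.2 with h | h | h
    · simp [h, h.ne, h.not_gt]
    · simp [h]
    · simp [h, h.ne', h.not_gt]
  have h2 : ‖(‖∑ x ∈ S, expi (f x)‖ ^ 2 : ℂ)‖ = ‖∑ x ∈ S, expi (f x)‖ ^ 2 := by simp
  rw [← h2, h1, hsplit]
  have h3 : ‖∑ h ∈ Ico 1 P, D h‖ ≤ ∑ h ∈ Ico 1 P, ‖D h‖ := norm_sum_le _ _
  calc _ ≤ ‖(S.card : ℂ)‖ + ‖∑ h ∈ Ico 1 P, D h‖ + ‖(starRingEnd ℂ) (∑ h ∈ Ico 1 P, D h)‖ :=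
        norm_add₃_le
    _ ≤ _ := by
        rw [RCLike.norm_conj, Complex.norm_natCast]
        linarith

lemma expSum_pow {ι : Type*} [Fintype ι] [DecidableEq ι] (S : Finset ℤ) (g : ℤ → ℤ) (θ : ℝ) :
    (∑ x ∈ S, expi (θ * g x)) ^ Fintype.card ι
      = ∑ z ∈ Fintype.piFinset (fun _ : ι => S), expi (θ * (∑ i, g (z i) : ℤ)) := by
  have h := prod_univ_sum (fun _ : ι => S) (fun _ x => expi (θ * g x))
  rw [prod_const, card_univ] at h
  rw [h]
  refine sum_congr rfl fun z _ => ?_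
  rw [← expi_sum]
  push_cast
  rw [mul_sum]

lemma norm_expSum_pow (S : Finset ℤ) (g : ℤ → ℤ) (θ : ℝ) (t : ℕ) :
    ((‖∑ x ∈ S, expi (θ * g x)‖ ^ (2 * t) : ℝ) : ℂ)
      = ∑ z ∈ Fintype.piFinset (fun _ : Fin t => S) ×ˢ Fintype.piFinset (fun _ : Fin t => S),
        expi (θ * (∑ i, g (z.1 i) - ∑ i, g (z.2 i) : ℤ)) := by
  have h := expSum_pow (ι := Fin t) S g θ
  rw [Fintype.card_fin] at h
  push_cast
  rw [pow_mul, ← Complex.mul_conj', mul_pow, ← map_pow, h, map_sum, sum_mul_sum, sum_product]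
  refine sum_congr rfl fun x _ => sum_congr rfl fun y _ => ?_
  rw [conj_expi, ← expi_add]
  push_cast
  ring_nf

/-- An even power of an exponential sum is a trigonometric polynomial whose coefficients are
bounded by the corresponding moment. -/
lemma exists_coeff_norm_expSum_pow (S : Finset ℤ) (g : ℤ → ℤ) (t : ℕ) (G : ℤ)
    (hG : ∀ x ∈ S, |g x| ≤ G) :
    ∃ r : ℤ → ℝ, (∀ y, 0 ≤ r y) ∧
      (∀ y, r y ≤ ∫ α in (0 : ℝ)..1, ‖∑ x ∈ S, expi (α * g x)‖ ^ (2 * t)) ∧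
      ∀ θ : ℝ, ((‖∑ x ∈ S, expi (θ * g x)‖ ^ (2 * t) : ℝ) : ℂ)
        = ∑ y ∈ Icc (-(2 * t * G)) (2 * t * G), r y * expi (θ * y) := by
  set Z := Fintype.piFinset (fun _ : Fin t => S) ×ˢ Fintype.piFinset (fun _ : Fin t => S) with hZ
  set φ : (Fin t → ℤ) × (Fin t → ℤ) → ℤ := fun z => ∑ i, g (z.1 i) - ∑ i, g (z.2 i) with hφ
  refine ⟨fun y => (Z.filter (fun z => φ z = y)).card, fun y => by positivity, fun y => ?_,
    fun θ => ?_⟩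
  · have h1 := integral_sum_expi Z (fun _ => 1) (fun z => φ z - y)
    rw [sum_const, nsmul_eq_mul, mul_one] at h1
    have h2 : (fun α : ℝ => ∑ z ∈ Z, (1 : ℂ) * expi (α * (φ z - y : ℤ)))
        = fun α : ℝ => ((‖∑ x ∈ S, expi (α * g x)‖ ^ (2 * t) : ℝ) : ℂ) * expi (-(α * y)) := by
      funext α
      rw [norm_expSum_pow, sum_mul]
      refine sum_congr rfl fun z _ => ?_
      rw [← expi_add, one_mul]
      push_cast [hφ]
      ring_nf
    rw [h2] at h1
    have h3 : ((Z.filter (fun z => φ z = y)).card : ℝ)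
        = ‖((Z.filter (fun z => φ z - y = 0)).card : ℂ)‖ := by
      simp [sub_eq_zero]
    beta_reduce
    rw [h3, ← h1]
    refine (intervalIntegral.norm_integral_le_integral_norm zero_le_one).trans_eq ?_
    refine intervalIntegral.integral_congr fun α _ => ?_
    simp only [norm_mul, norm_expi, mul_one, Complex.norm_real]
    rw [Real.norm_of_nonneg (by positivity)]
  · rw [norm_expSum_pow]
    have hmaps : ∀ z ∈ Z, φ z ∈ Icc (-(2 * t * G)) (2 * t * G) := by
      intro z hz
      rw [hZ, mem_product, Fintype.mem_piFinset, Fintype.mem_piFinset] at hz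
      have hb : ∀ w : Fin t → ℤ, (∀ i, w i ∈ S) → |∑ i, g (w i)| ≤ t * G := fun w hw => by
        refine (abs_sum_le_sum_abs _ _).trans ((sum_le_sum fun i _ => hG _ (hw i)).trans ?_)
        simp
      have h1 := abs_le.1 (hb _ hz.1)
      have h2 := abs_le.1 (hb _ hz.2)
      rw [mem_Icc]
      constructor <;> simp only [hφ] <;> linarith
    rw [← sum_fiberwise_of_maps_to hmaps]
    refine sum_congr rfl fun y _ => ?_
    rw [Complex.ofReal_natCast, ← nsmul_eq_mul, ← sum_const]
    refine sum_congr rfl fun z hz => ?_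
    rw [← (mem_filter.1 hz).2]

end ExpSums

section PolyDiff

open Finset

/-- Differencing lowers the degree of a polynomial. -/
lemma polyEval_add_sub {R : Type*} [CommRing R] (k : ℕ) (a : ℕ → R) (h x : R) :
    (∑ j ∈ range (k + 2), a j * (x + h) ^ j) - ∑ j ∈ range (k + 2), a j * x ^ j
      = h * ∑ i ∈ range (k + 1),
        (∑ j ∈ range (k + 2), if i < j then a j * (j.choose i : R) * h ^ (j - 1 - i) else 0)
          * x ^ i := by
  have key : ∀ j ∈ range (k + 2), a j * (x + h) ^ j - a j * x ^ j
      = ∑ i ∈ range (k + 1),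
        h * ((if i < j then a j * (j.choose i : R) * h ^ (j - 1 - i) else 0) * x ^ i) := by
    intro j hj
    rw [mem_range] at hj
    rw [add_pow, sum_range_succ]
    simp only [Nat.sub_self, pow_zero, mul_one, Nat.choose_self, Nat.cast_one]
    rw [mul_add, add_sub_cancel_right, mul_sum]
    have hsub : range j ⊆ range (k + 1) := range_subset_range.2 (by omega)
    rw [← sum_subset hsub]
    · refine sum_congr rfl fun i hi => ?_
      rw [mem_range] at hi
      rw [if_pos hi]
      have : h ^ (j - i) = h * h ^ (j - 1 - i) := by
        rw [← pow_succ']; congr 1; omega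
      rw [this]; ring
    · intro i _ hi
      rw [mem_range, not_lt] at hi
      rw [if_neg (by omega)]; ring
  rw [← sum_sub_distrib, sum_congr rfl key, sum_comm, mul_sum]
  refine sum_congr rfl fun i _ => ?_
  rw [sum_mul, mul_sum]

lemma polyEval_diff_leading {R : Type*} [CommRing R] (k : ℕ) (a : ℕ → R) (h : R) :
    (∑ j ∈ range (k + 2), if k < j then a j * (j.choose k : R) * h ^ (j - 1 - k) else 0)
      = (k + 1) * a (k + 1) := by
  rw [sum_range_succ, sum_eq_zero]
  · simp; ring
  · intro j hj
    rw [mem_range] at hj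
    rw [if_neg (by omega)]

end PolyDiff

section Counting

open Finset

lemma card_mul_le_of_dvd_sub {A : Finset ℤ} {Y q : ℕ} (hq : 0 < q)
    (hA : A ⊆ Icc (-(Y : ℤ)) Y) (h : ∀ y ∈ A, ∀ z ∈ A, (q : ℤ) ∣ y - z) :
    A.card * q ≤ 2 * Y + q := by
  have hq' : (0 : ℤ) < q := by exact_mod_cast hq
  have hc : A.card ≤ (range (2 * Y / q + 1)).card := by
    refine card_le_card_of_injOn (fun y => ((y + Y) / q).toNat) ?_ ?_
    · intro y hy
      have hy' := mem_Icc.1 (hA hy)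
      have h1 : (y + Y) / (q : ℤ) ≤ (2 * Y : ℤ) / q := Int.ediv_le_ediv hq' (by linarith)
      have h2 : ((2 * Y / q : ℕ) : ℤ) = (2 * Y : ℤ) / q := by push_cast; rfl
      have h4 : 0 ≤ (2 * Y : ℤ) / q := Int.ediv_nonneg (by positivity) hq'.le
      simp only [coe_range, Set.mem_Iio]
      omega
    · intro y hy z hz hyz
      have hy' := mem_Icc.1 (hA hy)
      have hz' := mem_Icc.1 (hA hz)
      have h1 : 0 ≤ (y + Y) / (q : ℤ) := Int.ediv_nonneg (by linarith) hq'.le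
      have h2 : 0 ≤ (z + Y) / (q : ℤ) := Int.ediv_nonneg (by linarith) hq'.le
      have h3 : (y + Y) / (q : ℤ) = (z + Y) / q := by
        simp only at hyz; omega
      have h4 : (y + Y) % (q : ℤ) = (z + Y) % q := by
        refine Int.emod_emod_of_dvd _ dvd_rfl |>.symm.trans ?_
        rw [Int.emod_emod_of_dvd _ dvd_rfl]
        refine (Int.emod_eq_emod_iff_emod_sub_eq_zero).2 (Int.emod_eq_zero_of_dvd ?_)
        have := h y hy z hz
        rwa [show y + Y - (z + Y) = y - z by ring]
      have h5 := Int.mul_ediv_add_emod (y + Y) q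
      have h6 := Int.mul_ediv_add_emod (z + Y) q
      rw [h3, h4] at h5
      linarith
  rw [card_range] at hc
  calc A.card * q ≤ (2 * Y / q + 1) * q := Nat.mul_le_mul_right _ hc
    _ = 2 * Y / q * q + q := by ring
    _ ≤ _ := by have := Nat.div_mul_le_self (2 * Y) q; omega

lemma card_pairs_mul_le {Y h₁ h₂ : ℕ} (h₁0 : 0 < h₁) (h₁Y : h₁ ≤ Y) (n : ℤ) :
    ((Icc (-(Y : ℤ)) Y ×ˢ Icc (-(Y : ℤ)) Y).filter
      (fun y => h₁ * y.1 + h₂ * y.2 = n)).card * h₁ ≤ 3 * Y * Nat.gcd h₁ h₂ := by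
  set B := (Icc (-(Y : ℤ)) Y ×ˢ Icc (-(Y : ℤ)) Y).filter (fun y => h₁ * y.1 + h₂ * y.2 = n)
  have hd : 0 < Nat.gcd h₁ h₂ := Nat.gcd_pos_of_pos_left _ h₁0
  obtain ⟨a, ha⟩ := Nat.gcd_dvd_left h₁ h₂
  obtain ⟨b, hb⟩ := Nat.gcd_dvd_right h₁ h₂
  set d := Nat.gcd h₁ h₂ with hdd
  have hcop : Nat.Coprime a b := by
    have := Nat.coprime_div_gcd_div_gcd (m := h₁) (n := h₂) hd
    rw [← hdd] at this
    rwa [ha, hb, Nat.mul_div_cancel_left _ hd, Nat.mul_div_cancel_left _ hd] at this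
  have ha0 : 0 < a := Nat.pos_of_ne_zero fun h => by simp [h] at ha; omega
  have hinj : Set.InjOn Prod.snd (B : Set (ℤ × ℤ)) := by
    rintro ⟨y, z⟩ hy ⟨y', z'⟩ hy' hz
    simp only [B, coe_filter, Set.mem_ofPred_eq] at hy hy' hz
    subst hz
    have : (h₁ : ℤ) * y = h₁ * y' := by linarith [hy.2, hy'.2]
    have := mul_left_cancel₀ (by exact_mod_cast h₁0.ne') this
    rw [this]
  have hcard := card_image_of_injOn hinj
  have h1 := card_mul_le_of_dvd_sub (A := B.image Prod.snd) (Y := Y) ha0 (by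
    intro z hz
    obtain ⟨y, hy, rfl⟩ := mem_image.1 hz
    exact (mem_product.1 (mem_filter.1 hy).1).2) (by
    intro z hz z' hz'
    obtain ⟨y, hy, rfl⟩ := mem_image.1 hz
    obtain ⟨y', hy', rfl⟩ := mem_image.1 hz'
    have e1 := (mem_filter.1 hy).2
    have e2 := (mem_filter.1 hy').2
    have e3 : (a : ℤ) * (y'.1 - y.1) = b * (y.2 - y'.2) := by
      have : (d : ℤ) * (a * (y'.1 - y.1)) = d * (b * (y.2 - y'.2)) := by
        rw [ha, hb] at e1 e2
        push_cast at e1 e2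
        linarith
      exact mul_left_cancel₀ (by exact_mod_cast hd.ne') this
    have hcop' : IsCoprime (a : ℤ) b := Nat.isCoprime_iff_coprime.2 hcop
    exact hcop'.dvd_of_dvd_mul_left ⟨_, e3.symm⟩)
  rw [hcard] at h1
  have haY : a ≤ Y := le_trans (by rw [ha]; exact Nat.le_mul_of_pos_left a hd) h₁Y
  calc B.card * h₁ = B.card * a * d := by rw [ha]; ring
    _ ≤ (2 * Y + a) * d := Nat.mul_le_mul_right _ h1
    _ ≤ 3 * Y * d := Nat.mul_le_mul_right _ (by omega)

lemma card_pairs_mul_max_le {Y h₁ h₂ : ℕ} (h₁0 : 0 < h₁) (h₂0 : 0 < h₂) (h₁Y : h₁ ≤ Y)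
    (h₂Y : h₂ ≤ Y) (n : ℤ) :
    ((Icc (-(Y : ℤ)) Y ×ˢ Icc (-(Y : ℤ)) Y).filter
      (fun y => h₁ * y.1 + h₂ * y.2 = n)).card * max h₁ h₂ ≤ 3 * Y * Nat.gcd h₁ h₂ := by
  rcases le_total h₂ h₁ with h | h
  · rw [max_eq_left h]; exact card_pairs_mul_le h₁0 h₁Y n
  · rw [max_eq_right h, Nat.gcd_comm]
    refine le_trans (Nat.mul_le_mul_right _ ?_) (card_pairs_mul_le h₂0 h₂Y n)
    refine card_le_card_of_injOn Prod.swap ?_ Prod.swap_injective.injOn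
    rintro ⟨y, z⟩ hy
    simp only [coe_filter, Set.mem_ofPred_eq, mem_product, Prod.swap] at hy ⊢
    exact ⟨hy.1.symm, by linarith [hy.2]⟩

lemma card_triples_mul_max_le {Y h₁ h₂ h₃ : ℕ} (h₁0 : 0 < h₁) (h₂0 : 0 < h₂)
    (h₁Y : h₁ ≤ Y) (h₂Y : h₂ ≤ Y) :
    ((Icc (-(Y : ℤ)) Y ×ˢ Icc (-(Y : ℤ)) Y ×ˢ Icc (-(Y : ℤ)) Y).filter
      (fun y => (h₁ : ℤ) * y.1 + h₂ * y.2.1 + h₃ * y.2.2 = 0)).card * max h₁ h₂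
      ≤ 9 * Y ^ 2 * Nat.gcd (Nat.gcd h₁ h₂) h₃ := by
  set I := Icc (-(Y : ℤ)) Y
  set B := (I ×ˢ I ×ˢ I).filter (fun y => (h₁ : ℤ) * y.1 + h₂ * y.2.1 + h₃ * y.2.2 = 0)
  set A := B.image (fun y => y.2.2) with hA
  have hd : 0 < Nat.gcd h₁ h₂ := Nat.gcd_pos_of_pos_left _ h₁0
  have hd₁ := Nat.gcd_dvd_left h₁ h₂
  have hd₂ := Nat.gcd_dvd_right h₁ h₂
  have hdY : Nat.gcd h₁ h₂ ≤ Y := (Nat.le_of_dvd h₁0 hd₁).trans h₁Y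
  have hpair := card_pairs_mul_max_le h₁0 h₂0 h₁Y h₂Y
  set d := Nat.gcd h₁ h₂
  have hg : 0 < Nat.gcd d h₃ := Nat.gcd_pos_of_pos_left _ hd
  obtain ⟨a, ha⟩ := Nat.gcd_dvd_left d h₃
  obtain ⟨b, hb⟩ := Nat.gcd_dvd_right d h₃
  set g := Nat.gcd d h₃ with hgg
  have hcop : Nat.Coprime a b := by
    have := Nat.coprime_div_gcd_div_gcd (m := d) (n := h₃) hg
    rw [← hgg] at this
    rwa [ha, hb, Nat.mul_div_cancel_left _ hg, Nat.mul_div_cancel_left _ hg] at this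
  have ha0 : 0 < a := Nat.pos_of_ne_zero fun h => by simp [h] at ha; omega
  have hdvd : ∀ z ∈ A, (a : ℤ) ∣ z := by
    intro z hz
    obtain ⟨y, hy, rfl⟩ := mem_image.1 hz
    have e1 := (mem_filter.1 hy).2
    obtain ⟨u, hu⟩ := hd₁
    obtain ⟨v, hv⟩ := hd₂
    have e2 : (a : ℤ) * (-(u * y.1 + v * y.2.1)) = b * y.2.2 := by
      have h3 : (g : ℤ) * (a * (-(u * y.1 + v * y.2.1))) = g * (b * y.2.2) := by
        have e3 : (h₁ : ℤ) = g * a * u := by rw [hu]; push_cast; rw [ha]; push_cast; ring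
        have e4 : (h₂ : ℤ) = g * a * v := by rw [hv]; push_cast; rw [ha]; push_cast; ring
        have e5 : (h₃ : ℤ) = g * b := by exact_mod_cast hb
        rw [e3, e4, e5] at e1
        linarith
      exact mul_left_cancel₀ (by exact_mod_cast hg.ne') h3
    have hcop' : IsCoprime (a : ℤ) b := Nat.isCoprime_iff_coprime.2 hcop
    exact hcop'.dvd_of_dvd_mul_left ⟨_, e2.symm⟩
  have hAc := card_mul_le_of_dvd_sub (A := A) (Y := Y) ha0 (by
    intro z hz
    obtain ⟨y, hy, rfl⟩ := mem_image.1 hz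
    exact (mem_product.1 (mem_product.1 (mem_filter.1 hy).1).2).2)
    (fun y hy z hz => dvd_sub (hdvd y hy) (hdvd z hz))
  have haY : a ≤ Y := le_trans (by
    calc a ≤ g * a := Nat.le_mul_of_pos_left a hg
      _ = d := ha.symm) hdY
  have hB : B.card * max h₁ h₂ ≤ A.card * (3 * Y * d) := by
    rw [card_eq_sum_card_image (fun y => y.2.2) B, sum_mul, ← smul_eq_mul, ← sum_const]
    refine sum_le_sum fun z hz => ?_
    refine le_trans (Nat.mul_le_mul_right _ ?_) (hpair (-(h₃ * z)))
    refine card_le_card_of_injOn (fun y => (y.1, y.2.1)) ?_ ?_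
    · rintro ⟨y₁, y₂, y₃⟩ hy
      simp only [B, coe_filter, Set.mem_ofPred_eq, mem_filter, mem_product] at hy ⊢
      obtain ⟨⟨⟨m1, m2, m3⟩, e⟩, rfl⟩ := hy
      exact ⟨⟨m1, m2⟩, by linarith⟩
    · rintro ⟨y₁, y₂, y₃⟩ hy ⟨z₁, z₂, z₃⟩ hz' h
      simp only [coe_filter, Set.mem_ofPred_eq] at hy hz'
      simp only [Prod.mk.injEq] at h
      simp [h.1, h.2, hy.2, hz'.2]
  have : A.card * (3 * Y * d) = A.card * a * (3 * Y * g) := by rw [ha]; ring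
  rw [this] at hB
  refine hB.trans ?_
  calc A.card * a * (3 * Y * g) ≤ (2 * Y + a) * (3 * Y * g) := Nat.mul_le_mul_right _ hAc
    _ ≤ (3 * Y) * (3 * Y * g) := Nat.mul_le_mul_right _ (by omega)
    _ = _ := by ring

lemma sum_inv_sq_le (n : ℕ) : ∑ d ∈ Ioc 0 n, (1 : ℝ) / d ^ 2 ≤ 2 := by
  suffices h : ∑ d ∈ Ioc 0 n, (1 : ℝ) / d ^ 2 ≤ 2 - 1 / n by
    have : (0 : ℝ) ≤ 1 / n := by positivity
    linarith
  induction n with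
  | zero => norm_num
  | succ n ih =>
    rw [sum_Ioc_succ_top (by omega)]
    rcases Nat.eq_zero_or_pos n with rfl | hn
    · norm_num
    · have hn' : (0 : ℝ) < n := by exact_mod_cast hn
      have : (1 : ℝ) / ((n + 1 : ℕ) : ℝ) ^ 2 ≤ 1 / n - 1 / ((n + 1 : ℕ) : ℝ) := by
        push_cast
        rw [div_sub_div _ _ hn'.ne' (by positivity),
          div_le_div_iff₀ (by positivity) (by positivity)]
        nlinarith
      linarith

lemma sum_dvd_inv_max_le {P d : ℕ} (hd : 0 < d) :
    ∑ h₁ ∈ Ioc 0 P with d ∣ h₁, ∑ h₂ ∈ Ioc 0 P with d ∣ h₂, (1 : ℝ) / max h₁ h₂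
      ≤ 2 * P / d ^ 2 := by
  have hd' : (0 : ℝ) < d := by exact_mod_cast hd
  have h1 : ∀ m : ℕ, (((Ioc 0 m).filter (fun h => d ∣ h)).card : ℝ) ≤ m / d := fun m => by
    rw [Nat.Ioc_filter_dvd_card_eq_div]; exact Nat.cast_div_le
  have h2 : ∀ a : ℕ, a ∈ (Ioc 0 P).filter (fun h => d ∣ h) →
      ∑ b ∈ Ioc 0 P with d ∣ b, (if b ≤ a then (1 : ℝ) / a else 0) ≤ 1 / d := by
    intro a ha
    have ha0 : (0 : ℝ) < a := by exact_mod_cast (mem_Ioc.1 (mem_filter.1 ha).1).1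
    rw [← sum_filter, sum_const, nsmul_eq_mul]
    have : ((((Ioc 0 P).filter (fun h => d ∣ h)).filter (fun b => b ≤ a)).card : ℝ) ≤ a / d := by
      refine le_trans ?_ (h1 a)
      exact_mod_cast card_le_card fun b hb => by
        simp only [mem_filter, mem_Ioc] at hb ⊢
        exact ⟨⟨hb.1.1.1, hb.2⟩, hb.1.2⟩
    calc _ ≤ (a : ℝ) / d * (1 / a) := by gcongr
      _ = 1 / d := by field_simp
  have h3 : ∀ a b : ℕ, (1 : ℝ) / max a b
      ≤ (if b ≤ a then (1 : ℝ) / a else 0) + if a ≤ b then (1 : ℝ) / b else 0 := by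
    intro a b
    have p1 : (0 : ℝ) ≤ 1 / a := by positivity
    have p2 : (0 : ℝ) ≤ 1 / b := by positivity
    rcases le_total a b with h | h
    · rw [max_eq_right (by exact_mod_cast h), if_pos h]; split_ifs <;> linarith
    · rw [max_eq_left (by exact_mod_cast h), if_pos h]; split_ifs <;> linarith
  have h4 : ∑ a ∈ Ioc 0 P with d ∣ a, ∑ b ∈ Ioc 0 P with d ∣ b,
      (if b ≤ a then (1 : ℝ) / a else 0) ≤ P / d ^ 2 := by
    refine (sum_le_sum h2).trans ?_
    rw [sum_const, nsmul_eq_mul]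
    calc _ ≤ (P : ℝ) / d * (1 / d) := by gcongr; exact h1 P
      _ = _ := by field_simp
  calc _ ≤ ∑ a ∈ Ioc 0 P with d ∣ a, ∑ b ∈ Ioc 0 P with d ∣ b,
        ((if b ≤ a then (1 : ℝ) / a else 0) + if a ≤ b then (1 : ℝ) / b else 0) :=
        sum_le_sum fun a _ => sum_le_sum fun b _ => h3 a b
    _ ≤ P / d ^ 2 + P / d ^ 2 := by
        simp only [sum_add_distrib]
        refine add_le_add h4 ?_
        rw [sum_comm]
        exact h4
    _ = _ := by ring

lemma sum_gcd_div_max_le (P : ℕ) :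
    ∑ h₁ ∈ Ioc 0 P, ∑ h₂ ∈ Ioc 0 P, ∑ h₃ ∈ Ioc 0 P,
      ((Nat.gcd (Nat.gcd h₁ h₂) h₃ : ℕ) : ℝ) / max h₁ h₂ ≤ 4 * P ^ 2 := by
  have h1 : ∀ h₁ ∈ Ioc 0 P, ∀ h₂ ∈ Ioc 0 P, ∀ h₃ ∈ Ioc 0 P,
      ((Nat.gcd (Nat.gcd h₁ h₂) h₃ : ℕ) : ℝ) / max h₁ h₂
        ≤ ∑ d ∈ Ioc 0 P, if d ∣ h₁ then (if d ∣ h₂ then (if d ∣ h₃ then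
          (d : ℝ) * (1 / max h₁ h₂) else 0) else 0) else 0 := by
    intro h₁ hh₁ h₂ _ h₃ _
    rw [mem_Ioc] at hh₁
    set g := Nat.gcd (Nat.gcd h₁ h₂) h₃ with hg
    have d1 : g ∣ h₁ := (Nat.gcd_dvd_left _ _).trans (Nat.gcd_dvd_left _ _)
    have d2 : g ∣ h₂ := (Nat.gcd_dvd_left _ _).trans (Nat.gcd_dvd_right _ _)
    have d3 : g ∣ h₃ := Nat.gcd_dvd_right _ _
    have hmem : g ∈ Ioc 0 P := mem_Ioc.2
      ⟨Nat.pos_of_dvd_of_pos d1 hh₁.1, (Nat.le_of_dvd hh₁.1 d1).trans hh₁.2⟩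
    refine le_trans ?_ (single_le_sum (fun d _ => ?_) hmem)
    · rw [if_pos d1, if_pos d2, if_pos d3]; exact (mul_one_div _ _).ge
    · split_ifs <;> positivity
  calc _ ≤ ∑ h₁ ∈ Ioc 0 P, ∑ h₂ ∈ Ioc 0 P, ∑ h₃ ∈ Ioc 0 P,
        ∑ d ∈ Ioc 0 P, if d ∣ h₁ then (if d ∣ h₂ then (if d ∣ h₃ then
          (d : ℝ) * (1 / max h₁ h₂) else 0) else 0) else 0 :=
        sum_le_sum fun a ha => sum_le_sum fun b hb => sum_le_sum fun c hc => h1 a ha b hb c hc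
    _ = ∑ d ∈ Ioc 0 P, ∑ h₁ ∈ Ioc 0 P, ∑ h₂ ∈ Ioc 0 P, ∑ h₃ ∈ Ioc 0 P,
        if d ∣ h₁ then (if d ∣ h₂ then (if d ∣ h₃ then
          (d : ℝ) * (1 / max h₁ h₂) else 0) else 0) else 0 := by
        conv_rhs => rw [sum_comm]
        refine sum_congr rfl fun a _ => ?_
        conv_rhs => rw [sum_comm]
        refine sum_congr rfl fun b _ => ?_
        exact sum_comm
    _ ≤ ∑ d ∈ Ioc 0 P, 2 * P ^ 2 * (1 / (d : ℝ) ^ 2) := by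
        refine sum_le_sum fun d hd => ?_
        rw [mem_Ioc] at hd
        have hd' : (0 : ℝ) < d := by exact_mod_cast hd.1
        have e : ∑ h₁ ∈ Ioc 0 P, ∑ h₂ ∈ Ioc 0 P, ∑ h₃ ∈ Ioc 0 P,
            (if d ∣ h₁ then (if d ∣ h₂ then (if d ∣ h₃ then
              (d : ℝ) * (1 / max h₁ h₂) else 0) else 0) else 0)
            = (((Ioc 0 P).filter (fun h => d ∣ h)).card : ℝ) * d *
              ∑ h₁ ∈ Ioc 0 P with d ∣ h₁, ∑ h₂ ∈ Ioc 0 P with d ∣ h₂, (1 : ℝ) / max h₁ h₂ := by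
          rw [sum_filter, mul_sum]
          refine sum_congr rfl fun a _ => ?_
          split_ifs with ha
          · rw [sum_filter, mul_sum]
            refine sum_congr rfl fun b _ => ?_
            split_ifs with hb
            · rw [← sum_filter, sum_const, nsmul_eq_mul]; ring
            · simp
          · simp
        rw [e, Nat.Ioc_filter_dvd_card_eq_div]
        calc _ ≤ ((P : ℝ) / d) * d * (2 * P / d ^ 2) := by
              gcongr
              · exact Nat.cast_div_le
              · exact sum_dvd_inv_max_le hd.1
          _ = _ := by field_simp
    _ ≤ _ := by
        rw [← mul_sum]
        nlinarith [sum_inv_sq_le P, sq_nonneg (P : ℝ)]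

lemma card_triple_solutions_le {P Y : ℕ} (hPY : P ≤ Y) :
    ((((Ioc 0 P ×ˢ Icc (-(Y : ℤ)) Y) ×ˢ (Ioc 0 P ×ˢ Icc (-(Y : ℤ)) Y) ×ˢ
        (Ioc 0 P ×ˢ Icc (-(Y : ℤ)) Y)).filter (fun v : (ℕ × ℤ) × (ℕ × ℤ) × (ℕ × ℤ) =>
      (v.1.1 : ℤ) * v.1.2 + v.2.1.1 * v.2.1.2 + v.2.2.1 * v.2.2.2 = 0)).card : ℝ)
      ≤ 36 * P ^ 2 * Y ^ 2 := by
  set I := Icc (-(Y : ℤ)) Y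
  set T := ((Ioc 0 P ×ˢ I) ×ˢ (Ioc 0 P ×ˢ I) ×ˢ (Ioc 0 P ×ˢ I)).filter
    (fun v : (ℕ × ℤ) × (ℕ × ℤ) × (ℕ × ℤ) =>
      (v.1.1 : ℤ) * v.1.2 + v.2.1.1 * v.2.1.2 + v.2.2.1 * v.2.2.2 = 0) with hT
  have hmaps : ∀ v ∈ T, (v.1.1, v.2.1.1, v.2.2.1) ∈ Ioc 0 P ×ˢ Ioc 0 P ×ˢ Ioc 0 P := by
    intro v hv
    simp only [hT, mem_filter, mem_product] at hv ⊢
    tauto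
  rw [card_eq_sum_card_fiberwise hmaps, Nat.cast_sum, sum_product]
  simp_rw [sum_product]
  have hb : ∀ a ∈ Ioc 0 P, ∀ b ∈ Ioc 0 P, ∀ c ∈ Ioc 0 P,
      (((T.filter (fun v => (v.1.1, v.2.1.1, v.2.2.1) = (a, b, c))).card : ℕ) : ℝ)
        ≤ 9 * Y ^ 2 * (((Nat.gcd (Nat.gcd a b) c : ℕ) : ℝ) / max a b) := by
    intro a ha b hb c hc
    rw [mem_Ioc] at ha hb hc
    have h1 := card_triples_mul_max_le (h₃ := c) ha.1 hb.1 (ha.2.trans hPY) (hb.2.trans hPY)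
    have h2 : (T.filter (fun v => (v.1.1, v.2.1.1, v.2.2.1) = (a, b, c))).card
        ≤ ((I ×ˢ I ×ˢ I).filter
          (fun y => (a : ℤ) * y.1 + b * y.2.1 + c * y.2.2 = 0)).card := by
      refine card_le_card_of_injOn (fun v => (v.1.2, v.2.1.2, v.2.2.2)) ?_ ?_
      · rintro ⟨⟨a', y₁⟩, ⟨b', y₂⟩, ⟨c', y₃⟩⟩ hv
        simp only [hT, coe_filter, Set.mem_ofPred_eq, mem_filter, mem_product,
          Prod.mk.injEq] at hv ⊢
        obtain ⟨⟨⟨⟨_, m1⟩, ⟨_, m2⟩, _, m3⟩, e⟩, rfl, rfl, rfl⟩ := hv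
        exact ⟨⟨m1, m2, m3⟩, e⟩
      · rintro ⟨⟨a₁, y₁⟩, ⟨b₁, y₂⟩, ⟨c₁, y₃⟩⟩ hv ⟨⟨a₂, z₁⟩, ⟨b₂, z₂⟩, ⟨c₂, z₃⟩⟩ hw h
        simp only [coe_filter, Set.mem_ofPred_eq, Prod.mk.injEq] at hv hw h
        simp only [Prod.mk.injEq]
        obtain ⟨_, rfl, rfl, rfl⟩ := hv
        obtain ⟨_, rfl, rfl, rfl⟩ := hw
        exact ⟨⟨rfl, h.1⟩, ⟨rfl, h.2.1⟩, rfl, h.2.2⟩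
    have hmax : (0 : ℝ) < ((max a b : ℕ) : ℝ) := by exact_mod_cast lt_max_of_lt_left ha.1
    rw [← mul_div_assoc, le_div_iff₀ hmax]
    have h3 := (Nat.mul_le_mul_right (max a b) h2).trans h1
    exact_mod_cast h3
  calc _ ≤ ∑ a ∈ Ioc 0 P, ∑ b ∈ Ioc 0 P, ∑ c ∈ Ioc 0 P,
        9 * (Y : ℝ) ^ 2 * (((Nat.gcd (Nat.gcd a b) c : ℕ) : ℝ) / max a b) :=
        sum_le_sum fun a ha => sum_le_sum fun b hb' => sum_le_sum fun c hc => hb a ha b hb' c hc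
    _ = 9 * (Y : ℝ) ^ 2 * ∑ a ∈ Ioc 0 P, ∑ b ∈ Ioc 0 P, ∑ c ∈ Ioc 0 P,
        ((Nat.gcd (Nat.gcd a b) c : ℕ) : ℝ) / max a b := by
        simp only [mul_sum]
    _ ≤ 9 * (Y : ℝ) ^ 2 * (4 * P ^ 2) := by gcongr; exact sum_gcd_div_max_le P
    _ = _ := by ring

end Counting

section MeanValue

open Finset

lemma integral_sum_cube_le {P Y : ℕ} (hPY : P ≤ Y) (r : ℕ → ℤ → ℝ) {J : ℝ} (hJ : 0 ≤ J)
    (hr0 : ∀ h y, 0 ≤ r h y) (hrJ : ∀ h ∈ Ico 1 P, ∀ y, r h y ≤ J) (B : ℕ → ℝ → ℝ)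
    (hB : ∀ h ∈ Ico 1 P, ∀ α : ℝ, ((B h α : ℝ) : ℂ)
      = ∑ y ∈ Icc (-(Y : ℤ)) Y, r h y * expi (h * α * y)) :
    ∫ α in (0 : ℝ)..1, (∑ h ∈ Ico 1 P, B h α) ^ 3 ≤ J ^ 3 * (36 * P ^ 2 * Y ^ 2) := by
  set W := Ico 1 P ×ˢ Icc (-(Y : ℤ)) Y with hW
  set N : (ℕ × ℤ) × (ℕ × ℤ) × (ℕ × ℤ) → ℤ := fun v =>
    (v.1.1 : ℤ) * v.1.2 + v.2.1.1 * v.2.1.2 + v.2.2.1 * v.2.2.2 with hN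
  set w : (ℕ × ℤ) × (ℕ × ℤ) × (ℕ × ℤ) → ℝ := fun v =>
    r v.1.1 v.1.2 * (r v.2.1.1 v.2.1.2 * r v.2.2.1 v.2.2.2) with hw
  have h1 : ∀ α : ℝ, (((∑ h ∈ Ico 1 P, B h α) ^ 3 : ℝ) : ℂ)
      = ∑ v ∈ W ×ˢ W ×ˢ W, (w v : ℂ) * expi (α * N v) := by
    intro α
    have h2 : ((∑ h ∈ Ico 1 P, B h α : ℝ) : ℂ)
        = ∑ z ∈ W, (r z.1 z.2 : ℂ) * expi (z.1 * α * z.2) := by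
      rw [hW, sum_product]
      push_cast
      exact sum_congr rfl fun h hh => hB h hh α
    rw [Complex.ofReal_pow, h2, pow_succ', pow_two, sum_mul_sum W W, ← sum_product',
      sum_mul_sum, ← sum_product']
    refine sum_congr rfl fun v _ => ?_
    have h3 : (α * (N v : ℤ) : ℝ) = v.1.1 * α * v.1.2 + (v.2.1.1 * α * v.2.1.2
        + v.2.2.1 * α * v.2.2.2) := by
      simp only [hN]; push_cast; ring
    rw [h3, expi_add, expi_add, hw]
    push_cast
    ring
  have h4 : (((∫ α in (0 : ℝ)..1, (∑ h ∈ Ico 1 P, B h α) ^ 3 : ℝ)) : ℂ)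
      = ((∑ v ∈ W ×ˢ W ×ˢ W with N v = 0, w v : ℝ) : ℂ) := by
    rw [← intervalIntegral.integral_ofReal]
    simp_rw [h1]
    rw [integral_sum_expi]
    push_cast
    rfl
  rw [Complex.ofReal_injective h4]
  have hsub : (W ×ˢ W ×ˢ W).filter (fun v => N v = 0) ⊆
      (((Ioc 0 P ×ˢ Icc (-(Y : ℤ)) Y) ×ˢ (Ioc 0 P ×ˢ Icc (-(Y : ℤ)) Y) ×ˢ
        (Ioc 0 P ×ˢ Icc (-(Y : ℤ)) Y)).filter (fun v : (ℕ × ℤ) × (ℕ × ℤ) × (ℕ × ℤ) =>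
      (v.1.1 : ℤ) * v.1.2 + v.2.1.1 * v.2.1.2 + v.2.2.1 * v.2.2.2 = 0)) := by
    have hI : Ico 1 P ⊆ Ioc 0 P := by
      intro x hx; rw [mem_Ico] at hx; rw [mem_Ioc]; omega
    have hWs := product_subset_product_left (t := Icc (-(Y : ℤ)) Y) hI
    exact filter_subset_filter _ (product_subset_product hWs (product_subset_product hWs hWs))
  have hcard := (Nat.cast_le (α := ℝ)).2 (card_le_card hsub)
  calc _ ≤ ∑ v ∈ W ×ˢ W ×ˢ W with N v = 0, J ^ 3 := by
        refine sum_le_sum fun v hv => ?_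
        simp only [mem_filter, mem_product, hW] at hv
        obtain ⟨⟨⟨a1, _⟩, ⟨a2, _⟩, a3, _⟩, _⟩ := hv
        have b1 := hrJ _ a1 v.1.2
        have b2 := hrJ _ a2 v.2.1.2
        have b3 := hrJ _ a3 v.2.2.2
        have c1 := hr0 v.1.1 v.1.2
        have c2 := hr0 v.2.1.1 v.2.1.2
        have c3 := hr0 v.2.2.1 v.2.2.2
        calc w v ≤ J * (J * J) := by
              simp only [hw]; gcongr
          _ = J ^ 3 := by ring
    _ ≤ _ := by
        rw [sum_const, nsmul_eq_mul, mul_comm]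
        gcongr
        exact hcard.trans (card_triple_solutions_le hPY)

/-- The value at `x` of the integer polynomial of degree at most `k` with coefficients `a`. -/
def intPoly (k : ℕ) (a : ℕ → ℤ) (x : ℤ) : ℤ := ∑ i ∈ range (k + 1), a i * x ^ i

/-- The coefficients of the difference quotient of `intPoly (k + 1) a` with step `h`. -/
def diffCoeff (k : ℕ) (a : ℕ → ℤ) (h : ℤ) (i : ℕ) : ℤ :=
  ∑ j ∈ range (k + 2), if i < j then a j * (j.choose i : ℤ) * h ^ (j - 1 - i) else 0

lemma intPoly_add_sub (k : ℕ) (a : ℕ → ℤ) (h x : ℤ) :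
    intPoly (k + 1) a (x + h) - intPoly (k + 1) a x = h * intPoly k (diffCoeff k a h) x :=
  polyEval_add_sub k a h x

lemma diffCoeff_self (k : ℕ) (a : ℕ → ℤ) (h : ℤ) : diffCoeff k a h k = (k + 1) * a (k + 1) :=
  polyEval_diff_leading k a h

lemma abs_diffCoeff_le {k c P : ℕ} {a : ℕ → ℤ} (ha : ∀ i ≤ k + 1, |a i| ≤ c * P ^ (k + 1 - i))
    {h : ℕ} (hh : h ≤ P) {i : ℕ} (hi : i ≤ k) :
    |diffCoeff k a h i| ≤ ((k + 2) * 2 ^ (k + 1) * (c + 1) : ℕ) * P ^ (k - i) := by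
  unfold diffCoeff
  have : ∀ j ∈ range (k + 2),
      |if i < j then a j * (j.choose i : ℤ) * (h : ℤ) ^ (j - 1 - i) else 0|
        ≤ 2 ^ (k + 1) * (c + 1) * P ^ (k - i) := by
    intro j hj
    rw [mem_range] at hj
    split_ifs with hij
    · rw [abs_mul, abs_mul, abs_pow, Nat.abs_cast, Nat.abs_cast]
      have h1 : (j.choose i : ℤ) ≤ 2 ^ (k + 1) := by
        have : j.choose i ≤ 2 ^ (k + 1) :=
          (Nat.choose_le_two_pow j i).trans (Nat.pow_le_pow_right (by norm_num) (by omega))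
        exact_mod_cast this
      have h2 : (h : ℤ) ^ (j - 1 - i) ≤ (P : ℤ) ^ (j - 1 - i) := by gcongr
      calc |a j| * (j.choose i : ℤ) * (h : ℤ) ^ (j - 1 - i)
          ≤ (c * P ^ (k + 1 - j)) * 2 ^ (k + 1) * (P : ℤ) ^ (j - 1 - i) := by
            gcongr
            exact ha j (by omega)
        _ = 2 ^ (k + 1) * c * P ^ (k - i) := by
            have : k - i = (k + 1 - j) + (j - 1 - i) := by omega
            rw [this, pow_add]; ring
        _ ≤ _ := by gcongr; linarith
    · rw [abs_zero]; positivity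
  refine (abs_sum_le_sum_abs _ _).trans ((sum_le_sum this).trans ?_)
  rw [sum_const, card_range, nsmul_eq_mul]
  push_cast
  apply le_of_eq; ring

lemma abs_intPoly_le {k c P : ℕ} {a : ℕ → ℤ} (ha : ∀ i ≤ k, |a i| ≤ c * P ^ (k - i)) {x : ℤ}
    (hx : |x| ≤ P) : |intPoly k a x| ≤ (k + 1) * c * P ^ k := by
  unfold intPoly
  have : ∀ i ∈ range (k + 1), |a i * x ^ i| ≤ c * P ^ k := by
    intro i hi
    rw [mem_range] at hi
    rw [abs_mul, abs_pow]
    calc |a i| * |x| ^ i ≤ (c * P ^ (k - i)) * P ^ i := by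
          gcongr
          exact ha i (by omega)
      _ = _ := by rw [mul_assoc, ← pow_add]; congr 2; omega
  refine (abs_sum_le_sum_abs _ _).trans ((sum_le_sum this).trans ?_)
  rw [sum_const, card_range, nsmul_eq_mul]
  push_cast
  apply le_of_eq; ring

lemma integral_norm_sq_expSum_linear (a : ℕ → ℤ) (ha : a 1 ≠ 0) (S : Finset ℤ) :
    ∫ α in (0 : ℝ)..1, ‖∑ x ∈ S, expi (α * intPoly 1 a x)‖ ^ (2 * 1) ≤ S.card := by
  have h1 : (((∫ α in (0 : ℝ)..1, ‖∑ x ∈ S, expi (α * intPoly 1 a x)‖ ^ (2 * 1) : ℝ)) : ℂ)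
      = (((Fintype.piFinset (fun _ : Fin 1 => S) ×ˢ Fintype.piFinset (fun _ : Fin 1 => S)).filter
        (fun z => ∑ i, intPoly 1 a (z.1 i) - ∑ i, intPoly 1 a (z.2 i) = 0)).card : ℝ) := by
    rw [← intervalIntegral.integral_ofReal]
    simp_rw [norm_expSum_pow]
    have := integral_sum_expi
      (Fintype.piFinset (fun _ : Fin 1 => S) ×ˢ Fintype.piFinset (fun _ : Fin 1 => S))
      (fun _ => 1) (fun z => ∑ i, intPoly 1 a (z.1 i) - ∑ i, intPoly 1 a (z.2 i))
    simp only [one_mul, sum_const, nsmul_eq_mul, mul_one] at this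
    rw [this]
    norm_cast
  rw [Complex.ofReal_injective h1, Nat.cast_le]
  refine card_le_card_of_injOn (fun z => z.1 0) ?_ ?_
  · intro z hz
    simp only [coe_filter, mem_product, Fintype.mem_piFinset, Set.mem_ofPred_eq] at hz
    exact hz.1.1 0
  · intro z hz z' hz' h
    simp only [coe_filter, Set.mem_ofPred_eq, univ_unique, sum_singleton, intPoly,
      sum_range_succ, range_zero, sum_empty] at hz hz'
    have e1 : a 1 * (z.1 0 - z.2 0) = 0 := by
      have := hz.2
      simp only [Fin.default_eq_zero] at this
      linear_combination this
    have e2 : a 1 * (z'.1 0 - z'.2 0) = 0 := by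
      have := hz'.2
      simp only [Fin.default_eq_zero] at this
      linear_combination this
    simp only [mul_eq_zero, ha, false_or] at e1 e2
    simp only at h
    refine Prod.ext (funext fun i => ?_) (funext fun i => ?_) <;>
      rw [Subsingleton.elim i 0] <;> linarith

lemma pow_sum_le_card_pow_mul_sum {ι : Type*} (n : ℕ) (s : Finset ι) (f : ι → ℝ)
    (hf : ∀ i ∈ s, 0 ≤ f i) :
    (∑ i ∈ s, f i) ^ (n + 1) ≤ (s.card : ℝ) ^ n * ∑ i ∈ s, f i ^ (n + 1) := by
  rcases s.eq_empty_or_nonempty with rfl | hs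
  · simp
  · have h0 : (0 : ℝ) < s.card := by exact_mod_cast hs.card_pos
    have h := pow_sum_div_card_le_sum_pow (s := s) (f := f) hf n
    rwa [div_le_iff₀' (by positivity)] at h

/-- Hua's mean value theorem, with a large even exponent and no loss. -/
theorem exists_mean_value (k : ℕ) (hk : 1 ≤ k) : ∃ t : ℕ, 1 ≤ t ∧ k ≤ 2 * t ∧
    ∀ c : ℕ, ∃ C : ℝ, 0 ≤ C ∧ ∀ P : ℕ, 1 ≤ P → ∀ a : ℕ → ℤ,
      (∀ i ≤ k, |a i| ≤ c * P ^ (k - i)) → a k ≠ 0 → ∀ S : Finset ℤ, S ⊆ Ico 0 (P : ℤ) →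
      (∫ α in (0 : ℝ)..1, ‖∑ x ∈ S, expi (α * intPoly k a x)‖ ^ (2 * t)) * P ^ k
        ≤ C * P ^ (2 * t) := by
  induction k, hk using Nat.le_induction with
  | base =>
    refine ⟨1, le_rfl, by norm_num, fun c => ⟨1, zero_le_one, fun P hP a _ ha S hS => ?_⟩⟩
    have h1 := integral_norm_sq_expSum_linear a ha S
    have h2 : (S.card : ℝ) ≤ P := by
      have := card_le_card hS
      rw [Int.card_Ico] at this
      exact_mod_cast (by simpa using this)
    calc _ ≤ (P : ℝ) * P ^ 1 := by gcongr; exact h1.trans h2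
      _ = _ := by ring
  | succ k hk ih =>
    obtain ⟨t, ht, hkt, ih⟩ := ih
    refine ⟨6 * t, by omega, by omega, fun c => ?_⟩
    set c' := (k + 2) * 2 ^ (k + 1) * (c + 1) with hc'
    obtain ⟨C', hC'0, hC'⟩ := ih c'
    set y0 := 2 * t * ((k + 1) * c') with hy0
    set u := 2 * t with hu
    refine ⟨2 ^ (3 * u) * (1 + 2 ^ (3 * u) * (36 * y0 ^ 2 * C' ^ 3)), by positivity,
      fun P hP a ha ha0 S hS => ?_⟩
    have hP0 : (0 : ℝ) < P := by exact_mod_cast hP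
    set Y := y0 * P ^ k with hY
    have hPY : P ≤ Y := by
      have h1 : 1 ≤ y0 := by
        have : 0 < y0 := by simp only [hy0, hc']; positivity
        exact this
      calc P = 1 * P ^ 1 := by ring
        _ ≤ y0 * P ^ k := Nat.mul_le_mul h1 (Nat.pow_le_pow_right hP hk)
    set g : ℕ → ℤ → ℤ := fun h => intPoly k (diffCoeff k a h) with hg
    set Sh : ℕ → Finset ℤ := fun h => S.filter (fun x => x + (h : ℤ) ∈ S) with hSh
    set B : ℕ → ℝ → ℝ := fun h α => ‖∑ x ∈ Sh h, expi ((h * α) * g h x)‖ with hB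
    set J := C' * P ^ u / P ^ k with hJ
    have hr : ∀ h : ℕ, ∃ r : ℤ → ℝ, (∀ y, 0 ≤ r y) ∧ (h ∈ Ico 1 P → ((∀ y, r y ≤ J) ∧
        ∀ α : ℝ, (((B h α) ^ u : ℝ) : ℂ) = ∑ y ∈ Icc (-(Y : ℤ)) Y, r y * expi (h * α * y))) := by
      intro h
      by_cases hh : h ∈ Ico 1 P
      · have hh' := mem_Ico.1 hh
        have hcoef : ∀ i ≤ k, |diffCoeff k a h i| ≤ c' * P ^ (k - i) :=
          fun i hi => abs_diffCoeff_le ha hh'.2.le hi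
        have hShP : Sh h ⊆ Ico 0 (P : ℤ) := (filter_subset _ _).trans hS
        have hlead : diffCoeff k a h k ≠ 0 := by
          rw [diffCoeff_self]
          exact mul_ne_zero (by positivity) ha0
        have hG : ∀ x ∈ Sh h, |g h x| ≤ (k + 1) * c' * P ^ k := by
          intro x hx
          have := mem_Ico.1 (hShP hx)
          exact abs_intPoly_le hcoef (abs_le.2 ⟨by linarith, by linarith⟩)
        obtain ⟨r, hr0, hr1, hr2⟩ := exists_coeff_norm_expSum_pow (Sh h) (g h) t _ hG
        refine ⟨r, hr0, fun _ => ⟨fun y => (hr1 y).trans ?_, fun α => ?_⟩⟩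
        · rw [hJ, le_div_iff₀ (by positivity)]
          exact hC' P hP _ hcoef hlead _ hShP
        · rw [hB, hr2 (h * α)]
          have : (2 * t * ((k + 1) * c' * P ^ k) : ℤ) = Y := by
            rw [hY, hy0, hu]; push_cast; ring
          rw [this]
      · exact ⟨0, fun _ => le_rfl, fun h' => absurd h' hh⟩
    choose r hr0 hr1 using hr
    have hJ0 : 0 ≤ J := by positivity
    have hcube := integral_sum_cube_le hPY r hJ0 hr0 (fun h hh => (hr1 h hh).1)
      (fun h α => B h α ^ u) (fun h hh => (hr1 h hh).2)
    have hcontB : ∀ h, Continuous (B h) := by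
      intro h
      simp only [hB]
      have := continuous_expi
      fun_prop
    have hpt : ∀ α : ℝ, ‖∑ x ∈ S, expi (α * intPoly (k + 1) a x)‖ ^ (2 * (6 * t))
        ≤ 2 ^ (3 * u) * (P ^ (3 * u) + 2 ^ (3 * u) * (P ^ (3 * u - 3) *
          (∑ h ∈ Ico 1 P, B h α ^ u) ^ 3)) := by
      intro α
      have h1 := norm_sq_expSum_le S (fun x => α * intPoly (k + 1) a x) 0 P (by simpa using hS)
      have h2 : (S.card : ℝ) ≤ P := by
        have := card_le_card hS
        rw [Int.card_Ico] at this
        exact_mod_cast (by simpa using this)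
      have h3 : ∀ h : ℕ, ‖∑ x ∈ S with x + (h : ℤ) ∈ S, expi (α * intPoly (k + 1) a (x + (h : ℤ))
          - α * intPoly (k + 1) a x)‖ = B h α := by
        intro h
        simp only [hB, hSh, hg]
        congr 1
        refine sum_congr rfl fun x _ => ?_
        congr 1
        rw [← mul_sub]
        have := congrArg (fun z : ℤ => (z : ℝ)) (intPoly_add_sub k a h x)
        simp only [Int.cast_sub, Int.cast_mul, Int.cast_natCast] at this
        rw [this]; ring
      simp only [h3] at h1
      have hB0 : ∀ h ∈ Ico 1 P, 0 ≤ B h α := fun h _ => norm_nonneg _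
      have hs0 : 0 ≤ ∑ h ∈ Ico 1 P, B h α := sum_nonneg hB0
      have h4 : (∑ h ∈ Ico 1 P, B h α) ^ u ≤ P ^ (u - 1) * ∑ h ∈ Ico 1 P, B h α ^ u := by
        have hu1 : u = (u - 1) + 1 := by omega
        have h5 := pow_sum_le_card_pow_mul_sum (u - 1) (Ico 1 P) (fun h => B h α) hB0
        rw [← hu1] at h5
        have h6 : (((Ico 1 P).card : ℕ) : ℝ) ≤ P := by
          rw [Nat.card_Ico]; exact_mod_cast Nat.sub_le P 1
        exact h5.trans (mul_le_mul_of_nonneg_right (pow_le_pow_left₀ (Nat.cast_nonneg _) h6 _)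
          (sum_nonneg fun h hh => pow_nonneg (hB0 h hh) _))
      calc ‖∑ x ∈ S, expi (α * intPoly (k + 1) a x)‖ ^ (2 * (6 * t))
          = (‖∑ x ∈ S, expi (α * intPoly (k + 1) a x)‖ ^ 2) ^ (3 * u) := by
            rw [← pow_mul]; congr 1; rw [hu]; ring
        _ ≤ (P + 2 * ∑ h ∈ Ico 1 P, B h α) ^ (3 * u) := by
            gcongr; exact h1.trans (by gcongr)
        _ ≤ 2 ^ (3 * u - 1) * (P ^ (3 * u) + (2 * ∑ h ∈ Ico 1 P, B h α) ^ (3 * u)) :=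
            add_pow_le hP0.le (by positivity) _
        _ ≤ 2 ^ (3 * u) * (P ^ (3 * u) + (2 * ∑ h ∈ Ico 1 P, B h α) ^ (3 * u)) := by
            gcongr
            · norm_num
            · omega
        _ ≤ _ := by
            rw [mul_pow]
            gcongr
            calc (∑ h ∈ Ico 1 P, B h α) ^ (3 * u)
                = ((∑ h ∈ Ico 1 P, B h α) ^ u) ^ 3 := by rw [← pow_mul, mul_comm]
              _ ≤ (P ^ (u - 1) * ∑ h ∈ Ico 1 P, B h α ^ u) ^ 3 := by gcongr
              _ = _ := by
                rw [mul_pow, ← pow_mul]; congr 2; omega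
    have hcont : Continuous fun α : ℝ => (∑ h ∈ Ico 1 P, B h α ^ u) ^ 3 := by fun_prop
    have hint : ∫ α in (0 : ℝ)..1, ‖∑ x ∈ S, expi (α * intPoly (k + 1) a x)‖ ^ (2 * (6 * t))
        ≤ 2 ^ (3 * u) * (P ^ (3 * u) + 2 ^ (3 * u) * (P ^ (3 * u - 3) *
          (J ^ 3 * (36 * P ^ 2 * Y ^ 2)))) := by
      have hce := continuous_expi
      refine (intervalIntegral.integral_mono_on zero_le_one
        (Continuous.intervalIntegrable (by fun_prop) _ _)
        (Continuous.intervalIntegrable (by fun_prop) _ _) (fun α _ => hpt α)).trans ?_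
      rw [intervalIntegral.integral_const_mul, intervalIntegral.integral_add
        (Continuous.intervalIntegrable (by fun_prop) _ _)
        (Continuous.intervalIntegrable (by fun_prop) _ _), intervalIntegral.integral_const_mul,
        intervalIntegral.integral_const_mul]
      simp only [intervalIntegral.integral_const, sub_zero, one_smul]
      gcongr
    have hJk : J * P ^ k = C' * P ^ u := by rw [hJ]; field_simp
    have hP1 : (1 : ℝ) ≤ P := by exact_mod_cast hP
    have e1 : (P : ℝ) ^ (3 * u) * P ^ (k + 1) ≤ P ^ (2 * (6 * t)) := by
      rw [← pow_add]
      exact pow_le_pow_right₀ hP1 (by omega)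
    have e2 : (P : ℝ) ^ (3 * u - 3) * (J ^ 3 * (36 * P ^ 2 * Y ^ 2)) * P ^ (k + 1)
        = 36 * y0 ^ 2 * C' ^ 3 * P ^ (2 * (6 * t)) := by
      have e3 : (P : ℝ) ^ (2 * (6 * t)) = P ^ (3 * u - 3) * P ^ 3 * (P ^ u) ^ 3 := by
        rw [← pow_mul, ← pow_add, ← pow_add]; congr 1; omega
      have e4 : C' ^ 3 * (P ^ u) ^ 3 = (J * P ^ k) ^ 3 := by rw [hJk]; ring
      rw [e3]
      calc _ = 36 * y0 ^ 2 * (J * P ^ k) ^ 3 * (P ^ (3 * u - 3) * P ^ 3) := by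
            rw [hY]; push_cast; ring
        _ = _ := by rw [← e4]; ring
    calc _ ≤ 2 ^ (3 * u) * (P ^ (3 * u) + 2 ^ (3 * u) * (P ^ (3 * u - 3) *
          (J ^ 3 * (36 * P ^ 2 * Y ^ 2)))) * P ^ (k + 1) := by gcongr
      _ = 2 ^ (3 * u) * (P ^ (3 * u) * P ^ (k + 1) + 2 ^ (3 * u) * (P ^ (3 * u - 3) *
          (J ^ 3 * (36 * P ^ 2 * Y ^ 2)) * P ^ (k + 1))) := by ring
      _ ≤ 2 ^ (3 * u) * (P ^ (2 * (6 * t)) + 2 ^ (3 * u) *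
          (36 * y0 ^ 2 * C' ^ 3 * P ^ (2 * (6 * t)))) := by rw [e2]; gcongr
      _ = _ := by ring

end MeanValue

section InverseWeyl

open Finset

lemma exists_pair_gap {H : Finset ℕ} {X W : ℕ} {δ : ℝ} (hH : H ⊆ range X)
    (hcard : δ * X ≤ H.card) (hW : 4 ≤ δ * W) (hW0 : 0 < W) (hWX : W ≤ X) :
    ∃ h ∈ H, ∃ h' ∈ H, h < h' ∧ δ * W / 4 ≤ (h' : ℝ) - h ∧ (h' : ℝ) - h ≤ W := by
  have hWr : (0 : ℝ) < W := by exact_mod_cast hW0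
  have hXr : (W : ℝ) ≤ X := by exact_mod_cast hWX
  have hmaps : ∀ h ∈ H, h / W ∈ range (X / W + 1) := by
    intro h hh
    have := mem_range.1 (hH hh)
    rw [mem_range]
    exact Nat.lt_succ_of_le (Nat.div_le_div_right this.le)
  have hδ : 0 < δ := by
    by_contra hc
    push Not at hc
    nlinarith
  have hsum : ∃ j ∈ range (X / W + 1), δ * W / 2 ≤ ((H.filter (fun h => h / W = j)).card : ℝ) := by
    by_contra hc
    push Not at hc
    have h1 : (H.card : ℝ)
        = ∑ j ∈ range (X / W + 1), ((H.filter (fun h => h / W = j)).card : ℝ) := by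
      rw [card_eq_sum_card_fiberwise hmaps]; push_cast; rfl
    have h2 : (H.card : ℝ) < ∑ j ∈ range (X / W + 1), δ * W / 2 := by
      rw [h1]; exact sum_lt_sum_of_nonempty (by simp) hc
    rw [sum_const, card_range, nsmul_eq_mul] at h2
    have h3 : (((X / W + 1 : ℕ)) : ℝ) ≤ 2 * X / W := by
      push_cast
      have : ((X / W : ℕ) : ℝ) ≤ X / W := Nat.cast_div_le
      have h4 : 1 ≤ (X : ℝ) / W := by rwa [le_div_iff₀ hWr, one_mul]
      calc _ ≤ (X : ℝ) / W + X / W := by linarith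
        _ = _ := by ring
    have h5 : (((X / W + 1 : ℕ)) : ℝ) * (δ * W / 2) ≤ 2 * X / W * (δ * W / 2) := by gcongr
    have h6 : 2 * X / W * (δ * W / 2) = δ * X := by field_simp
    linarith
  obtain ⟨j, _, hj⟩ := hsum
  set F := H.filter (fun h => h / W = j) with hF
  have hFne : F.Nonempty := by
    rw [← card_pos]
    have : (0 : ℝ) < F.card := by linarith
    exact_mod_cast this
  have hFs : F ⊆ Icc (F.min' hFne) (F.max' hFne) := fun x hx =>
    mem_Icc.2 ⟨F.min'_le x hx, F.le_max' x hx⟩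
  have h1 := card_le_card hFs
  rw [Nat.card_Icc] at h1
  have hmm : F.min' hFne ≤ F.max' hFne := F.min'_le _ (F.max'_mem _)
  have h2 : (F.card : ℝ) ≤ F.max' hFne - F.min' hFne + 1 := by
    have : F.card + F.min' hFne ≤ F.max' hFne + 1 := by omega
    have : (F.card : ℝ) + F.min' hFne ≤ F.max' hFne + 1 := by exact_mod_cast this
    linarith
  have m1 := mem_filter.1 (F.min'_mem hFne)
  have m2 := mem_filter.1 (F.max'_mem hFne)
  refine ⟨_, m1.1, _, m2.1, ?_, by linarith, ?_⟩
  · have : (F.min' hFne : ℝ) < F.max' hFne := by linarith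
    exact_mod_cast this
  · have d1 := Nat.div_add_mod (F.min' hFne) W
    have d2 := Nat.div_add_mod (F.max' hFne) W
    have d3 := Nat.mod_lt (F.max' hFne) hW0
    rw [m1.2] at d1
    rw [m2.2] at d2
    have : F.max' hFne ≤ F.min' hFne + W := by omega
    have : (F.max' hFne : ℝ) ≤ F.min' hFne + W := by exact_mod_cast this
    linarith

/-- If many multiples of `β` are close to integers then `β` is close to a rational number with
small denominator. -/
lemma exists_rational_approx {H : Finset ℕ} {X W₀ : ℕ} {δ η β : ℝ} (hδ : 0 < δ) (hη : 0 ≤ η)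
    (hH : H ⊆ range X) (hcard : δ * X ≤ H.card) (hW₀ : 4 ≤ δ * W₀) (hW₀X : W₀ ≤ X)
    (h1 : 2 * η * W₀ < δ / 16) (h2 : 2 * η * W₀ ≤ 1 / 4) (h3 : η ≤ δ / 32)
    (hβ : ∀ h ∈ H, ∃ b : ℤ, |h * β - b| ≤ η) :
    ∃ q : ℕ, 1 ≤ q ∧ q ≤ W₀ ∧ ∃ b : ℤ, |q * β - b| ≤ 8 * η * q / (δ * X) := by
  have hW₀p : 0 < W₀ := by
    rcases Nat.eq_zero_or_pos W₀ with h | h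
    · subst h; norm_num at hW₀
    · exact h
  have hXp : (0 : ℝ) < X := by exact_mod_cast hW₀p.trans_le hW₀X
  have hdiff : ∀ h ∈ H, ∀ h' ∈ H, ∃ b : ℤ, |((h' : ℝ) - h) * β - b| ≤ 2 * η := by
    intro h hh h' hh'
    obtain ⟨b, hb⟩ := hβ h hh
    obtain ⟨b', hb'⟩ := hβ h' hh'
    refine ⟨b' - b, ?_⟩
    rw [abs_le] at *
    push_cast
    constructor <;> linarith [hb.1, hb.2, hb'.1, hb'.2]
  obtain ⟨x, hx, x', hx', hlt, hq1, hq2⟩ := exists_pair_gap hH hcard hW₀ hW₀p hW₀X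
  obtain ⟨b, hb⟩ := hdiff x hx x' hx'
  have hqc : ((x' - x : ℕ) : ℝ) = (x' : ℝ) - x := Nat.cast_sub hlt.le
  refine ⟨x' - x, by omega, by exact_mod_cast hqc.trans_le hq2, b, ?_⟩
  rw [hqc]
  set q : ℝ := (x' : ℝ) - x with hq
  set κ := |q * β - b| with hκ
  have hq0 : 0 < q := by rw [← hqc]; exact_mod_cast Nat.sub_pos_of_lt hlt
  have key : ∀ h ∈ H, ∀ h' ∈ H, h < h' → ((h' : ℝ) - h) * κ ≤ 1 / 2 →
      ((h' : ℝ) - h) * κ ≤ 2 * η * q := by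
    intro h hh h' hh' hl hg
    obtain ⟨a, ha⟩ := hdiff h hh h' hh'
    have hg0 : 0 < (h' : ℝ) - h := by
      have : (h : ℝ) < h' := by exact_mod_cast hl
      linarith
    set g : ℝ := (h' : ℝ) - h with hgdef
    have e1 : |q * (g * β - a)| ≤ 2 * η * q := by
      rw [abs_mul, abs_of_pos hq0]; nlinarith
    have e2 : |g * (q * β - b)| = g * κ := by rw [abs_mul, abs_of_pos hg0]
    have e3 : |q * a - g * b| < 1 := by
      have : q * a - g * b = g * (q * β - b) - q * (g * β - a) := by ring
      rw [this]
      have : 2 * η * q ≤ 2 * η * W₀ := by gcongr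
      calc _ ≤ |g * (q * β - b)| + |q * (g * β - a)| := abs_sub _ _
        _ < 1 := by linarith
    have e4 : q * a - g * b = 0 := by
      have hz : ((((x' : ℤ) - x) * a - ((h' : ℤ) - h) * b : ℤ) : ℝ) = q * a - g * b := by
        push_cast; rfl
      rw [← hz] at e3 ⊢
      have : |((x' : ℤ) - x) * a - ((h' : ℤ) - h) * b| < 1 := by exact_mod_cast e3
      rw [Int.abs_lt_one_iff.1 this]; simp
    have e5 : g * (q * β - b) = q * (g * β - a) := by linear_combination e4
    rw [← e2, e5]; exact e1
  have hκ0 : 0 ≤ κ := abs_nonneg _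
  by_cases hc : X * κ ≤ 1 / 2
  · have hWX : 4 ≤ δ * X := hW₀.trans (by gcongr)
    obtain ⟨h, hh, h', hh', hl, hg1, hg2⟩ :=
      exists_pair_gap hH hcard hWX (hW₀p.trans_le hW₀X) le_rfl
    have := key h hh h' hh' hl ((mul_le_mul_of_nonneg_right hg2 hκ0).trans hc)
    rw [le_div_iff₀ (by positivity)]
    have := mul_le_mul_of_nonneg_right hg1 hκ0
    nlinarith
  · exfalso
    push Not at hc
    have hκp : 0 < κ := by
      rcases hκ0.eq_or_lt with h | h
      · rw [← h] at hc; norm_num at hc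
      · exact h
    set W := ⌊1 / (2 * κ)⌋₊ with hW
    have hWle : (W : ℝ) ≤ 1 / (2 * κ) := Nat.floor_le (by positivity)
    have hWκ : W * κ ≤ 1 / 2 := by
      rw [le_div_iff₀ (by positivity)] at hWle; linarith
    have hκη : κ ≤ 2 * η := hb
    have hηδ : 4 ≤ δ * (1 / (4 * κ)) := by
      rw [mul_one_div, le_div_iff₀ (by positivity)]; linarith
    have hδW₀ : δ ≤ 4 := by
      by_contra hcon
      push Not at hcon
      have : (H.card : ℝ) ≤ X := by
        have := card_le_card hH
        rw [card_range] at this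
        exact_mod_cast this
      nlinarith
    have hbig : 1 ≤ 1 / (4 * κ) := by
      by_contra hcon
      push Not at hcon
      nlinarith
    have h4κ : 1 / (2 * κ) = 2 * (1 / (4 * κ)) := by field_simp; norm_num
    have hWge : 1 / (4 * κ) ≤ W := by
      have := Nat.lt_floor_add_one (1 / (2 * κ))
      rw [← hW] at this
      linarith
    have hWδ : 4 ≤ δ * W := hηδ.trans (by gcongr)
    have hWp : 0 < W := by
      have : (0 : ℝ) < W := by linarith
      exact_mod_cast this
    have hWX : W ≤ X := by
      have : (W : ℝ) ≤ X := by
        refine hWle.trans ?_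
        rw [div_le_iff₀ (by positivity)]; linarith
      exact_mod_cast this
    obtain ⟨h, hh, h', hh', hl, hg1, hg2⟩ := exists_pair_gap hH hcard hWδ hWp hWX
    have hk := key h hh h' hh' hl ((mul_le_mul_of_nonneg_right hg2 hκ0).trans hWκ)
    have h5 : 2 * η * q ≤ 2 * η * W₀ := by gcongr
    have h6 : δ / 16 ≤ δ * W / 4 * κ := by
      rw [div_le_iff₀ (by positivity)] at hWge
      nlinarith
    have := mul_le_mul_of_nonneg_right hg1 hκ0
    linarith

lemma four_mul_abs_le_norm_expi_sub_one (x : ℝ) : 4 * |x - round x| ≤ ‖expi x - 1‖ := by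
  set y := x - round x with hy
  have h1 : expi x = expi y := (expi_sub_intCast x (round x)).symm
  have h2 : |y| ≤ 1 / 2 := abs_sub_round x
  have h3 : ‖expi y - 1‖ = ‖2 * Real.sin (Real.pi * y)‖ := by
    have := Complex.norm_exp_I_mul_ofReal_sub_one (2 * Real.pi * y)
    rw [show 2 * Real.pi * y / 2 = Real.pi * y by ring] at this
    rw [← this, expi]
    congr 3
    push_cast; ring
  have h4 : |Real.sin (Real.pi * y)| = Real.sin (Real.pi * |y|) := by
    rcases abs_cases y with ⟨h, h'⟩ | ⟨h, h'⟩
    · rw [h, abs_of_nonneg]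
      exact Real.sin_nonneg_of_nonneg_of_le_pi (by positivity) (by nlinarith [Real.pi_pos])
    · rw [h, mul_neg, Real.sin_neg, abs_of_nonpos]
      exact Real.sin_nonpos_of_nonpos_of_neg_pi_le (by nlinarith [Real.pi_pos])
        (by nlinarith [Real.pi_pos])
  have h5 := Real.mul_le_sin (x := Real.pi * |y|) (by positivity) (by nlinarith [Real.pi_pos])
  rw [h1, h3, norm_mul, Real.norm_eq_abs, Real.norm_eq_abs, h4, abs_two]
  have h6 : 2 / Real.pi * (Real.pi * |y|) = 2 * |y| := by
    field_simp
  linarith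

lemma norm_geom_expSum_le (a : ℝ) (u v : ℤ) :
    4 * |a - round a| * ‖∑ x ∈ Ico u v, expi (a * x)‖ ≤ 2 := by
  rcases le_or_gt v u with h | h
  · simp [h]
  have key : ∀ n : ℕ, (∑ x ∈ Ico u (u + n), expi (a * x)) * (expi a - 1)
      = expi (a * (u + n)) - expi (a * u) := by
    intro n
    induction n with
    | zero => simp
    | succ n ih =>
      have : Ico u (u + (n + 1 : ℕ)) = insert (u + n : ℤ) (Ico u (u + n)) := by
        ext x; simp only [mem_Ico, mem_insert]; push_cast; omega
      rw [this, sum_insert (by simp), add_mul, ih, mul_sub, ← expi_add]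
      push_cast
      ring_nf
  obtain ⟨n, rfl⟩ : ∃ n : ℕ, v = u + n := ⟨(v - u).toNat, by omega⟩
  calc _ ≤ ‖expi a - 1‖ * ‖∑ x ∈ Ico u (u + (n : ℤ)), expi (a * x)‖ := by
        gcongr; exact four_mul_abs_le_norm_expi_sub_one a
    _ = ‖expi (a * (u + n)) - expi (a * u)‖ := by rw [← key, norm_mul, mul_comm]
    _ ≤ ‖expi (a * (u + n))‖ + ‖expi (a * u)‖ := norm_sub_le _ _
    _ = 2 := by rw [norm_expi, norm_expi]; norm_num

end InverseWeyl

section InverseWeyl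

open Finset

lemma norm_expSum_le_card {ι : Type*} (S : Finset ι) (f : ι → ℝ) :
    ‖∑ x ∈ S, expi (f x)‖ ≤ S.card := by
  refine (norm_sum_le _ _).trans ?_
  simp [norm_expi]

lemma norm_expSum_Ico_le {u v : ℤ} {P : ℕ} (h : v - u ≤ P) (f : ℤ → ℝ) :
    ‖∑ x ∈ Ico u v, expi (f x)‖ ≤ P := by
  refine (norm_expSum_le_card _ _).trans ?_
  rw [Int.card_Ico]
  exact_mod_cast (by omega : (v - u).toNat ≤ P)

lemma many_large_differences {ε : ℝ} {P : ℕ} (hP : 1 ≤ P) (hP2 : 2 ≤ ε ^ 2 * P) {f : ℤ → ℝ}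
    {u v : ℤ} (huv : v - u ≤ P) (hε : 0 < ε) (hT : ε * P ≤ ‖∑ x ∈ Ico u v, expi (f x)‖) :
    ε ^ 2 / 8 * P ≤ ((Ico 1 P).filter (fun h : ℕ =>
      ε ^ 2 / 8 * P ≤ ‖∑ x ∈ Ico u (v - h), expi (f (x + (h : ℤ)) - f x)‖)).card := by
  have hP0 : (0 : ℝ) < P := by exact_mod_cast hP
  set T : ℕ → ℝ := fun h => ‖∑ x ∈ Ico u (v - h), expi (f (x + (h : ℤ)) - f x)‖ with hTd
  set H := (Ico 1 P).filter (fun h : ℕ => ε ^ 2 / 8 * P ≤ T h) with hH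
  have h1 := norm_sq_expSum_le (Ico u v) f u P (by
    intro x hx; rw [mem_Ico] at hx ⊢; omega)
  have h2 : ∀ h ∈ Ico 1 P, ‖∑ x ∈ Ico u v with x + (h : ℤ) ∈ Ico u v,
      expi (f (x + (h : ℤ)) - f x)‖ = T h := by
    intro h _
    simp only [hTd]
    congr 2
    ext x
    simp only [mem_filter, mem_Ico]
    omega
  rw [sum_congr rfl h2] at h1
  have h3 : ((Ico u v).card : ℝ) ≤ P := by
    rw [Int.card_Ico]; exact_mod_cast (by omega : (v - u).toNat ≤ P)
  have h4 : ∑ h ∈ Ico 1 P, T h ≤ H.card * P + P * (ε ^ 2 / 8 * P) := by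
    rw [← sum_filter_add_sum_filter_not (Ico 1 P) (fun h : ℕ => ε ^ 2 / 8 * P ≤ T h)]
    refine add_le_add ?_ ?_
    · calc _ ≤ ∑ h ∈ H, (P : ℝ) :=
            sum_le_sum fun h _ => norm_expSum_Ico_le (by omega) _
        _ = _ := by rw [sum_const, nsmul_eq_mul]
    · calc _ ≤ ∑ h ∈ (Ico 1 P).filter (fun h : ℕ => ¬ ε ^ 2 / 8 * P ≤ T h), ε ^ 2 / 8 * P := by
            refine sum_le_sum fun h hh => ?_
            exact (not_le.1 (mem_filter.1 hh).2).le
        _ ≤ _ := by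
            rw [sum_const, nsmul_eq_mul]
            gcongr
            refine (card_filter_le _ _).trans ?_
            rw [Nat.card_Ico]; omega
  have h5 : (ε * P) ^ 2 ≤ ‖∑ x ∈ Ico u v, expi (f x)‖ ^ 2 := by gcongr
  have h6 : (ε * P) ^ 2 ≤ P + 2 * (H.card * P + P * (ε ^ 2 / 8 * P)) := by linarith
  by_contra hc
  push Not at hc
  have h7 : (H.card : ℝ) * P < ε ^ 2 / 8 * P * P := by gcongr
  have h8 : 2 * P ≤ ε ^ 2 * P * P := by gcongr
  nlinarith

/-- If the Weyl sum is large then the leading coefficient has a good rational approximation with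
bounded denominator. -/
theorem exists_inverse_weyl (k : ℕ) (hk : 1 ≤ k) : ∀ ε : ℝ, 0 < ε → ∃ Q : ℕ, 1 ≤ Q ∧
    ∀ P : ℕ, 1 ≤ P → ∀ a : ℕ → ℝ, ∀ u v : ℤ, v - u ≤ P →
      ε * P ≤ ‖∑ x ∈ Ico u v, expi (∑ i ∈ range (k + 1), a i * x ^ i)‖ →
      ∃ q : ℕ, 1 ≤ q ∧ q ≤ Q ∧ ∃ b : ℤ, |q * a k - b| ≤ Q / P ^ k := by
  induction k, hk using Nat.le_induction with
  | base =>
    intro ε hε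
    refine ⟨⌈1 / (2 * ε)⌉₊ + 1, by omega, fun P hP a u v huv hT => ⟨1, le_rfl, by omega,
      round (a 1), ?_⟩⟩
    have hP0 : (0 : ℝ) < P := by exact_mod_cast hP
    have h1 : ‖∑ x ∈ Ico u v, expi (∑ i ∈ range (1 + 1), a i * (x : ℝ) ^ i)‖
        = ‖∑ x ∈ Ico u v, expi (a 1 * x)‖ := by
      have : ∀ x : ℤ, expi (∑ i ∈ range (1 + 1), a i * (x : ℝ) ^ i)
          = expi (a 0) * expi (a 1 * x) := by
        intro x; rw [← expi_add]; simp [sum_range_succ]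
      simp_rw [this]
      rw [← mul_sum, norm_mul, norm_expi, one_mul]
    rw [h1] at hT
    have h2 := norm_geom_expSum_le (a 1) u v
    have h3 : 4 * |a 1 - round (a 1)| * (ε * P) ≤ 2 := le_trans (by gcongr) h2
    rw [Nat.cast_one, one_mul, pow_one, le_div_iff₀ hP0]
    push_cast
    have h4 := Nat.le_ceil (1 / (2 * ε))
    have h5 : |a 1 - round (a 1)| * P ≤ 1 / (2 * ε) := by
      rw [le_div_iff₀ (by positivity)]; linarith
    linarith
  | succ k hk ih =>
    intro ε hε
    set δ := ε ^ 2 / 8 with hδ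
    have hδ0 : 0 < δ := by positivity
    obtain ⟨Q, hQ1, hQ⟩ := ih δ hδ0
    set W₀ := ⌈4 / δ⌉₊ with hW₀
    have hW₀' : 4 ≤ δ * W₀ := by
      have := Nat.le_ceil (4 / δ)
      rw [div_le_iff₀ hδ0] at this
      linarith
    set D : ℝ := Q.factorial * Q with hD
    set P₀ := W₀ + ⌈32 * D * (W₀ + 1) / δ⌉₊ + ⌈8 * D * W₀⌉₊ + ⌈2 / ε ^ 2⌉₊ + 1 with hP₀
    set Q' := W₀ * (Q.factorial * (k + 1)) + ⌈8 * D * W₀ / δ⌉₊ + (P₀ + 1) ^ (k + 1) with hQ'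
    have hQ'1 : 1 ≤ Q' := by
      have := Nat.one_le_pow (k + 1) (P₀ + 1) (by omega)
      omega
    refine ⟨Q', hQ'1, fun P hP a u v huv hT => ?_⟩
    have hP0 : (0 : ℝ) < P := by exact_mod_cast hP
    rcases lt_or_ge P P₀ with hPP | hPP
    · refine ⟨1, le_rfl, hQ'1, round (a (k + 1)), ?_⟩
      rw [Nat.cast_one, one_mul]
      refine (abs_sub_round _).trans ?_
      have : (1 : ℝ) ≤ Q' / P ^ (k + 1) := by
        rw [le_div_iff₀ (by positivity), one_mul]
        have : P ^ (k + 1) ≤ (P₀ + 1) ^ (k + 1) := Nat.pow_le_pow_left (by omega) _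
        have : P ^ (k + 1) ≤ Q' := by omega
        exact_mod_cast this
      linarith
    have hPr : (P₀ : ℝ) ≤ P := by exact_mod_cast hPP
    have c1 := Nat.le_ceil (32 * D * (W₀ + 1) / δ)
    have c2 := Nat.le_ceil (8 * D * W₀)
    have c3 := Nat.le_ceil (2 / ε ^ 2)
    rw [hP₀] at hPr
    push_cast at hPr
    have hWnn : (0 : ℝ) ≤ W₀ := Nat.cast_nonneg _
    have hD0 : 0 ≤ D := by positivity
    have hc1nn := Nat.cast_nonneg (α := ℝ) ⌈32 * D * (W₀ + 1) / δ⌉₊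
    have hc2nn := Nat.cast_nonneg (α := ℝ) ⌈8 * D * W₀⌉₊
    have hc3nn := Nat.cast_nonneg (α := ℝ) ⌈2 / ε ^ 2⌉₊
    have hP1 : 32 * D * (W₀ + 1) / δ + 1 ≤ P := by linarith
    have hP2 : 8 * D * W₀ ≤ P := by linarith
    have hP3 : 2 ≤ ε ^ 2 * P := by
      have : 2 / ε ^ 2 ≤ P := by linarith
      rw [div_le_iff₀ (by positivity)] at this
      linarith
    have hW₀P : W₀ ≤ P := by
      have : (W₀ : ℝ) ≤ P := by linarith
      exact_mod_cast this
    have hmany := many_large_differences hP hP3 huv hε hT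
    set H := (Ico 1 P).filter (fun h : ℕ => ε ^ 2 / 8 * P ≤
      ‖∑ x ∈ Ico u (v - h), expi (∑ i ∈ range (k + 1 + 1), a i * ((x + (h : ℤ) : ℤ) : ℝ) ^ i
        - ∑ i ∈ range (k + 1 + 1), a i * (x : ℝ) ^ i)‖) with hH
    set β := Q.factorial * ((k + 1) * a (k + 1)) with hβ
    have hHβ : ∀ h ∈ H, ∃ b : ℤ, |h * β - b| ≤ D / P ^ k := by
      intro h hh
      have hh2 := (mem_filter.1 hh).2
      set b : ℕ → ℝ := fun i => h * ∑ j ∈ range (k + 2),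
        if i < j then a j * (j.choose i : ℝ) * (h : ℝ) ^ (j - 1 - i) else 0 with hb
      have hbk : b k = h * ((k + 1) * a (k + 1)) := by
        simp only [hb]; rw [polyEval_diff_leading]
      have hpoly : ∀ x : ℤ, (∑ i ∈ range (k + 1 + 1), a i * ((x + (h : ℤ) : ℤ) : ℝ) ^ i
        - ∑ i ∈ range (k + 1 + 1), a i * (x : ℝ) ^ i) = ∑ i ∈ range (k + 1), b i * (x : ℝ) ^ i := by
        intro x
        have := polyEval_add_sub k a (h : ℝ) (x : ℝ)
        push_cast
        rw [this, mul_sum]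
        exact sum_congr rfl fun i _ => by simp only [hb]; ring
      simp only [hpoly] at hh2
      obtain ⟨q, hq1, hqQ, c, hc⟩ := hQ P hP b u (v - h) (by omega) hh2
      obtain ⟨e, he⟩ : q ∣ Q.factorial := Nat.dvd_factorial hq1 hqQ
      refine ⟨e * c, ?_⟩
      have heQ : e ≤ Q.factorial := by
        rw [he]; exact Nat.le_mul_of_pos_left e hq1
      have : h * β - ((e * c : ℤ) : ℝ) = e * (q * b k - c) := by
        rw [hβ, hbk, he]; push_cast; ring
      rw [this, abs_mul, Nat.abs_cast, hD, mul_div_assoc]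
      gcongr
    have hPk : (P : ℝ) ≤ P ^ k := by
      have h1P : (1 : ℝ) ≤ P := by exact_mod_cast hP
      exact le_self_pow₀ h1P (by omega)
    have hη : D / P ^ k ≤ D / P := by gcongr
    have hη2 : D / P * (32 * (W₀ + 1)) < δ := by
      have : 32 * D * (W₀ + 1) / δ < P := by linarith
      rw [div_lt_iff₀ hδ0] at this
      rw [div_mul_eq_mul_div, div_lt_iff₀ hP0]
      linarith
    have hη0 : 0 ≤ D / P ^ k := by positivity
    have hη1 : 0 ≤ D / P := by positivity
    have hηW : D / P ^ k * W₀ ≤ D / P * W₀ := by gcongr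
    obtain ⟨q, hq1, hqW, b, hqb⟩ := exists_rational_approx (β := β) hδ0 hη0
      (H := H) (fun x hx => by
        have := mem_Ico.1 (mem_filter.1 hx).1
        rw [mem_range]; omega) hmany hW₀' hW₀P
      (by linarith)
      (by
        have : D / P * W₀ ≤ 1 / 8 := by
          rw [div_mul_eq_mul_div, div_le_iff₀ hP0]; linarith
        linarith)
      (by linarith [mul_nonneg hη1 hWnn]) hHβ
    refine ⟨q * (Q.factorial * (k + 1)), ?_, ?_, b, ?_⟩
    · exact Nat.mul_pos hq1 (Nat.mul_pos (Nat.factorial_pos Q) (by omega))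
    · have := Nat.mul_le_mul_right (Q.factorial * (k + 1)) hqW
      omega
    · have e1 : ((q * (Q.factorial * (k + 1)) : ℕ) : ℝ) * a (k + 1) = q * β := by
        rw [hβ]; push_cast; ring
      rw [e1]
      refine hqb.trans ?_
      have e2 : 8 * (D / P ^ k) * q / (δ * P) = 8 * D * q / δ / P ^ (k + 1) := by
        rw [pow_succ]; field_simp
      rw [e2]
      gcongr
      have hqr : (q : ℝ) ≤ W₀ := by exact_mod_cast hqW
      have e3 : 8 * D * q / δ ≤ 8 * D * W₀ / δ := by gcongr
      have e4 := Nat.le_ceil (8 * D * W₀ / δ)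
      have e5 : ⌈8 * D * W₀ / δ⌉₊ ≤ Q' := by omega
      have e6 : ((⌈8 * D * W₀ / δ⌉₊ : ℕ) : ℝ) ≤ Q' := by exact_mod_cast e5
      linarith

end InverseWeyl

section RepCount

open Finset

lemma card_piFinset_eq_integral {ι : Type*} [Fintype ι] [DecidableEq ι] (S : Finset ℤ)
    (g : ℤ → ℤ) (n : ℤ) :
    ((((Fintype.piFinset (fun _ : ι => S)).filter (fun z => ∑ i, g (z i) = n)).card : ℝ) : ℂ)
      = ∫ α in (0 : ℝ)..1, (∑ x ∈ S, expi (α * g x)) ^ Fintype.card ι * expi (-(α * n)) := by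
  have h := integral_sum_expi (Fintype.piFinset (fun _ : ι => S)) (fun _ => 1)
    (fun z => ∑ i, g (z i) - n)
  simp only [sum_const, nsmul_eq_mul, mul_one, one_mul, sub_eq_zero] at h
  push_cast
  rw [← h]
  refine intervalIntegral.integral_congr fun α _ => ?_
  rw [expSum_pow, sum_mul]
  refine sum_congr rfl fun z _ => ?_
  rw [← expi_add]
  push_cast
  ring_nf

/-- The number of representations of `n` as a sum of `k`-th powers of elements of `s`. -/
def repCount (ι : Type*) [Fintype ι] [DecidableEq ι] (s : Finset ℕ) (k : ℕ) (n : ℤ) : ℕ :=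
  ((Fintype.piFinset (fun _ : ι => s)).filter (fun z => ((∑ i, z i ^ k : ℕ) : ℤ) = n)).card

lemma repCount_eq_integral {ι : Type*} [Fintype ι] [DecidableEq ι] (s : Finset ℕ) (k : ℕ) (n : ℤ) :
    ((repCount ι s k n : ℝ) : ℂ)
      = ∫ α in (0 : ℝ)..1, (∑ x ∈ s.map Nat.castEmbedding, expi (α * ((x ^ k : ℤ) : ℝ)))
        ^ Fintype.card ι * expi (-(α * n)) := by
  rw [← card_piFinset_eq_integral]
  congr 2
  refine card_bij (fun z _ i => (z i : ℤ)) ?_ ?_ ?_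
  · intro z hz
    simp only [mem_filter, Fintype.mem_piFinset, mem_map, Nat.castEmbedding_apply] at hz ⊢
    refine ⟨fun i => ⟨z i, hz.1 i, rfl⟩, ?_⟩
    rw [← hz.2]; push_cast; rfl
  · intro z _ z' _ h
    funext i
    exact_mod_cast congrFun h i
  · intro z hz
    simp only [mem_filter, Fintype.mem_piFinset, mem_map, Nat.castEmbedding_apply] at hz
    choose w hw hw' using hz.1
    refine ⟨w, ?_, funext hw'⟩
    simp only [mem_filter, Fintype.mem_piFinset]
    refine ⟨hw, ?_⟩
    rw [← hz.2]; push_cast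
    exact sum_congr rfl fun i _ => by rw [hw']

lemma map_cast_subset {s : Finset ℕ} {N : ℕ} (hs : s ⊆ range N) :
    s.map (Nat.castEmbedding : ℕ ↪ ℤ) ⊆ Ico 0 (N : ℤ) := by
  intro x hx
  simp only [mem_map, Nat.castEmbedding_apply] at hx
  obtain ⟨y, hy, rfl⟩ := hx
  have := mem_range.1 (hs hy)
  rw [mem_Ico]; omega

lemma exists_mean_value_pow (k : ℕ) (hk : 1 ≤ k) : ∃ t : ℕ, 1 ≤ t ∧ k ≤ 2 * t ∧
    ∃ C : ℝ, 0 ≤ C ∧ ∀ N : ℕ, 1 ≤ N → ∀ S ⊆ Ico 0 (N : ℤ),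
      (∫ α in (0 : ℝ)..1, ‖∑ x ∈ S, expi (α * ((x ^ k : ℤ) : ℝ))‖ ^ (2 * t)) * N ^ k
        ≤ C * N ^ (2 * t) := by
  obtain ⟨t, ht, hkt, h⟩ := exists_mean_value k hk
  obtain ⟨C, hC, h⟩ := h 1
  refine ⟨t, ht, hkt, C, hC, fun N hN S hS => ?_⟩
  have h1 := h N hN (fun i => if i = k then 1 else 0) (by
    intro i hi
    split_ifs with hik
    · simp [hik]
    · rw [abs_zero]; positivity) (by simp) S hS
  have h2 : ∀ x : ℤ, intPoly k (fun i => if i = k then 1 else 0) x = x ^ k := by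
    intro x; simp [intPoly]
  simpa only [h2] using h1

/-- Upper bound of the expected order for the number of representations. -/
lemma exists_repCount_le (k : ℕ) (hk : 1 ≤ k) : ∃ s : ℕ, ∃ C : ℝ, 0 ≤ C ∧
    ∀ (ι : Type) [Fintype ι] [DecidableEq ι], s ≤ Fintype.card ι → ∀ N : ℕ, 1 ≤ N →
      ∀ n : ℤ, (repCount ι (range N) k n : ℝ) * N ^ k ≤ C * N ^ Fintype.card ι := by
  obtain ⟨t, ht, hkt, C, hC, h⟩ := exists_mean_value_pow k hk
  refine ⟨2 * t, C, hC, fun ι _ _ hι N hN n => ?_⟩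
  set S := (range N).map (Nat.castEmbedding : ℕ ↪ ℤ) with hS
  have hSs : S ⊆ Ico 0 (N : ℤ) := map_cast_subset subset_rfl
  have hcard : (S.card : ℝ) = N := by rw [hS, card_map, card_range]
  set l := Fintype.card ι with hl
  have hce := continuous_expi
  have h1 : (repCount ι (range N) k n : ℝ)
      ≤ ∫ α in (0 : ℝ)..1, N ^ (l - 2 * t) *
        ‖∑ x ∈ S, expi (α * ((x ^ k : ℤ) : ℝ))‖ ^ (2 * t) := by
    have h2 : ‖((repCount ι (range N) k n : ℝ) : ℂ)‖ = repCount ι (range N) k n := by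
      rw [Complex.norm_real, Real.norm_of_nonneg (Nat.cast_nonneg _)]
    rw [← h2, repCount_eq_integral]
    refine (intervalIntegral.norm_integral_le_integral_norm zero_le_one).trans ?_
    refine intervalIntegral.integral_mono_on zero_le_one
      (Continuous.intervalIntegrable (by fun_prop) _ _)
      (Continuous.intervalIntegrable (by fun_prop) _ _) (fun α _ => ?_)
    rw [norm_mul, norm_expi, mul_one, norm_pow, ← hl]
    have h3 : l = (l - 2 * t) + 2 * t := by omega
    conv_lhs => rw [h3, pow_add]
    gcongr
    exact (norm_expSum_le_card _ _).trans hcard.le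
  rw [intervalIntegral.integral_const_mul] at h1
  calc _ ≤ N ^ (l - 2 * t) * (∫ α in (0 : ℝ)..1,
        ‖∑ x ∈ S, expi (α * ((x ^ k : ℤ) : ℝ))‖ ^ (2 * t)) * (N : ℝ) ^ k := by gcongr
    _ ≤ N ^ (l - 2 * t) * (C * N ^ (2 * t)) := by
      rw [mul_assoc]
      exact mul_le_mul_of_nonneg_left (h N hN S hSs) (by positivity)
    _ = C * N ^ l := by
      rw [mul_left_comm, ← pow_add]; congr 2; omega

/-- Trivial upper bound for the number of representations. -/
lemma repCount_le_pow {ι : Type*} [Fintype ι] [DecidableEq ι] {k : ℕ} (hk : 1 ≤ k) (s : Finset ℕ)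
    (n : ℤ) (i₀ : ι) : repCount ι s k n ≤ s.card ^ (Fintype.card ι - 1) := by
  have : s.card ^ (Fintype.card ι - 1)
      = (Fintype.piFinset (fun _ : {i : ι // i ≠ i₀} => s)).card := by
    rw [Fintype.card_piFinset, prod_const, card_univ, Fintype.card_subtype_compl,
      Fintype.card_subtype_eq]
  rw [this]
  refine card_le_card_of_injOn (fun z i => z i.1) ?_ ?_
  · intro z hz
    simp only [coe_filter, Fintype.mem_piFinset, Set.mem_ofPred_eq, mem_coe] at hz ⊢
    exact fun i => hz.1 i.1
  · intro z hz z' hz' h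
    simp only [coe_filter, Set.mem_ofPred_eq] at hz hz'
    have e : ∀ i, i ≠ i₀ → z i = z' i := fun i hi => congrFun h ⟨i, hi⟩
    have e2 : ∑ i, z i ^ k = ∑ i, z' i ^ k := by exact_mod_cast hz.2.trans hz'.2.symm
    rw [← add_sum_erase _ _ (mem_univ i₀), ← add_sum_erase _ (fun i => z' i ^ k) (mem_univ i₀),
      sum_congr rfl (fun i hi => by rw [e i (ne_of_mem_erase hi)])] at e2
    have e3 : z i₀ = z' i₀ := Nat.pow_left_injective (n := k) (by omega) (by simpa using e2)
    funext i
    by_cases hi : i = i₀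
    · rw [hi, e3]
    · exact e i hi

end RepCount

section RepCountShift

open Finset

lemma norm_one_sub_expi_le (x : ℝ) : ‖1 - expi x‖ ≤ 2 * Real.pi * |x| := by
  have := Complex.norm_exp_I_mul_ofReal_sub_one (2 * Real.pi * x)
  rw [norm_sub_rev]
  have h : expi x = Complex.exp (Complex.I * ((2 * Real.pi * x : ℝ) : ℂ)) := by
    rw [expi]; push_cast; ring_nf
  rw [h, this, norm_mul, Real.norm_eq_abs, Real.norm_eq_abs, abs_two]
  have h2 := Real.abs_sin_le_abs (x := 2 * Real.pi * x / 2)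
  calc _ ≤ 2 * |2 * Real.pi * x / 2| := by gcongr
    _ = _ := by
      rw [show 2 * Real.pi * x / 2 = Real.pi * x by ring, abs_mul, abs_of_pos Real.pi_pos]; ring

/-- The number of representations hardly changes under small shifts in a suitable progression. -/
lemma exists_repCount_shift_le (k : ℕ) (hk : 1 ≤ k) : ∃ t : ℕ, ∃ C : ℝ, 0 < C ∧
    ∀ ε : ℝ, 0 < ε → ∃ L : ℕ, ∃ D : ℝ, 1 ≤ L ∧ 0 < D ∧ ∀ P : ℕ, 1 ≤ P → ∀ n τ : ℤ,
      |(repCount (Fin (2 * t + 1)) (Ico P (2 * P)) k n : ℝ)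
        - repCount (Fin (2 * t + 1)) (Ico P (2 * P)) k (n + L * τ)| * P ^ k
      ≤ C * (ε + D * |τ| / P ^ k) * P ^ (2 * t + 1) := by
  obtain ⟨t, ht, hkt, C, hC, hmv⟩ := exists_mean_value_pow k hk
  refine ⟨t, 2 * (C + 1) * 2 ^ (2 * t), by positivity, fun ε hε => ?_⟩
  obtain ⟨Q, hQ1, hQ⟩ := exists_inverse_weyl k hk ε hε
  have hQr : (0 : ℝ) < Q := by exact_mod_cast hQ1
  refine ⟨Q.factorial, Real.pi * Q.factorial * Q, Nat.factorial_pos Q,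
    by have := Real.pi_pos; positivity, fun P hP n τ => ?_⟩
  have hP0 : (0 : ℝ) < P := by exact_mod_cast hP
  set L := Q.factorial with hL
  set S := (Ico P (2 * P)).map (Nat.castEmbedding : ℕ ↪ ℤ) with hS
  have hSI : S = Ico (P : ℤ) (2 * P) := by
    ext x
    simp only [hS, mem_map, mem_Ico, Nat.castEmbedding_apply]
    constructor
    · rintro ⟨y, hy, rfl⟩; omega
    · intro hx; exact ⟨x.toNat, by omega, by omega⟩
  have hSs : S ⊆ Ico 0 ((2 * P : ℕ) : ℤ) := by
    rw [hSI]; intro x hx; rw [mem_Ico] at hx ⊢; push_cast; omega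
  set T : ℝ → ℂ := fun α => ∑ x ∈ S, expi (α * ((x ^ k : ℤ) : ℝ)) with hT
  have hTP : ∀ α, ‖T α‖ ≤ P := by
    intro α
    simp only [hT, hSI]
    exact norm_expSum_Ico_le (by omega) _
  set E := ε + Real.pi * L * Q * |τ| / P ^ k with hE
  have hpi := Real.pi_pos
  have hpt : ∀ α, ‖T α‖ * ‖1 - expi (-(α * (L * τ : ℤ)))‖ ≤ 2 * E * P := by
    intro α
    rcases lt_or_ge ‖T α‖ (ε * P) with h | h
    · have h1 : ‖1 - expi (-(α * (L * τ : ℤ)))‖ ≤ 2 := by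
        refine (norm_sub_le _ _).trans ?_
        rw [norm_one, norm_expi]; norm_num
      calc _ ≤ ε * P * 2 := by gcongr
        _ ≤ E * P * 2 := by
          gcongr
          simp only [hE, le_add_iff_nonneg_right]
          positivity
        _ = _ := by ring
    · have h2 : ∀ x : ℤ, α * ((x ^ k : ℤ) : ℝ)
          = ∑ i ∈ range (k + 1), (if i = k then α else 0) * (x : ℝ) ^ i := by
        intro x; simp
      simp only [hT, hSI, h2] at h
      obtain ⟨q, hq1, hqQ, b, hb⟩ := hQ P hP _ _ _ (by omega) h
      rw [if_pos rfl] at hb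
      obtain ⟨e, he⟩ : q ∣ L := Nat.dvd_factorial hq1 hqQ
      have h3 : expi (-(α * (L * τ : ℤ))) = expi (-(e * τ * (q * α - b))) := by
        rw [← expi_sub_intCast _ (-(e * τ * b))]
        congr 1
        rw [he]; push_cast; ring
      have heL : (e : ℝ) ≤ L := by
        have : e ≤ L := by rw [he]; exact Nat.le_mul_of_pos_left e hq1
        exact_mod_cast this
      rw [h3]
      have h4 := norm_one_sub_expi_le (-(e * τ * (q * α - b)))
      rw [abs_neg, abs_mul, abs_mul, Nat.abs_cast] at h4
      calc _ ≤ P * (2 * Real.pi * (e * |(τ : ℝ)| * |q * α - b|)) := by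
            gcongr
            exact hTP α
        _ ≤ P * (2 * Real.pi * (L * |(τ : ℝ)| * (Q / P ^ k))) := by gcongr
        _ = 2 * (Real.pi * L * Q * |(τ : ℝ)| / P ^ k) * P := by ring
        _ ≤ 2 * E * P := by
          gcongr
          simp only [hE]
          push_cast
          linarith
  have hce := continuous_expi
  have hTc : Continuous T := by simp only [hT]; fun_prop
  have hE0 : 0 ≤ E := by positivity
  have h1 : |(repCount (Fin (2 * t + 1)) (Ico P (2 * P)) k n : ℝ)
        - repCount (Fin (2 * t + 1)) (Ico P (2 * P)) k (n + L * τ)|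
      ≤ ∫ α in (0 : ℝ)..1, 2 * E * P * ‖T α‖ ^ (2 * t) := by
    rw [← Real.norm_eq_abs, ← Complex.norm_real, Complex.ofReal_sub, repCount_eq_integral,
      repCount_eq_integral, ← intervalIntegral.integral_sub
        (Continuous.intervalIntegrable (by fun_prop) _ _)
        (Continuous.intervalIntegrable (by fun_prop) _ _)]
    refine (intervalIntegral.norm_integral_le_integral_norm zero_le_one).trans ?_
    refine intervalIntegral.integral_mono_on zero_le_one
      (Continuous.intervalIntegrable (by fun_prop) _ _)
      (Continuous.intervalIntegrable (by fun_prop) _ _) (fun α _ => ?_)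
    have h5 : -(α * ((n + L * τ : ℤ) : ℝ)) = -(α * n) + -(α * (L * τ : ℤ)) := by
      push_cast; ring
    rw [h5, expi_add, Fintype.card_fin, ← mul_sub, ← mul_one_sub, norm_mul, norm_mul, norm_expi,
      one_mul, norm_pow, pow_succ]
    have := hpt α
    calc _ = ‖T α‖ ^ (2 * t) * (‖T α‖ * ‖1 - expi (-(α * (L * τ : ℤ)))‖) := by
          simp only [hT, hS]; ring
      _ ≤ ‖T α‖ ^ (2 * t) * (2 * E * P) := by gcongr
      _ = _ := by ring
  rw [intervalIntegral.integral_const_mul] at h1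
  have h2 := hmv (2 * P) (by omega) S hSs
  have h3 : (∫ α in (0 : ℝ)..1, ‖T α‖ ^ (2 * t)) * P ^ k ≤ C * 2 ^ (2 * t) * P ^ (2 * t) := by
    have hJ0 : 0 ≤ ∫ α in (0 : ℝ)..1, ‖T α‖ ^ (2 * t) :=
      intervalIntegral.integral_nonneg zero_le_one fun _ _ => by positivity
    calc _ ≤ (∫ α in (0 : ℝ)..1, ‖T α‖ ^ (2 * t)) * ((2 * P : ℕ) : ℝ) ^ k := by
          gcongr; omega
      _ ≤ _ := h2
      _ = _ := by push_cast; rw [mul_pow]; ring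
  have h3' : (∫ α in (0 : ℝ)..1, ‖T α‖ ^ (2 * t)) * P ^ k
      ≤ (C + 1) * 2 ^ (2 * t) * P ^ (2 * t) := h3.trans (by gcongr; linarith)
  calc _ ≤ (2 * E * P * ∫ α in (0 : ℝ)..1, ‖T α‖ ^ (2 * t)) * P ^ k := by gcongr
    _ = 2 * E * P * ((∫ α in (0 : ℝ)..1, ‖T α‖ ^ (2 * t)) * P ^ k) := by ring
    _ ≤ 2 * E * P * ((C + 1) * 2 ^ (2 * t) * P ^ (2 * t)) := by gcongr
    _ = _ := by simp only [hE]; push_cast; ring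

lemma sum_repCount {k : ℕ} (ι : Type*) [Fintype ι] [DecidableEq ι] (s : Finset ℕ) {M : ℕ}
    (hs : ∀ x ∈ s, x ≤ M) :
    ∑ n ∈ range (Fintype.card ι * M ^ k + 1), repCount ι s k n = s.card ^ Fintype.card ι := by
  have h : (Fintype.piFinset (fun _ : ι => s)).card = s.card ^ Fintype.card ι := by
    rw [Fintype.card_piFinset, prod_const, card_univ]
  rw [← h, card_eq_sum_card_fiberwise (f := fun z => ∑ i, z i ^ k)
    (t := range (Fintype.card ι * M ^ k + 1))]
  · refine sum_congr rfl fun n _ => ?_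
    unfold repCount
    congr 1
    refine filter_congr fun z _ => ?_
    norm_cast
  · intro z hz
    simp only [mem_coe, Fintype.mem_piFinset] at hz
    rw [mem_coe, mem_range, Nat.lt_succ_iff]
    calc ∑ i, z i ^ k ≤ ∑ _i : ι, M ^ k := sum_le_sum fun i _ => Nat.pow_le_pow_left (hs _ (hz i)) k
      _ = _ := by rw [sum_const, card_univ, smul_eq_mul]

/-- There is a short progression all of whose elements have many representations. -/
lemma exists_le_repCount_progression (k : ℕ) (hk : 1 ≤ k) : ∃ s L : ℕ, ∃ c η : ℝ,
    1 ≤ L ∧ 0 < c ∧ 0 < η ∧ ∀ P : ℕ, 1 ≤ P → ∃ n₀ : ℕ, n₀ ≤ s * (2 * P) ^ k ∧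
      ∀ τ : ℤ, |(τ : ℝ)| ≤ η * P ^ k →
        c * P ^ s ≤ repCount (Fin s) (Ico P (2 * P)) k (n₀ + L * τ) * P ^ k := by
  obtain ⟨t, C, hC, h⟩ := exists_repCount_shift_le k hk
  set s := 2 * t + 1 with hs
  set c₀ : ℝ := 1 / (s * 2 ^ k + 1) with hc₀
  have hc₀0 : 0 < c₀ := by positivity
  obtain ⟨L, D, hL, hD, h⟩ := h (c₀ / (4 * C)) (by positivity)
  refine ⟨s, L, c₀ / 2, c₀ / (4 * C * D), hL, by positivity, by positivity, fun P hP => ?_⟩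
  have hP0 : (0 : ℝ) < P := by exact_mod_cast hP
  have hP1 : (1 : ℝ) ≤ P := by exact_mod_cast hP
  have hsum := sum_repCount (k := k) (Fin s) (Ico P (2 * P)) (M := 2 * P)
    (fun x hx => (mem_Ico.1 hx).2.le)
  rw [Fintype.card_fin, Nat.card_Ico, show 2 * P - P = P by omega] at hsum
  have hex : ∃ n ∈ range (s * (2 * P) ^ k + 1),
      c₀ * P ^ s ≤ (repCount (Fin s) (Ico P (2 * P)) k n : ℝ) * P ^ k := by
    by_contra hc
    push Not at hc
    have h1 := sum_lt_sum_of_nonempty (s := range (s * (2 * P) ^ k + 1)) (by simp) hc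
    rw [← sum_mul, ← Nat.cast_sum, hsum, sum_const, card_range, nsmul_eq_mul] at h1
    have h2 : ((s * (2 * P) ^ k + 1 : ℕ) : ℝ) * (c₀ * P ^ s) ≤ (P ^ s : ℕ) * P ^ k := by
      have h3 : ((s * (2 * P) ^ k + 1 : ℕ) : ℝ) ≤ (s * 2 ^ k + 1) * P ^ k := by
        push_cast
        rw [mul_pow]
        nlinarith [one_le_pow₀ hP1 (n := k)]
      calc _ ≤ (s * 2 ^ k + 1) * P ^ k * (c₀ * P ^ s) := by gcongr
        _ = _ := by rw [hc₀]; push_cast; field_simp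
    linarith
  obtain ⟨n₀, hn₀, hn⟩ := hex
  refine ⟨n₀, Nat.lt_succ_iff.1 (mem_range.1 hn₀), fun τ hτ => ?_⟩
  have h1 := h P hP n₀ τ
  have h2 : C * (c₀ / (4 * C) + D * |τ| / P ^ k) * (P : ℝ) ^ s ≤ c₀ / 2 * P ^ s := by
    gcongr
    have h3 : D * |(τ : ℝ)| / P ^ k ≤ c₀ / (4 * C) := by
      rw [div_le_iff₀ (by positivity)]
      calc _ ≤ D * (c₀ / (4 * C * D) * P ^ k) := by gcongr
        _ = _ := by field_simp
    push_cast
    calc _ ≤ C * (c₀ / (4 * C) + c₀ / (4 * C)) := by gcongr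
      _ = _ := by field_simp; norm_num
  have h4 := le_abs_self ((repCount (Fin s) (Ico P (2 * P)) k n₀ : ℝ)
    - repCount (Fin s) (Ico P (2 * P)) k (n₀ + L * τ))
  have h5 := mul_le_mul_of_nonneg_right h4 (by positivity : (0 : ℝ) ≤ P ^ k)
  linarith

end RepCountShift

section RepCountLower

open Finset

lemma card_filter_modEq_Ioc {z L N : ℕ} (hL : 0 < L) (h : L * N ≤ z) (e : ℕ) :
    ((Ioc (z - L * N) z).filter (fun x => x ≡ e [MOD L])).card = N := by
  have h1 := Nat.Ioc_filter_modEq_card (z - L * N) z hL e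
  have hL' : (L : ℚ) ≠ 0 := by positivity
  have h2 : ((z : ℚ) - e) / L = ((z - L * N : ℕ) - e) / L + (N : ℤ) := by
    rw [Nat.cast_sub h]; push_cast; field_simp; ring
  rw [h2, Int.floor_add_intCast] at h1
  omega

lemma pow_le_pow_add_mul (k : ℕ) {a b : ℕ} (h : b ≤ a) :
    a ^ k ≤ b ^ k + k * (a - b) * a ^ (k - 1) := by
  induction k with
  | zero => simp
  | succ k ih =>
    obtain ⟨d, rfl⟩ := Nat.exists_eq_add_of_le h
    rw [Nat.add_sub_cancel_left] at ih ⊢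
    rcases Nat.eq_zero_or_pos k with rfl | hk
    · simp
    · have h1 : (b + d) ^ k = (b + d) ^ (k - 1) * (b + d) := by
        rw [← pow_succ]; congr 1; omega
      calc (b + d) ^ (k + 1) = b * (b + d) ^ k + d * (b + d) ^ k := by ring
        _ ≤ b * (b ^ k + k * d * (b + d) ^ (k - 1)) + d * (b + d) ^ k := by gcongr
        _ = b ^ (k + 1) + (k * d * (b + d) ^ (k - 1) * b + d * (b + d) ^ k) := by ring
        _ ≤ b ^ (k + 1) + (k * d * (b + d) ^ (k - 1) * (b + d) + d * (b + d) ^ k) := by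
          gcongr
        _ = b ^ (k + 1) + (k * d * ((b + d) ^ (k - 1) * (b + d)) + d * (b + d) ^ k) := by ring
        _ = _ := by rw [← h1, Nat.add_sub_cancel]; ring

lemma sum_repCount_le {ι κ ι' : Type*} [Fintype ι] [DecidableEq ι] [Fintype κ] [Fintype ι']
    [DecidableEq ι'] (e : ι' ≃ ι ⊕ κ) {s₁ s : Finset ℕ} (hs : s₁ ⊆ s) (k : ℕ) (F : Finset (κ → ℕ))
    (hF : ∀ y ∈ F, ∀ i, y i ∈ s) (n : ℤ) :
    ∑ y ∈ F, repCount ι s₁ k (n - (∑ i, y i ^ k : ℕ)) ≤ repCount ι' s k n := by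
  unfold repCount
  rw [← card_sigma]
  refine card_le_card_of_injOn (fun p i => Sum.elim p.2 p.1 (e i)) ?_ ?_
  · rintro ⟨y, z⟩ h
    simp only [coe_sigma, Set.mem_sigma_iff, mem_coe, mem_filter, Fintype.mem_piFinset] at h ⊢
    obtain ⟨hy, hz, hsum⟩ := h
    refine ⟨fun i => ?_, ?_⟩
    · rcases e i with j | j
      · exact hs (hz j)
      · exact hF y hy j
    · rw [Equiv.sum_comp e (fun j => Sum.elim z y j ^ k), Fintype.sum_sum_type]
      push_cast at hsum ⊢
      simp only [Sum.elim_inl, Sum.elim_inr]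
      linarith
  · rintro ⟨y, z⟩ _ ⟨y', z'⟩ _ h
    have h1 : ∀ j, Sum.elim z y j = Sum.elim z' y' j := by
      intro j
      have := congrFun h (e.symm j)
      simpa using this
    have hz : z = z' := funext fun i => h1 (Sum.inl i)
    have hy : y = y' := funext fun i => h1 (Sum.inr i)
    rw [hz, hy]

lemma exists_floor_root {k M : ℕ} (hk : 1 ≤ k) (hM : 1 ≤ M) {v w B : ℕ} (h1 : M * w ^ k ≤ v)
    (h2 : v ≤ B ^ k) : ∃ z, w ≤ z ∧ z ≤ B ∧ M * z ^ k ≤ v ∧ v < M * (z + 1) ^ k := by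
  classical
  have hex : ∃ x, v < M * x ^ k := by
    refine ⟨v + 1, ?_⟩
    calc v < v + 1 := by omega
      _ ≤ (v + 1) ^ k := Nat.le_self_pow (by omega) _
      _ ≤ _ := Nat.le_mul_of_pos_left _ hM
  obtain ⟨z, hz⟩ : ∃ z, Nat.find hex = z + 1 := by
    refine Nat.exists_eq_succ_of_ne_zero fun h0 => ?_
    have := Nat.find_spec hex
    rw [h0, zero_pow (by omega)] at this
    omega
  have hs := Nat.find_spec hex
  rw [hz] at hs
  have hm : M * z ^ k ≤ v := not_lt.1 (Nat.find_min hex (by omega))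
  refine ⟨z, ?_, ?_, hm, hs⟩
  · by_contra hc
    have : M * (z + 1) ^ k ≤ M * w ^ k := by gcongr; omega
    omega
  · by_contra hc
    have : B ^ k < z ^ k := Nat.pow_lt_pow_left (by omega) (by omega)
    have : z ^ k ≤ M * z ^ k := Nat.le_mul_of_pos_left _ hM
    omega

/-- Lower bound of the expected order for the number of representations. -/
theorem exists_le_repCount (k : ℕ) (hk : 1 ≤ k) : ∃ m₀ : ℕ, ∀ m : ℕ, m₀ ≤ m →
    ∃ c : ℝ, 0 < c ∧ ∃ P₀ : ℕ, ∀ P : ℕ, P₀ ≤ P → ∀ n : ℕ, m * (2 * P) ^ k ≤ n →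
      n ≤ m * (4 * P) ^ k →
      c * P ^ m ≤ repCount (Fin m) (Icc P ((4 * m + 1) * P)) k n * P ^ k := by
  obtain ⟨s, L, c, η, hL, hc, hη, h⟩ := exists_le_repCount_progression k hk
  refine ⟨s + L, fun m hm => ?_⟩
  obtain ⟨M, rfl⟩ : ∃ M, m = s + M := ⟨m - s, by omega⟩
  have hLM : L ≤ M := by omega
  have hL0 : (0 : ℝ) < L := by exact_mod_cast hL
  have hM0 : (0 : ℝ) < M := by exact_mod_cast (by omega : 0 < M)
  have hk0 : (0 : ℝ) < k := by exact_mod_cast (by omega : 0 < k)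
  set m := s + M with hmdef
  set G : ℝ := 2 * M * k * L * (4 * m + 1) ^ (k - 1) with hG
  have hG0 : 0 < G := by positivity
  set κ : ℝ := min (1 / L) (η / G) with hκ
  have hκ0 : 0 < κ := by positivity
  have hκL : L * κ ≤ 1 := by
    calc L * κ ≤ L * (1 / L) := by gcongr; exact min_le_left _ _
      _ = 1 := by field_simp
  have hκG : κ * G ≤ η := by
    calc κ * G ≤ η / G * G := by gcongr; exact min_le_right _ _
      _ = η := by field_simp
  refine ⟨(κ / 2) ^ M * c, by positivity, ⌈2 / κ⌉₊ + 1, fun P hP n hn1 hn2 => ?_⟩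
  have hP0 : (0 : ℝ) < P := by exact_mod_cast (by omega : 0 < P)
  have hκP : 2 ≤ κ * P := by
    have h1 := Nat.le_ceil (2 / κ)
    have h2 : ((⌈2 / κ⌉₊ : ℕ) : ℝ) ≤ P := by exact_mod_cast (by omega : ⌈2 / κ⌉₊ ≤ P)
    have h3 : 2 / κ ≤ P := h1.trans h2
    rw [div_le_iff₀ hκ0] at h3
    linarith
  set N := ⌊κ * P⌋₊ with hN
  have hN1 : (N : ℝ) ≤ κ * P := Nat.floor_le (by positivity)
  have hN2 : κ / 2 * P ≤ N := by
    have := Nat.lt_floor_add_one (κ * P)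
    rw [← hN] at this
    linarith
  have hLN : L * N ≤ P := by
    have : (L : ℝ) * N ≤ P := by
      calc (L : ℝ) * N ≤ L * (κ * P) := by gcongr
        _ = L * κ * P := by ring
        _ ≤ 1 * P := by gcongr
        _ = P := one_mul _
    exact_mod_cast this
  have hN2' : 1 ≤ κ * P := by linarith
  have hLN2 : ((L * N + 1 : ℕ) : ℝ) ≤ 2 * L * κ * P := by
    have hL1 : (1 : ℝ) ≤ L := by exact_mod_cast hL
    have h1 : (L : ℝ) * N ≤ L * (κ * P) := by gcongr
    have h2 : 1 ≤ L * (κ * P) := by nlinarith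
    push_cast
    linarith
  obtain ⟨n₀, hn₀, hrep⟩ := h P (by omega)
  have hn₀n : n₀ ≤ n := by
    refine hn₀.trans (le_trans ?_ hn1)
    gcongr; omega
  set v := n - n₀ with hv
  have hv1 : M * (2 * P) ^ k ≤ v := by
    have : m * (2 * P) ^ k = s * (2 * P) ^ k + M * (2 * P) ^ k := by rw [hmdef]; ring
    omega
  have hv2 : v ≤ (4 * m * P) ^ k := by
    calc v ≤ n := Nat.sub_le _ _
      _ ≤ m * (4 * P) ^ k := hn2
      _ ≤ m ^ k * (4 * P) ^ k := by gcongr; exact Nat.le_self_pow (by omega) _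
      _ = _ := by rw [← mul_pow]; ring
  obtain ⟨z, hz1, hz2, hz3, hz4⟩ := exists_floor_root hk (by omega) hv1 hv2
  set r := v % L with hr
  have hrL : r < L := Nat.mod_lt _ (by omega)
  set e : Fin M → ℕ := fun i => if (i : ℕ) < r then 1 else 0 with he
  have hesum : ∑ i, e i ^ k = r := by
    have h1 : ∀ i, e i ^ k = if (i : ℕ) < r then 1 else 0 := by
      intro i
      simp only [he]
      split_ifs
      · simp
      · rw [zero_pow (by omega)]
    simp only [h1]
    rw [Fin.sum_univ_eq_sum_range (fun i => if i < r then 1 else 0), sum_boole]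
    have : (range M).filter (fun x => x < r) = range r := by
      ext x; simp only [mem_filter, mem_range]; omega
    rw [this, card_range]; simp
  set F := Fintype.piFinset (fun i => (Ioc (z - L * N) z).filter (fun x => x ≡ e i [MOD L])) with hF
  have hFcard : F.card = N ^ M := by
    rw [hF, Fintype.card_piFinset]
    simp only [card_filter_modEq_Ioc hL (by omega : L * N ≤ z)]
    simp
  have hFmem : ∀ y ∈ F, ∀ i, (z - L * N < y i ∧ y i ≤ z) ∧ y i ≡ e i [MOD L] := by
    intro y hy i
    have := Fintype.mem_piFinset.1 hy i
    simpa only [mem_filter, mem_Ioc] using this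
  have hFs : ∀ y ∈ F, ∀ i, y i ∈ Icc P ((4 * m + 1) * P) := by
    intro y hy i
    have := (hFmem y hy i).1
    rw [mem_Icc]
    constructor
    · omega
    · calc y i ≤ 4 * m * P := this.2.trans hz2
        _ ≤ _ := by gcongr; omega
  have hmain : ∀ y ∈ F, c * P ^ s
      ≤ repCount (Fin s) (Ico P (2 * P)) k (n - (∑ i, y i ^ k : ℕ)) * P ^ k := by
    intro y hy
    have hle : ∑ i, y i ^ k ≤ v := by
      calc ∑ i, y i ^ k ≤ ∑ _i : Fin M, z ^ k :=
            sum_le_sum fun i _ => Nat.pow_le_pow_left (hFmem y hy i).1.2 k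
        _ = M * z ^ k := by simp
        _ ≤ v := hz3
    have hmod : ∑ i, y i ^ k ≡ v [MOD L] := by
      have h1 : ∑ i, y i ^ k ≡ ∑ i, e i ^ k [MOD L] :=
        Nat.ModEq.sum fun i _ => ((hFmem y hy i).2).pow k
      rw [hesum] at h1
      exact h1.trans (Nat.mod_modEq _ _)
    obtain ⟨τ, hτ⟩ := (Nat.modEq_iff_dvd' hle).1 hmod
    have hup : v ≤ ∑ i, y i ^ k + M * (k * (L * N + 1) * ((4 * m + 1) * P) ^ (k - 1)) := by
      have h1 : ∀ i ∈ (univ : Finset (Fin M)), (z + 1) ^ k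
          ≤ y i ^ k + k * (L * N + 1) * ((4 * m + 1) * P) ^ (k - 1) := by
        intro i _
        have hyi := (hFmem y hy i).1
        refine (pow_le_pow_add_mul k (by omega : y i ≤ z + 1)).trans ?_
        gcongr
        · omega
        · have : (4 * m + 1) * P = 4 * m * P + P := by ring
          omega
      have h2 := sum_le_sum h1
      rw [sum_add_distrib] at h2
      simp only [sum_const, card_univ, Fintype.card_fin, smul_eq_mul] at h2
      omega
    have hτ2 : L * τ ≤ M * (k * (L * N + 1) * ((4 * m + 1) * P) ^ (k - 1)) := by omega
    have hτ3 : τ ≤ M * (k * (L * N + 1) * ((4 * m + 1) * P) ^ (k - 1)) :=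
      (Nat.le_mul_of_pos_left τ hL).trans hτ2
    have hτ4 : |((τ : ℤ) : ℝ)| ≤ η * P ^ k := by
      rw [Int.cast_natCast, Nat.abs_cast]
      calc (τ : ℝ) ≤ ((M * (k * (L * N + 1) * ((4 * m + 1) * P) ^ (k - 1)) : ℕ) : ℝ) := by
            exact_mod_cast hτ3
        _ = M * (k * ((L * N + 1 : ℕ) : ℝ) * ((4 * m + 1) * P) ^ (k - 1)) := by push_cast; ring
        _ ≤ M * (k * (2 * L * κ * P) * ((4 * m + 1) * P) ^ (k - 1)) := by gcongr
        _ = κ * G * (P ^ (k - 1) * P) := by rw [hG, mul_pow]; ring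
        _ ≤ η * (P ^ (k - 1) * P) := by gcongr
        _ = _ := by rw [← pow_succ, Nat.sub_add_cancel hk]
    have h5 := hrep τ hτ4
    have h6 : (n : ℤ) - (∑ i, y i ^ k : ℕ) = n₀ + L * (τ : ℤ) := by
      have : (L * τ : ℤ) = ((v - ∑ i, y i ^ k : ℕ) : ℤ) := by rw [hτ]; push_cast; ring
      rw [this]; omega
    rw [h6]; exact h5
  have hfin := sum_repCount_le (finSumFinEquiv (m := s) (n := M)).symm
    (s₁ := Ico P (2 * P)) (s := Icc P ((4 * m + 1) * P)) (by
      intro x hx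
      rw [mem_Ico] at hx
      rw [mem_Icc]
      refine ⟨hx.1, ?_⟩
      have h1 : 2 * P ≤ (4 * m + 1) * P := by gcongr; omega
      omega) k F hFs n
  have hfin' : ((∑ y ∈ F, repCount (Fin s) (Ico P (2 * P)) k (n - (∑ i, y i ^ k : ℕ)) : ℕ) : ℝ)
      ≤ repCount (Fin m) (Icc P ((4 * m + 1) * P)) k n := by exact_mod_cast hfin
  calc (κ / 2) ^ M * c * P ^ m = (κ / 2 * P) ^ M * (c * P ^ s) := by
        rw [hmdef, mul_pow, pow_add]; ring
    _ ≤ (N : ℝ) ^ M * (c * P ^ s) := by gcongr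
    _ = ∑ y ∈ F, c * (P : ℝ) ^ s := by
        rw [sum_const, hFcard, nsmul_eq_mul]; push_cast; ring
    _ ≤ ∑ y ∈ F, (repCount (Fin s) (Ico P (2 * P)) k (n - (∑ i, y i ^ k : ℕ)) : ℝ) * P ^ k :=
        sum_le_sum hmain
    _ = ((∑ y ∈ F, repCount (Fin s) (Ico P (2 * P)) k (n - (∑ i, y i ^ k : ℕ)) : ℕ) : ℝ)
        * P ^ k := by rw [← sum_mul]; push_cast; rfl
    _ ≤ _ := by gcongr

end RepCountLower

section RandomBasis

open Finset

variable {ι : Type*} [Fintype ι]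

/-- The graph of a function `ι → ℕ`, as a finite set. -/
def funGraph (z : ι → ℕ) : Finset (ι × ℕ) :=
  univ.map ⟨fun i => (i, z i), fun _ _ h => (Prod.ext_iff.1 h).1⟩

lemma mem_funGraph {z : ι → ℕ} {x : ι × ℕ} : x ∈ funGraph z ↔ z x.1 = x.2 := by
  simp only [funGraph, mem_map, mem_univ, true_and, Prod.ext_iff]
  constructor
  · rintro ⟨i, rfl, h⟩
    exact h
  · intro h
    exact ⟨x.1, rfl, h⟩

lemma card_funGraph (z : ι → ℕ) : (funGraph z).card = Fintype.card ι := by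
  simp [funGraph]

lemma funGraph_injective : Function.Injective (funGraph : (ι → ℕ) → Finset (ι × ℕ)) := by
  intro z w h
  funext i
  have : (i, z i) ∈ funGraph w := h ▸ mem_funGraph.2 rfl
  exact (mem_funGraph.1 this).symm

lemma not_disjoint_funGraph {z w : ι → ℕ} (h : ¬Disjoint (funGraph z) (funGraph w)) :
    ∃ i, z i = w i := by
  obtain ⟨x, hx, hy⟩ := not_disjoint_iff.1 h
  exact ⟨x.1, by rw [mem_funGraph.1 hx, mem_funGraph.1 hy]⟩

variable [DecidableEq ι]

lemma card_funGraph_union (z w : ι → ℕ) :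
    (funGraph z ∪ funGraph w).card = Fintype.card ι + #{i | z i ≠ w i} := by
  rw [union_comm, ← card_sdiff_add_card, card_funGraph, add_comm]
  congr 1
  symm
  refine card_bij (fun i _ => (i, w i)) ?_ ?_ ?_
  · intro i hi
    simpa [mem_funGraph] using hi
  · intro i _ j _ h
    exact (Prod.ext_iff.1 h).1
  · rintro ⟨i, a⟩ h
    simp only [mem_sdiff, mem_funGraph] at h
    refine ⟨i, ?_, ?_⟩
    · simp only [mem_filter, mem_univ, true_and]
      rw [h.1]
      exact h.2
    · rw [h.1]

/-- The `ι`-tuples from `s` whose `k`-th powers sum to `n`. -/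
def powerReps (ι : Type*) [Fintype ι] [DecidableEq ι] (s : Finset ℕ) (k : ℕ) (n : ℤ) :
    Finset (ι → ℕ) :=
  (Fintype.piFinset (fun _ : ι => s)).filter (fun z => ((∑ i, z i ^ k : ℕ) : ℤ) = n)

lemma mem_powerReps {s : Finset ℕ} {k : ℕ} {n : ℤ} {z : ι → ℕ} :
    z ∈ powerReps ι s k n ↔ (∀ i, z i ∈ s) ∧ ((∑ i, z i ^ k : ℕ) : ℤ) = n := by
  simp [powerReps]

lemma card_powerReps (s : Finset ℕ) (k : ℕ) (n : ℤ) :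
    (powerReps ι s k n).card = repCount ι s k n := rfl

lemma card_powerReps_differing_le (s : Finset ℕ) (k : ℕ) (n : ℤ) (z : ι → ℕ) (J : Finset ι) :
    #{w ∈ powerReps ι s k n | ({i | z i ≠ w i} : Finset ι) = J}
      ≤ repCount J s k (n - (∑ i ∈ Jᶜ, z i ^ k : ℕ)) := by
  rw [← card_powerReps]
  have hz : ∀ w : ι → ℕ, ({i | z i ≠ w i} : Finset ι) = J → ∀ i, i ∉ J → z i = w i := by
    rintro w rfl i hi
    simpa using hi
  refine card_le_card_of_injOn (fun w i => w i) ?_ ?_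
  · intro w hw
    simp only [mem_coe, mem_filter, mem_powerReps] at hw ⊢
    refine ⟨fun i => hw.1.1 i, ?_⟩
    rw [← hw.1.2, eq_sub_iff_add_eq, ← Nat.cast_add, Nat.cast_inj, ← sum_add_sum_compl J]
    congr 1
    · exact sum_coe_sort J (fun i => w i ^ k)
    · exact sum_congr rfl fun i hi => by rw [hz w hw.2 i (mem_compl.1 hi)]
  · intro w hw w' hw' h
    simp only [mem_coe, mem_filter] at hw hw'
    funext i
    by_cases hi : i ∈ J
    · exact congrFun h ⟨i, hi⟩
    · rw [← hz w hw.2 i hi, ← hz w' hw'.2 i hi]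

lemma sum_pow_card_union_le {s : Finset ℕ} {k : ℕ} {p : ℝ} (hp : 0 ≤ p)
    (h : ∀ J : Finset ι, J.Nonempty → J ≠ univ → ∀ n : ℤ,
      p ^ J.card * repCount J s k n ≤ 1 / 2 ^ (Fintype.card ι + 1))
    (n : ℤ) (z : ι → ℕ) :
    ∑ β ∈ (powerReps ι s k n).image funGraph with β ≠ funGraph z ∧ ¬Disjoint (funGraph z) β,
      p ^ (funGraph z ∪ β).card ≤ p ^ (funGraph z).card / 2 := by
  set m := Fintype.card ι with hm
  set D : (ι → ℕ) → Finset ι := fun w => {i | z i ≠ w i} with hD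
  set T : Finset (Finset ι) := {J | J.Nonempty ∧ J ≠ univ} with hT
  rw [filter_image, sum_image funGraph_injective.injOn]
  set R := (powerReps ι s k n).filter
    (fun w => funGraph w ≠ funGraph z ∧ ¬Disjoint (funGraph z) (funGraph w)) with hR
  have hmaps : ∀ w ∈ R, D w ∈ T := by
    intro w hw
    simp only [hR, mem_filter] at hw
    simp only [hT, hD, mem_filter, mem_univ, true_and]
    constructor
    · by_contra hne
      rw [not_nonempty_iff_eq_empty, filter_eq_empty_iff] at hne
      refine hw.2.1 (congrArg _ (funext fun i => ?_))
      have := hne (mem_univ i)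
      push Not at this
      exact this.symm
    · obtain ⟨i, hi⟩ := not_disjoint_funGraph hw.2.2
      intro h
      have : i ∈ D w := by
        rw [show D w = univ from h]
        exact mem_univ i
      simp [hD, hi] at this
  rw [← sum_fiberwise_of_maps_to hmaps]
  calc ∑ J ∈ T, ∑ w ∈ R with D w = J, p ^ (funGraph z ∪ funGraph w).card
      ≤ ∑ J ∈ T, p ^ m * (1 / 2 ^ (m + 1)) := by
        refine sum_le_sum fun J hJ => ?_
        simp only [hT, mem_filter, mem_univ, true_and] at hJ
        calc ∑ w ∈ R with D w = J, p ^ (funGraph z ∪ funGraph w).card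
            = ∑ w ∈ R with D w = J, p ^ m * p ^ J.card := by
              refine sum_congr rfl fun w hw => ?_
              rw [card_funGraph_union, ← pow_add]
              have := (mem_filter.1 hw).2
              rw [← this]
          _ = #{w ∈ R | D w = J} * (p ^ m * p ^ J.card) := by
              rw [sum_const, nsmul_eq_mul]
          _ ≤ repCount J s k (n - (∑ i ∈ Jᶜ, z i ^ k : ℕ)) * (p ^ m * p ^ J.card) := by
              gcongr
              refine le_trans (card_le_card ?_) (card_powerReps_differing_le s k n z J)
              exact filter_subset_filter _ (filter_subset _ _)
          _ = p ^ m * (p ^ J.card * repCount J s k (n - (∑ i ∈ Jᶜ, z i ^ k : ℕ))) := by ring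
          _ ≤ p ^ m * (1 / 2 ^ (m + 1)) := by
              gcongr
              exact h J hJ.1 hJ.2 _
    _ = T.card * (p ^ m * (1 / 2 ^ (m + 1))) := by rw [sum_const, nsmul_eq_mul]
    _ ≤ 2 ^ m * (p ^ m * (1 / 2 ^ (m + 1))) := by
        gcongr
        have : T.card ≤ 2 ^ m := by
          refine (card_filter_le _ _).trans ?_
          simp [hm]
        exact_mod_cast this
    _ = p ^ (funGraph z).card / 2 := by
        rw [card_funGraph, ← hm, pow_succ]
        field_simp

/-- If tuples sharing some of their coordinates are rare, then a random subset of `s` represents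
all of `𝒩`. -/
theorem exists_subset_representing [Nonempty ι] {s : Finset ℕ} (hs : s.Nonempty) {k : ℕ} {p : ℝ}
    (hp0 : 0 < p) (hp1 : p ≤ 1)
    (h : ∀ J : Finset ι, J.Nonempty → J ≠ univ → ∀ n : ℤ,
      p ^ J.card * repCount J s k n ≤ 1 / 2 ^ (Fintype.card ι + 1))
    (N : Finset ℕ)
    (hN : ∑ n ∈ N, Real.exp (-(repCount ι s k n * p ^ Fintype.card ι / 2)) < 1 / 2) :
    ∃ B ⊆ s, (B.card : ℝ) ≤ 2 * p * Fintype.card ι * s.card ∧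
      ∀ n ∈ N, ∃ z : ι → ℕ, (∀ i, z i ∈ B) ∧ ∑ i, z i ^ k = n := by
  set m := Fintype.card ι with hm
  have hm0 : 0 < m := Fintype.card_pos
  set U : Finset (ι × ℕ) := univ ×ˢ s with hU
  have hUcard : U.card = m * s.card := by simp [hU, hm]
  have hs0 : 0 < s.card := hs.card_pos
  have hU0 : (0 : ℝ) < U.card := by rw [hUcard]; exact_mod_cast Nat.mul_pos hm0 hs0
  set I : ℕ → Finset (Finset (ι × ℕ)) := fun n => (powerReps ι s k n).image funGraph with hI
  have hjanson : ∀ n : ℕ, subsetMean U p (avoids (I n))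
      ≤ Real.exp (-(repCount ι s k n * p ^ m / 2)) := by
    intro n
    have hsum : ∑ α ∈ I n, p ^ α.card / 2 = repCount ι s k n * p ^ m / 2 := by
      rw [hI, sum_image funGraph_injective.injOn]
      simp_rw [card_funGraph]
      rw [sum_const, nsmul_eq_mul, card_powerReps, mul_div_assoc]
    rw [← hsum]
    refine janson hp0.le hp1 ?_ ?_
    · intro α hα
      obtain ⟨z, hz, rfl⟩ := mem_image.1 hα
      intro x hx
      rw [mem_funGraph] at hx
      simp only [hU, mem_product, mem_univ, true_and]
      exact hx ▸ (mem_powerReps.1 hz).1 x.1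
    · intro α hα
      obtain ⟨z, hz, rfl⟩ := mem_image.1 hα
      exact sum_pow_card_union_le hp0.le h n z
  obtain ⟨S, hS⟩ : ∃ S : Finset (ι × ℕ),
      ∑ n ∈ N, avoids (I n) S + 1 / (2 * p * U.card) * (S ∩ U).card < 1 := by
    by_contra! hcon
    have h1 := subsetMean_mono (U := U) hp0.le hp1 hcon
    rw [subsetMean_one, subsetMean_add, subsetMean_sum, subsetMean_smul, subsetMean_card] at h1
    have h2 : ∑ n ∈ N, subsetMean U p (fun S => avoids (I n) S) < 1 / 2 :=
      (sum_le_sum fun n _ => hjanson n).trans_lt hN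
    have h3 : 1 / (2 * p * U.card) * (p * U.card) = 1 / 2 := by field_simp
    rw [h3] at h1
    linarith
  have havoid0 : 0 ≤ ∑ n ∈ N, avoids (I n) S := sum_nonneg fun n _ => avoids_nonneg _ _
  refine ⟨(S ∩ U).image Prod.snd, ?_, ?_, ?_⟩
  · intro x hx
    obtain ⟨y, hy, rfl⟩ := mem_image.1 hx
    have := (mem_inter.1 hy).2
    simp only [hU, mem_product, mem_univ, true_and] at this
    exact this
  · have h1 : 1 / (2 * p * U.card) * ((S ∩ U).card : ℝ) ≤ 1 := by linarith
    rw [one_div, inv_mul_le_iff₀ (by positivity), mul_one, hUcard] at h1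
    calc (((S ∩ U).image Prod.snd).card : ℝ) ≤ (S ∩ U).card := by
          exact_mod_cast card_image_le
      _ ≤ _ := h1
      _ = _ := by push_cast; ring
  · intro n hn
    have hpos : 0 ≤ 1 / (2 * p * U.card) * ((S ∩ U).card : ℝ) := by positivity
    have h1 : avoids (I n) S < 1 :=
      (single_le_sum (f := fun n => avoids (I n) S) (fun n _ => avoids_nonneg _ _) hn).trans_lt
        (by linarith)
    have h2 : ∃ α ∈ I n, α ⊆ S := by
      by_contra hcon
      rw [avoids, if_neg hcon] at h1
      exact lt_irrefl _ h1
    obtain ⟨α, hα, hαS⟩ := h2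
    obtain ⟨z, hz, rfl⟩ := mem_image.1 hα
    rw [mem_powerReps] at hz
    refine ⟨z, fun i => mem_image.2 ⟨(i, z i), mem_inter.2 ⟨hαS (mem_funGraph.2 rfl), ?_⟩, rfl⟩,
      by exact_mod_cast hz.2⟩
    simp [hU, hz.1 i]

end RandomBasis

section Scale

open Finset Filter Topology

lemma repCount_mono {ι : Type*} [Fintype ι] [DecidableEq ι] {s t : Finset ℕ} (h : s ⊆ t) (k : ℕ)
    (n : ℤ) : repCount ι s k n ≤ repCount ι t k n :=
  card_le_card (filter_subset_filter _ (Fintype.piFinset_subset _ _ fun _ => h))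

lemma tendsto_rpow_mul_log_rpow {a : ℝ} (ha : a < 0) (b D : ℝ) :
    Tendsto (fun P : ℕ => D * ((P : ℝ) ^ a * Real.log P ^ b)) atTop (𝓝 0) := by
  have h := (isLittleO_log_rpow_rpow_atTop b (neg_pos.2 ha)).tendsto_div_nhds_zero
  have h2 := (h.comp tendsto_natCast_atTop_atTop).const_mul D
  rw [mul_zero] at h2
  refine h2.congr fun P => ?_
  simp only [Function.comp]
  rw [Real.rpow_neg (Nat.cast_nonneg P), div_inv_eq_mul]
  ring

/-- The density `K * P ^ (k / m - 1) * (log P) ^ (1 / m)`. -/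
noncomputable def density (K : ℝ) (k m P : ℕ) : ℝ :=
  K * ((P : ℝ) ^ ((k : ℝ) / m - 1) * Real.log P ^ (1 / (m : ℝ)))

lemma density_pow (K : ℝ) (k m P l : ℕ) :
    density K k m P ^ l
      = K ^ l * ((P : ℝ) ^ (l * ((k : ℝ) / m - 1)) * Real.log P ^ (l / (m : ℝ))) := by
  have hlog : 0 ≤ Real.log P := Real.log_natCast_nonneg P
  have hP : (0 : ℝ) ≤ P := Nat.cast_nonneg P
  rw [density, mul_pow, mul_pow, ← Real.rpow_mul_natCast hP, ← Real.rpow_mul_natCast hlog]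
  congr 3 <;> ring_nf

lemma exists_density_pow_mul_repCount_le {k : ℕ} (hk : 1 ≤ k) : ∃ m₀ : ℕ, ∀ m : ℕ, m₀ ≤ m →
    ∀ K : ℝ, 0 ≤ K → ∀ l : ℕ, 1 ≤ l → l < m → ∃ a D : ℝ, a < 0 ∧ ∀ P : ℕ, 1 ≤ P →
      ∀ (ι : Type) [Fintype ι] [DecidableEq ι], Fintype.card ι = l → ∀ n : ℤ,
        density K k m P ^ l * repCount ι (Icc P ((4 * m + 1) * P)) k n
          ≤ D * ((P : ℝ) ^ a * Real.log P ^ (l / (m : ℝ))) := by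
  obtain ⟨s, C, hC, hs⟩ := exists_repCount_le k hk
  refine ⟨k * s + 1, fun m hm K hK l hl hlm => ?_⟩
  have hm0 : (0 : ℝ) < m := by exact_mod_cast (by omega : 0 < m)
  have hk0 : (0 : ℝ) < k := by exact_mod_cast hk
  rcases le_or_gt s l with hsl | hsl
  · refine ⟨l * ((k : ℝ) / m - 1) + l - k, K ^ l * (C * (4 * m + 2) ^ l), ?_, ?_⟩
    · have h1 : (l : ℝ) * (k / m) < k := by
        rw [mul_div_assoc', div_lt_iff₀ hm0, mul_comm]
        have : (l : ℝ) < m := by exact_mod_cast hlm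
        gcongr
      linarith
    · intro P hP ι _ _ hι n
      have hP0 : (0 : ℝ) < P := by exact_mod_cast hP
      have hlog : 0 ≤ Real.log P := Real.log_natCast_nonneg P
      have hR : (repCount ι (Icc P ((4 * m + 1) * P)) k n : ℝ) * P ^ k
          ≤ C * ((4 * m + 2) * P) ^ l := by
        set N := (4 * m + 1) * P + 1 with hN
        have h1 := hs ι (hι ▸ hsl) N (by omega) n
        have hmono := repCount_mono (ι := ι) (s := Icc P ((4 * m + 1) * P)) (t := range N)
          (fun x hx => by simp only [mem_Icc, mem_range] at hx ⊢; omega) k n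
        have hNl : (N : ℝ) ≤ (4 * m + 2) * P := by
          have : N ≤ (4 * m + 2) * P := by rw [hN]; nlinarith
          exact_mod_cast this
        have hPN : (P : ℝ) ≤ N := by
          have : P ≤ N := by rw [hN]; nlinarith
          exact_mod_cast this
        calc (repCount ι (Icc P ((4 * m + 1) * P)) k n : ℝ) * P ^ k
            ≤ repCount ι (range N) k n * N ^ k := by gcongr
          _ ≤ C * N ^ Fintype.card ι := h1
          _ ≤ C * ((4 * m + 2) * P) ^ l := by rw [hι]; gcongr
      rw [← le_div_iff₀ (by positivity)] at hR
      calc density K k m P ^ l * repCount ι (Icc P ((4 * m + 1) * P)) k n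
          ≤ density K k m P ^ l * (C * ((4 * m + 2) * P) ^ l / P ^ k) := by
            rw [density_pow]; gcongr
        _ = _ := by
            rw [density_pow, Real.rpow_sub hP0, Real.rpow_add hP0, Real.rpow_natCast,
              Real.rpow_natCast, mul_pow]
            ring
  · refine ⟨l * ((k : ℝ) / m - 1) + l - 1, K ^ l * (4 * m + 2) ^ (l - 1), ?_, ?_⟩
    · have h1 : (l : ℝ) * (k / m) < 1 := by
        rw [mul_div_assoc', div_lt_iff₀ hm0, one_mul, mul_comm]
        have : k * l < m := by nlinarith
        exact_mod_cast this
      linarith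
    · intro P hP ι _ _ hι n
      have hP0 : (0 : ℝ) < P := by exact_mod_cast hP
      have hlog : 0 ≤ Real.log P := Real.log_natCast_nonneg P
      obtain ⟨i₀⟩ : Nonempty ι := Fintype.card_pos_iff.1 (by omega)
      have hR : (repCount ι (Icc P ((4 * m + 1) * P)) k n : ℝ)
          ≤ ((4 * m + 2) * P) ^ (l - 1) := by
        have h1 := repCount_le_pow hk (Icc P ((4 * m + 1) * P)) n i₀
        rw [hι] at h1
        have h2 : (Icc P ((4 * m + 1) * P)).card ≤ (4 * m + 2) * P := by
          rw [Nat.card_Icc]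
          have : (4 * m + 2) * P = (4 * m + 1) * P + P := by ring
          omega
        exact_mod_cast h1.trans (Nat.pow_le_pow_left h2 _)
      calc density K k m P ^ l * repCount ι (Icc P ((4 * m + 1) * P)) k n
          ≤ density K k m P ^ l * ((4 * m + 2) * P) ^ (l - 1) := by
            rw [density_pow]; gcongr
        _ = _ := by
            have : (P : ℝ) ^ ((l : ℝ) * (k / m - 1) + l - 1)
                = (P : ℝ) ^ ((l : ℝ) * (k / m - 1)) * P ^ (l - 1) := by
              rw [← Real.rpow_natCast, ← Real.rpow_add hP0, Nat.cast_sub hl]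
              congr 1
              push_cast
              ring
            rw [density_pow, this, mul_pow]
            ring

lemma sum_exp_lt_half {k m P : ℕ} {c K : ℝ} (hK : 1 ≤ K) (hc : 0 < c)
    (hKc : 2 * (k + 1) / c ≤ K) (hm : 1 ≤ m) (hP : 8 * m * 4 ^ k ≤ P)
    (hR : ∀ n : ℕ, m * (2 * P) ^ k ≤ n → n ≤ m * (4 * P) ^ k →
      c * P ^ m ≤ repCount (Fin m) (Icc P ((4 * m + 1) * P)) k n * (P : ℝ) ^ k) :
    ∑ n ∈ Icc (m * (2 * P) ^ k) (m * (4 * P) ^ k),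
      Real.exp (-(repCount (Fin m) (Icc P ((4 * m + 1) * P)) k n * density K k m P ^ m / 2))
        < 1 / 2 := by
  have h4 : 0 < 4 ^ k := by positivity
  have hP1 : 0 < P := by
    have : 0 < 8 * m * 4 ^ k := by positivity
    omega
  have hP0 : (0 : ℝ) < P := by exact_mod_cast hP1
  have hlog : 0 ≤ Real.log P := Real.log_natCast_nonneg P
  have hm0 : (m : ℝ) ≠ 0 := by exact_mod_cast (by omega : m ≠ 0)
  have hdens : density K k m P ^ m = K ^ m * (P ^ k / P ^ m * Real.log P) := by
    rw [density_pow, div_self hm0, Real.rpow_one, mul_sub, mul_div_cancel₀ _ hm0, mul_one,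
      Real.rpow_sub hP0, Real.rpow_natCast, Real.rpow_natCast]
  have hexp : ∀ n ∈ Icc (m * (2 * P) ^ k) (m * (4 * P) ^ k),
      Real.exp (-(repCount (Fin m) (Icc P ((4 * m + 1) * P)) k n * density K k m P ^ m / 2))
        ≤ 1 / P ^ (k + 1) := by
    intro n hn
    rw [mem_Icc] at hn
    have h1 := hR n hn.1 hn.2
    have h2 : (k + 1) * Real.log P
        ≤ repCount (Fin m) (Icc P ((4 * m + 1) * P)) k n * density K k m P ^ m / 2 := by
      have h3 : K ≤ K ^ m := le_self_pow₀ hK (by omega)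
      have h5 : 2 * (k + 1) ≤ c * K ^ m := by
        rw [div_le_iff₀ hc] at hKc
        nlinarith
      calc (k + 1) * Real.log P = 2 * (k + 1) * Real.log P / 2 := by ring
        _ ≤ c * K ^ m * Real.log P / 2 := by gcongr
        _ = c * P ^ m * (K ^ m * Real.log P / P ^ m) / 2 := by field_simp
        _ ≤ repCount (Fin m) (Icc P ((4 * m + 1) * P)) k n * (P : ℝ) ^ k
              * (K ^ m * Real.log P / P ^ m) / 2 := by gcongr
        _ = _ := by rw [hdens]; ring
    calc _ ≤ Real.exp (-((k + 1) * Real.log P)) := Real.exp_le_exp.2 (by linarith)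
      _ = 1 / P ^ (k + 1) := by
        rw [Real.exp_neg, one_div]
        congr 1
        rw [← Nat.cast_succ, mul_comm, Real.exp_mul, Real.exp_log hP0, Real.rpow_natCast]
  refine (sum_le_sum hexp).trans_lt ?_
  rw [sum_const, nsmul_eq_mul, Nat.card_Icc, mul_one_div, div_lt_iff₀ (by positivity)]
  have hcard : m * (4 * P) ^ k + 1 - m * (2 * P) ^ k ≤ m * 4 ^ k * P ^ k := by
    have : 0 < m * (2 * P) ^ k := by positivity
    have h6 : m * (4 * P) ^ k = m * 4 ^ k * P ^ k := by rw [mul_pow, mul_assoc]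
    omega
  calc ((m * (4 * P) ^ k + 1 - m * (2 * P) ^ k : ℕ) : ℝ) ≤ m * 4 ^ k * P ^ k := by
        exact_mod_cast hcard
    _ < 1 / 2 * (8 * m * 4 ^ k) * P ^ k := by
        have : (0 : ℝ) < m * 4 ^ k * P ^ k := by positivity
        nlinarith
    _ ≤ 1 / 2 * P * P ^ k := by
        gcongr
        exact_mod_cast hP
    _ = _ := by ring

/-- At each scale `P` there is a thin set of integers of size about `P` such that all integers
of size about `P ^ k` are sums of `m` of their `k`-th powers. -/
theorem exists_thin_scale (k : ℕ) (hk : 1 ≤ k) : ∃ m₀ : ℕ, ∀ m : ℕ, m₀ ≤ m →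
    ∃ K : ℝ, 0 < K ∧ ∃ P₀ : ℕ, ∀ P : ℕ, P₀ ≤ P → ∃ B : Finset ℕ, (∀ x ∈ B, P ≤ x) ∧
      (B.card : ℝ) ≤ K * ((P : ℝ) ^ ((k : ℝ) / m) * Real.log P ^ (1 / (m : ℝ))) ∧
      ∀ n : ℕ, m * (2 * P) ^ k ≤ n → n ≤ m * (4 * P) ^ k →
        ∃ z : Fin m → ℕ, (∀ i, z i ∈ B) ∧ ∑ i, z i ^ k = n := by
  obtain ⟨m₁, h₁⟩ := exists_le_repCount k hk
  obtain ⟨m₂, h₂⟩ := exists_density_pow_mul_repCount_le hk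
  refine ⟨max (k + 1) (max m₁ m₂), fun m hm => ?_⟩
  simp only [max_le_iff] at hm
  obtain ⟨hkm, hm₁, hm₂⟩ := hm
  obtain ⟨c, hc, P₁, hP₁⟩ := h₁ m hm₁
  set K : ℝ := max 1 (2 * (k + 1) / c) with hKdef
  have hK1 : 1 ≤ K := le_max_left _ _
  have hm0 : (0 : ℝ) < m := by exact_mod_cast (by omega : 0 < m)
  have hm1 : 1 ≤ m := by omega
  have : Nonempty (Fin m) := ⟨⟨0, by omega⟩⟩
  have hsmall : ∀ᶠ P : ℕ in atTop, ∀ l ∈ Ico 1 m, ∀ (ι : Type) [Fintype ι] [DecidableEq ι],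
      Fintype.card ι = l → ∀ n : ℤ,
      density K k m P ^ l * repCount ι (Icc P ((4 * m + 1) * P)) k n ≤ 1 / 2 ^ (m + 1) := by
    rw [eventually_all_finset]
    intro l hl
    rw [mem_Ico] at hl
    obtain ⟨a, D, ha, h⟩ := h₂ m hm₂ K (by linarith) l hl.1 hl.2
    have hlim := (tendsto_rpow_mul_log_rpow ha (l / (m : ℝ)) D).eventually
      (eventually_le_nhds (show (0 : ℝ) < 1 / 2 ^ (m + 1) by positivity))
    filter_upwards [hlim, eventually_ge_atTop 1] with P hP hP1 ι _ _ hι n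
    exact (h P hP1 ι hι n).trans hP
  have hle1 : ∀ᶠ P : ℕ in atTop, density K k m P ≤ 1 := by
    have ha : (k : ℝ) / m - 1 < 0 := by
      rw [sub_neg, div_lt_one hm0]
      exact_mod_cast hkm
    exact (tendsto_rpow_mul_log_rpow ha (1 / (m : ℝ)) K).eventually (eventually_le_nhds one_pos)
  obtain ⟨P₂, hP₂⟩ := eventually_atTop.1 (hsmall.and hle1)
  refine ⟨2 * K * m * (4 * m + 2), by positivity, max P₁ (max P₂ (8 * m * 4 ^ k)),
    fun P hP => ?_⟩
  simp only [max_le_iff] at hP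
  obtain ⟨hPP₁, hPP₂, hPP₃⟩ := hP
  obtain ⟨hsm, hp1⟩ := hP₂ P hPP₂
  have hP2 : 2 ≤ P := by
    have : 0 < m * 4 ^ k := by positivity
    nlinarith
  have hP0 : (0 : ℝ) < P := by exact_mod_cast (by omega : 0 < P)
  have hlog : 0 < Real.log P := Real.log_pos (by exact_mod_cast hP2)
  have hp0 : 0 < density K k m P := by
    rw [density]
    positivity
  set s := Icc P ((4 * m + 1) * P) with hs
  have hsne : s.Nonempty := ⟨P, by rw [hs, mem_Icc]; constructor <;> nlinarith⟩
  obtain ⟨B, hBs, hBcard, hB⟩ := exists_subset_representing (ι := Fin m) hsne (k := k) hp0 hp1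
    (fun J hJ hJu n => by
      rw [Fintype.card_fin]
      refine hsm J.card ?_ J (Fintype.card_coe J) n
      rw [mem_Ico]
      refine ⟨hJ.card_pos, ?_⟩
      simpa using card_lt_card (ssubset_univ_iff.2 hJu))
    (Icc (m * (2 * P) ^ k) (m * (4 * P) ^ k))
    (by
      rw [Fintype.card_fin]
      exact sum_exp_lt_half hK1 hc (le_max_right _ _) hm1 hPP₃ (hP₁ P hPP₁))
  refine ⟨B, fun x hx => (mem_Icc.1 (hBs hx)).1, ?_, fun n h1 h2 => hB n (mem_Icc.2 ⟨h1, h2⟩)⟩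
  have hscard : (s.card : ℝ) ≤ (4 * m + 2) * P := by
    have : s.card ≤ (4 * m + 2) * P := by
      rw [hs, Nat.card_Icc]
      have : (4 * m + 2) * P = (4 * m + 1) * P + P := by ring
      omega
    exact_mod_cast this
  rw [Fintype.card_fin] at hBcard
  calc (B.card : ℝ) ≤ 2 * density K k m P * m * s.card := hBcard
    _ ≤ 2 * density K k m P * m * ((4 * m + 2) * P) := by gcongr
    _ = _ := by
      rw [density, Real.rpow_sub hP0, Real.rpow_one]
      field_simp

end Scale

section ThinWaring

open Finset

lemma exists_dyadic_scale {k m n t₀ : ℕ} (hk : 1 ≤ k) (hm : 1 ≤ m)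
    (hn : m * (2 * 2 ^ t₀) ^ k ≤ n) :
    ∃ t, t₀ ≤ t ∧ m * (2 * 2 ^ t) ^ k ≤ n ∧ n ≤ m * (4 * 2 ^ t) ^ k := by
  have hex : ∃ t, t₀ ≤ t ∧ n ≤ m * (4 * 2 ^ t) ^ k := by
    refine ⟨t₀ + n, by omega, ?_⟩
    calc n ≤ 2 ^ (t₀ + n) := (Nat.lt_two_pow_self).le.trans
          (Nat.pow_le_pow_right two_pos (by omega))
      _ ≤ 4 * 2 ^ (t₀ + n) := by omega
      _ ≤ (4 * 2 ^ (t₀ + n)) ^ k := Nat.le_self_pow (by omega) _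
      _ ≤ m * (4 * 2 ^ (t₀ + n)) ^ k := Nat.le_mul_of_pos_left _ hm
  classical
  obtain ⟨h1, h2⟩ := Nat.find_spec hex
  refine ⟨Nat.find hex, h1, ?_, h2⟩
  rcases h1.eq_or_lt with h | h
  · rwa [← h]
  · obtain ⟨u, hu⟩ : ∃ u, Nat.find hex = u + 1 := ⟨Nat.find hex - 1, by omega⟩
    have h3 := Nat.find_min hex (m := u) (by omega)
    have h4 : n > m * (4 * 2 ^ u) ^ k := by
      by_contra hcon
      exact h3 ⟨by omega, by omega⟩
    rw [hu, pow_succ, show 2 * (2 ^ u * 2) = 4 * 2 ^ u by ring]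
    exact h4.le

lemma exists_sum_pow_of_le {k a m n : ℕ} (hk : 1 ≤ k) (ham : a ≤ m)
    (h : ∃ z : Fin a → ℕ, ∑ i, z i ^ k = n) : ∃ z : Fin m → ℕ, ∑ i, z i ^ k = n := by
  obtain ⟨z, hz⟩ := h
  obtain ⟨b, rfl⟩ := Nat.exists_eq_add_of_le ham
  refine ⟨Fin.append z 0, ?_⟩
  have hk0 : k ≠ 0 := by omega
  rw [Fin.sum_univ_add]
  simp [hz, hk0]

/-- **Waring's problem**: every natural number is a sum of boundedly many `k`-th powers. -/
theorem exists_waring (k : ℕ) (hk : 1 ≤ k) :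
    ∃ g : ℕ, ∀ m : ℕ, g ≤ m → ∀ n : ℕ, ∃ z : Fin m → ℕ, ∑ i, z i ^ k = n := by
  obtain ⟨m₀, h⟩ := exists_thin_scale k hk
  obtain ⟨K, -, P₀, h⟩ := h (m₀ + 1) (by omega)
  refine ⟨max (m₀ + 1) ((m₀ + 1) * (2 * 2 ^ P₀) ^ k), fun m hm n => ?_⟩
  rw [max_le_iff] at hm
  rcases le_or_gt ((m₀ + 1) * (2 * 2 ^ P₀) ^ k) n with hn | hn
  · obtain ⟨t, ht, h1, h2⟩ := exists_dyadic_scale hk (by omega) hn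
    obtain ⟨B, -, -, hB⟩ := h (2 ^ t) (ht.trans Nat.lt_two_pow_self.le)
    obtain ⟨z, -, hz⟩ := hB n h1 h2
    exact exists_sum_pow_of_le hk hm.1 ⟨z, hz⟩
  · exact exists_sum_pow_of_le (a := n) hk (by omega) ⟨fun _ => 1, by simp⟩

lemma countBelow_le {k m J t₀ : ℕ} (hk : 1 ≤ k) (hm : 1 ≤ m) {K : ℝ} (hK : 0 < K)
    {B : ℕ → Finset ℕ} (hB : ∀ t, t₀ ≤ t → ∀ x ∈ B t, 2 ^ t ≤ x)
    (hcard : ∀ t, t₀ ≤ t → ((B t).card : ℝ)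
      ≤ K * (((2 ^ t : ℕ) : ℝ) ^ ((k : ℝ) / m) * Real.log (2 ^ t : ℕ) ^ (1 / (m : ℝ)))) :
    ∃ C : ℝ, ∀ x : ℝ, 2 ≤ x →
      (countBelow {a : ℕ | ∃ j, a = j ^ k ∧ (j ≤ J ∨ ∃ t, t₀ ≤ t ∧ j ∈ B t)} x : ℝ)
        ≤ C * x ^ (1 / (m : ℝ)) * Real.log x ^ (1 / (m : ℝ)) := by
  have hm0 : (0 : ℝ) < m := by exact_mod_cast hm
  have hk0 : (0 : ℝ) < k := by exact_mod_cast hk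
  set r : ℝ := 2 ^ ((k : ℝ) / m) with hr
  have hr1 : 1 < r := Real.one_lt_rpow one_lt_two (by positivity)
  have hlog2 : 0 < Real.log 2 := Real.log_pos one_lt_two
  refine ⟨(J + 1) / Real.log 2 ^ (1 / (m : ℝ)) + K * (r / (r - 1)), fun x hx => ?_⟩
  have hx0 : 0 ≤ x := by linarith
  set T := Nat.log (2 ^ k) ⌊x⌋₊ with hT
  have hfl : ⌊x⌋₊ ≠ 0 := by
    rw [Ne, Nat.floor_eq_zero]
    linarith
  have hT1 : ∀ t, t ≤ T ↔ (((2 ^ t) ^ k : ℕ) : ℝ) ≤ x := by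
    intro t
    rw [hT, Nat.le_log_iff_pow_le (Nat.one_lt_two_pow (by omega)) hfl, Nat.le_floor_iff hx0,
      ← pow_mul, ← pow_mul, mul_comm]
  set F : Finset ℕ := range (J + 1) ∪ ((range (T + 1)).filter (t₀ ≤ ·)).biUnion B with hF
  have hsub : {a : ℕ | a ∈ {a : ℕ | ∃ j, a = j ^ k ∧ (j ≤ J ∨ ∃ t, t₀ ≤ t ∧ j ∈ B t)} ∧ (a : ℝ) ≤ x}
      ⊆ (F.image (· ^ k) : Set ℕ) := by
    rintro a ⟨⟨j, rfl, hj⟩, hax⟩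
    rw [coe_image]
    refine ⟨j, ?_, rfl⟩
    rw [mem_coe, hF, mem_union]
    rcases hj with hj | ⟨t, ht, hj⟩
    · left
      rw [mem_range]
      omega
    · right
      rw [mem_biUnion]
      refine ⟨t, ?_, hj⟩
      rw [mem_filter, mem_range, Nat.lt_succ_iff, hT1]
      refine ⟨le_trans ?_ hax, ht⟩
      exact_mod_cast Nat.pow_le_pow_left (hB t ht j hj) k
  have hcount : countBelow {a : ℕ | ∃ j, a = j ^ k ∧ (j ≤ J ∨ ∃ t, t₀ ≤ t ∧ j ∈ B t)} x
      ≤ J + 1 + ∑ t ∈ (range (T + 1)).filter (t₀ ≤ ·), (B t).card := by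
    calc _ ≤ (F.image (· ^ k) : Set ℕ).ncard := Set.ncard_le_ncard hsub (finite_toSet _)
      _ = (F.image (· ^ k)).card := by rw [Set.ncard_coe_finset]
      _ ≤ F.card := card_image_le
      _ ≤ _ := by
        refine (card_union_le _ _).trans ?_
        rw [card_range]
        gcongr
        exact card_biUnion_le
  set y := x ^ (1 / (m : ℝ)) with hy
  set l := Real.log x ^ (1 / (m : ℝ)) with hl
  have hlogx : Real.log 2 ≤ Real.log x := Real.log_le_log two_pos hx
  have hl0 : 0 < l := Real.rpow_pos_of_pos (hlog2.trans_le hlogx) _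
  have hy1 : 1 ≤ y := Real.one_le_rpow (by linarith) (by positivity)
  have hrpow : ∀ t : ℕ, ((2 ^ t : ℕ) : ℝ) ^ ((k : ℝ) / m) = r ^ t := by
    intro t
    rw [hr, Nat.cast_pow, Nat.cast_ofNat, ← Real.rpow_natCast, ← Real.rpow_natCast,
      ← Real.rpow_mul two_pos.le, ← Real.rpow_mul two_pos.le, mul_comm]
  have hrT : r ^ T ≤ y := by
    rw [← hrpow, div_eq_mul_one_div, Real.rpow_mul (Nat.cast_nonneg _), Real.rpow_natCast, hy]
    have := (hT1 T).1 le_rfl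
    push_cast at this ⊢
    gcongr
  have hsum : ∑ t ∈ (range (T + 1)).filter (t₀ ≤ ·), ((B t).card : ℝ)
      ≤ K * (r / (r - 1)) * y * l := by
    calc ∑ t ∈ (range (T + 1)).filter (t₀ ≤ ·), ((B t).card : ℝ)
        ≤ ∑ t ∈ (range (T + 1)).filter (t₀ ≤ ·), K * (r ^ t * l) := by
          refine sum_le_sum fun t ht => ?_
          rw [mem_filter, mem_range, Nat.lt_succ_iff, hT1] at ht
          refine (hcard t ht.2).trans ?_
          rw [hrpow]
          have h2 : ((2 ^ t : ℕ) : ℝ) ≤ x :=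
            le_trans (by exact_mod_cast Nat.le_self_pow (by omega) _) ht.1
          have h3 : 0 ≤ Real.log ((2 ^ t : ℕ) : ℝ) := Real.log_natCast_nonneg _
          have h4 : Real.log ((2 ^ t : ℕ) : ℝ) ≤ Real.log x :=
            Real.log_le_log (by positivity) h2
          rw [hl]
          gcongr
      _ ≤ ∑ t ∈ range (T + 1), K * (r ^ t * l) :=
          sum_le_sum_of_subset_of_nonneg (filter_subset _ _) fun t _ _ => by positivity
      _ = K * l * ((r ^ (T + 1) - 1) / (r - 1)) := by
          rw [← geom_sum_eq hr1.ne', mul_sum]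
          exact sum_congr rfl fun t _ => by ring
      _ ≤ K * l * (r * y / (r - 1)) := by
          have : 0 < r - 1 := by linarith
          gcongr
          rw [pow_succ]
          nlinarith
      _ = _ := by ring
  have hJ : (J + 1 : ℝ) ≤ (J + 1) / Real.log 2 ^ (1 / (m : ℝ)) * y * l := by
    have h1 : Real.log 2 ^ (1 / (m : ℝ)) ≤ l := by
      rw [hl]
      gcongr
    have h2 : 0 < Real.log 2 ^ (1 / (m : ℝ)) := Real.rpow_pos_of_pos hlog2 _
    rw [mul_assoc, div_mul_eq_mul_div, le_div_iff₀ h2]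
    gcongr
    nlinarith
  calc (countBelow {a : ℕ | ∃ j, a = j ^ k ∧ (j ≤ J ∨ ∃ t, t₀ ≤ t ∧ j ∈ B t)} x : ℝ)
      ≤ J + 1 + ∑ t ∈ (range (T + 1)).filter (t₀ ≤ ·), ((B t).card : ℝ) := by
        exact_mod_cast hcount
    _ ≤ _ := by linarith

end ThinWaring

theorem stmt5 (k : ℕ) (hk : 2 ≤ k) :
    ∃ m0 : ℕ, ∀ m : ℕ, m0 < m →
      ∃ A : Set ℕ, A ⊆ {a | ∃ j : ℕ, a = j ^ k} ∧
        (∀ n : ℕ, ∃ f : Fin m → ℕ, (∀ i, f i ∈ A) ∧ ∑ i, f i = n) ∧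
        ∃ C : ℝ, ∀ x : ℝ, 2 ≤ x →
          (countBelow A x : ℝ) ≤
            C * x ^ (1 / (m : ℝ)) * (Real.log x) ^ (1 / (m : ℝ)) := by
  have hk1 : 1 ≤ k := by omega
  obtain ⟨m₀, h⟩ := exists_thin_scale k hk1
  obtain ⟨g, hg⟩ := exists_waring k hk1
  refine ⟨max m₀ g, fun m hm => ?_⟩
  rw [max_lt_iff] at hm
  obtain ⟨K, hK, t₀, h⟩ := h m hm.1.le
  have hB : ∀ t, ∃ B : Finset ℕ, t₀ ≤ t → (∀ x ∈ B, 2 ^ t ≤ x) ∧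
      (B.card : ℝ) ≤ K * (((2 ^ t : ℕ) : ℝ) ^ ((k : ℝ) / m)
        * Real.log (2 ^ t : ℕ) ^ (1 / (m : ℝ))) ∧
      ∀ n : ℕ, m * (2 * 2 ^ t) ^ k ≤ n → n ≤ m * (4 * 2 ^ t) ^ k →
        ∃ z : Fin m → ℕ, (∀ i, z i ∈ B) ∧ ∑ i, z i ^ k = n := by
    intro t
    by_cases ht : t₀ ≤ t
    · obtain ⟨B, hB⟩ := h (2 ^ t) (ht.trans Nat.lt_two_pow_self.le)
      exact ⟨B, fun _ => hB⟩
    · exact ⟨∅, fun h => absurd h ht⟩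
  choose B hB using hB
  refine ⟨{a | ∃ j, a = j ^ k ∧ (j ≤ m * (2 * 2 ^ t₀) ^ k ∨ ∃ t, t₀ ≤ t ∧ j ∈ B t)}, ?_, ?_,
    countBelow_le hk1 (by omega) hK (fun t ht => (hB t ht).1) (fun t ht => (hB t ht).2.1)⟩
  · rintro a ⟨j, rfl, -⟩
    exact ⟨j, rfl⟩
  · intro n
    rcases le_or_gt (m * (2 * 2 ^ t₀) ^ k) n with hn | hn
    · obtain ⟨t, ht, h1, h2⟩ := exists_dyadic_scale hk1 (by omega) hn
      obtain ⟨z, hz, hzn⟩ := (hB t ht).2.2 n h1 h2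
      exact ⟨fun i => z i ^ k, fun i => ⟨z i, rfl, Or.inr ⟨t, ht, hz i⟩⟩, hzn⟩
    · obtain ⟨z, hz⟩ := hg m hm.2.le n
      refine ⟨fun i => z i ^ k, fun i => ⟨z i, rfl, Or.inl ?_⟩, hz⟩
      have h1 : z i ^ k ≤ n :=
        hz ▸ Finset.single_le_sum (f := fun i => z i ^ k) (fun _ _ => Nat.zero_le _)
          (Finset.mem_univ i)
      have h2 : z i ≤ z i ^ k := Nat.le_self_pow (by omega) _
      omega
end

section
/- (Erdős–Tetali disjointness lemma.) Let (Ω, 𝒮, P) be a probability space, let (B_i)_{i ∈ I} be a countable family of events, and let l ≥ 1 be an integer. If Σ_{i ∈ I} P(B_i) ≤ μ, then the sum of P(B_{i_1} ∩ B_{i_2} ∩ … ∩ B_{i_l}), taken over all l-element subsets {i_1, …, i_l} of I for which the events B_{i_1}, …, B_{i_l} are mutually independent, is at most μ^l / l!. -/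
open MeasureTheory

theorem pow_succ_add_mul_le_add_pow {R : Type*} [CommSemiring R] [PartialOrder R]
    [CanonicallyOrderedAdd R] (a b : R) (n : ℕ) :
    b ^ (n + 1) + (n + 1 : ℕ) * (a * b ^ n) ≤ (a + b) ^ (n + 1) := by
  induction n with
  | zero => simp [add_comm]
  | succ n ih =>
    obtain ⟨c, hc⟩ := exists_add_of_le ih
    rw [pow_succ (a + b) (n + 1), hc]
    refine le_of_le_of_eq (self_le_add_right _ ((n + 1 : ℕ) * (a * b ^ n) * a + c * (a + b))) ?_
    push_cast
    ring

theorem factorial_mul_sum_powersetCard_prod_le {ι R : Type*} [CommSemiring R] [PartialOrder R]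
    [IsOrderedRing R] [CanonicallyOrderedAdd R] (a : ι → R) (U : Finset ι) (n : ℕ) :
    (n.factorial : R) * ∑ s ∈ U.powersetCard n, ∏ i ∈ s, a i ≤ (∑ i ∈ U, a i) ^ n := by
  classical
  induction U using Finset.induction_on generalizing n with
  | empty =>
    cases n with
    | zero => simp
    | succ n => rw [Finset.powersetCard_eq_empty.2 (by simp)]; simp
  | insert x U hx ih =>
    cases n with
    | zero => simp
    | succ n =>
      have hdisj : Disjoint (U.powersetCard (n + 1)) ((U.powersetCard n).image (insert x)) := by
        rw [Finset.disjoint_left]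
        intro s hs hs'
        obtain ⟨t, -, rfl⟩ := Finset.mem_image.1 hs'
        exact hx ((Finset.mem_powersetCard.1 hs).1 (Finset.mem_insert_self x t))
      have hnot {s : Finset ι} (hs : s ∈ U.powersetCard n) : x ∉ s :=
        fun h => hx ((Finset.mem_powersetCard.1 hs).1 h)
      have himage : ∑ s ∈ (U.powersetCard n).image (insert x), ∏ i ∈ s, a i
          = a x * ∑ s ∈ U.powersetCard n, ∏ i ∈ s, a i := by
        rw [Finset.sum_image, Finset.mul_sum]
        · exact Finset.sum_congr rfl fun s hs => Finset.prod_insert (hnot hs)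
        · intro s hs t ht hst
          rw [← Finset.erase_insert (hnot hs), ← Finset.erase_insert (hnot ht)]
          exact congrArg (fun u => u.erase x) hst
      rw [Finset.powersetCard_succ_insert hx, Finset.sum_union hdisj, himage,
        Finset.sum_insert hx]
      refine le_trans ?_ (pow_succ_add_mul_le_add_pow (a x) (∑ i ∈ U, a i) n)
      rw [mul_add]
      refine add_le_add (ih (n + 1)) ?_
      calc _ = ((n + 1 : ℕ) : R) *
            (a x * ((n.factorial : R) * ∑ s ∈ U.powersetCard n, ∏ i ∈ s, a i)) := by
            rw [Nat.factorial_succ, Nat.cast_mul]; ring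
        _ ≤ _ := by gcongr; exact ih n

theorem stmt6 {Ω : Type*} [MeasurableSpace Ω] (P : Measure Ω)
    [IsProbabilityMeasure P]
    {I : Type*} [Countable I] (B : I → Set Ω) (hB : ∀ i, MeasurableSet (B i))
    (l : ℕ) (hl : 1 ≤ l) (μ : ENNReal) (hsum : ∑' i, P (B i) ≤ μ) :
    ∑' s : {s : Finset I // s.card = l ∧
        ∀ t ⊆ s, P (⋂ i ∈ t, B i) = ∏ i ∈ t, P (B i)},
      P (⋂ i ∈ s.1, B i) ≤ μ ^ l / (Nat.factorial l : ENNReal) := by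
  classical
  rw [ENNReal.tsum_eq_iSup_sum]
  refine iSup_le fun F => ?_
  rw [ENNReal.le_div_iff_mul_le (Or.inl (by exact_mod_cast l.factorial_ne_zero))
    (Or.inl (ENNReal.natCast_ne_top _)), mul_comm]
  set U : Finset I := F.biUnion fun s => s.1
  calc (l.factorial : ENNReal) * ∑ s ∈ F, P (⋂ i ∈ s.1, B i)
      = (l.factorial : ENNReal) * ∑ s ∈ F.image Subtype.val, ∏ i ∈ s, P (B i) := by
        rw [Finset.sum_image Subtype.val_injective.injOn]
        congr 1
        exact Finset.sum_congr rfl fun s _ => s.2.2 s.1 subset_rfl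
    _ ≤ (l.factorial : ENNReal) * ∑ s ∈ U.powersetCard l, ∏ i ∈ s, P (B i) := by
        gcongr
        intro s hs
        obtain ⟨t, ht, rfl⟩ := Finset.mem_image.1 hs
        exact Finset.mem_powersetCard.2 ⟨Finset.subset_biUnion_of_mem (fun s => s.1) ht, t.2.1⟩
    _ ≤ (∑ i ∈ U, P (B i)) ^ l := factorial_mul_sum_powersetCard_prod_le _ U l
    _ ≤ μ ^ l := by
        gcongr
        exact (ENNReal.sum_le_tsum U).trans hsum
end

section
/- (Erdős–Rado sunflower lemma.) Let k ≥ 1 and r ≥ 3 be integers. If H is a finite collection of distinct finite sets, each of size at most k, with |H| > (r − 1)^k · k!, then H contains r sets A_1, …, A_r forming a Δ-system, i.e., there is a set S such that A_i ∩ A_j = S for all 1 ≤ i < j ≤ r. -/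
/-- A family of finite sets contains a subfamily of pairwise disjoint members whose union meets
every nonempty member, and which contains the empty set if the family does. -/
theorem exists_pairwise_disjoint_meeting {α : Type*} [DecidableEq α] (H : Finset (Finset α)) :
    ∃ M ⊆ H, (∀ A ∈ M, ∀ B ∈ M, A ≠ B → A ∩ B = ∅) ∧ (∅ ∈ H → ∅ ∈ M) ∧
      ∀ A ∈ H, A ≠ ∅ → ∃ x ∈ M.biUnion id, x ∈ A := by
  classical
  obtain ⟨M, hM, hmax⟩ := Finset.exists_max_image
    (H.powerset.filter fun M => ∀ A ∈ M, ∀ B ∈ M, A ≠ B → A ∩ B = ∅) Finset.card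
    ⟨∅, by simp⟩
  simp only [Finset.mem_filter, Finset.mem_powerset] at hM hmax
  obtain ⟨hMH, hdisj⟩ := hM
  have mem_of_disjoint : ∀ A ∈ H, (∀ B ∈ M, A ∩ B = ∅) → A ∈ M := by
    intro A hA hAM
    by_contra hAM'
    have hle := hmax (insert A M) ⟨Finset.insert_subset hA hMH, by
      intro B hB C hC hBC
      rw [Finset.mem_insert] at hB hC
      rcases hB with rfl | hB <;> rcases hC with rfl | hC
      · exact absurd rfl hBC
      · exact hAM C hC
      · rw [Finset.inter_comm]; exact hAM B hB
      · exact hdisj B hB C hC hBC⟩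
    rw [Finset.card_insert_of_notMem hAM'] at hle
    omega
  refine ⟨M, hMH, hdisj, fun h => mem_of_disjoint ∅ h (by simp), fun A hA hne => ?_⟩
  by_contra! hU
  have hAM : A ∈ M := mem_of_disjoint A hA fun B hB => by
    ext x
    simp only [Finset.mem_inter, Finset.notMem_empty, iff_false, not_and]
    exact fun hxA hxB => hU x (Finset.mem_biUnion.2 ⟨B, hB, hxB⟩) hxA
  obtain ⟨x, hx⟩ := Finset.nonempty_iff_ne_empty.2 hne
  exact hU x (Finset.mem_biUnion.2 ⟨A, hAM, hx⟩) hx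

/-- A Δ-system among the sets of `H` through `x`, with `x` removed, lifts to one in `H`. -/
theorem exists_deltaSystem_of_link {α : Type*} [DecidableEq α] {H : Finset (Finset α)} {x : α}
    {r : ℕ} (h : ∃ T ⊆ (H.filter (x ∈ ·)).image (·.erase x), T.card = r ∧
      ∃ S : Finset α, ∀ A ∈ T, ∀ B ∈ T, A ≠ B → A ∩ B = S) :
    ∃ T ⊆ H, T.card = r ∧
      ∃ S : Finset α, ∀ A ∈ T, ∀ B ∈ T, A ≠ B → A ∩ B = S := by
  obtain ⟨T, hT, hr, S, hS⟩ := h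
  have hlink : ∀ A ∈ T, x ∉ A ∧ insert x A ∈ H := by
    intro A hA
    obtain ⟨B, hB, rfl⟩ := Finset.mem_image.1 (hT hA)
    rw [Finset.mem_filter] at hB
    exact ⟨Finset.notMem_erase x B, by rw [Finset.insert_erase hB.2]; exact hB.1⟩
  refine ⟨T.image (insert x), ?_, ?_, insert x S, ?_⟩
  · intro A hA
    obtain ⟨B, hB, rfl⟩ := Finset.mem_image.1 hA
    exact (hlink B hB).2
  · rw [Finset.card_image_of_injOn, hr]
    intro A hA B hB hAB
    rw [← Finset.erase_insert (hlink A hA).1, ← Finset.erase_insert (hlink B hB).1]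
    exact congrArg (·.erase x) hAB
  · intro A' hA' B' hB' hAB
    obtain ⟨A, hA, rfl⟩ := Finset.mem_image.1 hA'
    obtain ⟨B, hB, rfl⟩ := Finset.mem_image.1 hB'
    rw [← Finset.insert_inter_distrib, hS A hA B hB fun h => hAB (h ▸ rfl)]

theorem exists_deltaSystem {α : Type*} [DecidableEq α] (k r : ℕ) (hr : 2 ≤ r)
    (H : Finset (Finset α)) (hcard : ∀ A ∈ H, A.card ≤ k)
    (hH : (r - 1) ^ k * Nat.factorial k < H.card) :
    ∃ T ⊆ H, T.card = r ∧
      ∃ S : Finset α, ∀ A ∈ T, ∀ B ∈ T, A ≠ B → A ∩ B = S := by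
  induction k generalizing H with
  | zero =>
    have hsub : H ⊆ {∅} := fun A hA => by
      simpa using hcard A hA
    have := Finset.card_le_card hsub
    simp at hH this
    omega
  | succ k ih =>
    obtain ⟨M, hMH, hdisj, hempty, hmeet⟩ := exists_pairwise_disjoint_meeting H
    by_cases hM : r ≤ M.card
    · obtain ⟨T, hTM, hT⟩ := Finset.exists_subset_card_eq hM
      exact ⟨T, hTM.trans hMH, hT, ∅, fun A hA B hB => hdisj A (hTM hA) B (hTM hB)⟩
    by_cases hx : ∃ x, (r - 1) ^ k * Nat.factorial k < (H.filter (x ∈ ·)).card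
    · obtain ⟨x, hx⟩ := hx
      refine exists_deltaSystem_of_link (x := x) (ih _ ?_ ?_)
      · intro A hA
        obtain ⟨B, hB, rfl⟩ := Finset.mem_image.1 hA
        rw [Finset.mem_filter] at hB
        have := hcard B hB.1
        rw [Finset.card_erase_of_mem hB.2]
        omega
      · rwa [Finset.card_image_of_injOn]
        intro A hA B hB hAB
        rw [Finset.mem_coe, Finset.mem_filter] at hA hB
        rw [← Finset.insert_erase hA.2, ← Finset.insert_erase hB.2]
        exact congrArg (insert x) hAB
    · push Not at hx
      exfalso
      have hU : (M.biUnion id).card ≤ (M.erase ∅).card * (k + 1) := by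
        have : M.biUnion id = (M.erase ∅).biUnion id := by
          ext x
          simp only [Finset.mem_biUnion, Finset.mem_erase, id]
          exact ⟨fun ⟨A, hA, hxA⟩ => ⟨A, ⟨Finset.ne_empty_of_mem hxA, hA⟩, hxA⟩,
            fun ⟨A, hA, hxA⟩ => ⟨A, hA.2, hxA⟩⟩
        rw [this]
        exact Finset.card_biUnion_le_card_mul _ _ _
          fun A hA => hcard A (hMH (Finset.mem_of_mem_erase hA))
      have hcover : (H.erase ∅).card ≤
          (M.biUnion id).card * ((r - 1) ^ k * Nat.factorial k) := by
        have hsub : H.erase ∅ ⊆ (M.biUnion id).biUnion fun x => H.filter (x ∈ ·) := by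
          intro A hA
          rw [Finset.mem_erase] at hA
          obtain ⟨x, hxU, hxA⟩ := hmeet A hA.2 hA.1
          exact Finset.mem_biUnion.2 ⟨x, hxU, Finset.mem_filter.2 ⟨hA.2, hxA⟩⟩
        exact (Finset.card_le_card hsub).trans
          (Finset.card_biUnion_le_card_mul _ _ _ fun x _ => hx x)
      obtain ⟨s, rfl⟩ : ∃ s, r = s + 2 := ⟨r - 2, by omega⟩
      simp only [Nat.add_succ_sub_one] at hH hcover
      have hpos : 0 < (k + 1) * ((s + 1) ^ k * Nat.factorial k) := by positivity
      have hbound : (H.erase ∅).card ≤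
          (M.erase ∅).card * ((k + 1) * ((s + 1) ^ k * Nat.factorial k)) := by
        rw [← mul_assoc]
        exact hcover.trans (Nat.mul_le_mul_right _ hU)
      have hfact : (s + 1) ^ (k + 1) * Nat.factorial (k + 1) =
          (s + 1) * ((k + 1) * ((s + 1) ^ k * Nat.factorial k)) := by
        rw [Nat.factorial_succ]; ring
      rw [hfact] at hH
      generalize (k + 1) * ((s + 1) ^ k * Nat.factorial k) = c at hpos hbound hH
      by_cases h : ∅ ∈ H
      · have hHc := Finset.card_erase_add_one h
        have hMc := Finset.card_erase_add_one (hempty h)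
        have := Nat.mul_le_mul_right c (show (M.erase ∅).card ≤ s by omega)
        rw [add_mul] at hH
        omega
      · rw [Finset.erase_eq_of_notMem h] at hbound
        have hMc := Finset.card_erase_le (s := M) (a := ∅)
        have := Nat.mul_le_mul_right c (show (M.erase ∅).card ≤ s + 1 by omega)
        omega

theorem stmt7 {α : Type*} [DecidableEq α] (k r : ℕ) (hk : 1 ≤ k) (hr : 3 ≤ r)
    (H : Finset (Finset α)) (hcard : ∀ A ∈ H, A.card ≤ k)
    (hH : (r - 1) ^ k * Nat.factorial k < H.card) :
    ∃ T ⊆ H, T.card = r ∧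
      ∃ S : Finset α, ∀ A ∈ T, ∀ B ∈ T, A ≠ B → A ∩ B = S :=
  exists_deltaSystem k r (by omega) H hcard hH
end

section
/- Let A be a set of positive integers and h ≥ 2 an integer. Then sup_n R_{A,h}(n) is finite if and only if sup_n f_{A,l}(n) is finite for every integer 2 ≤ l ≤ h. -/
/-- `Rcnt A l n` : number of representations `n = a_1 + ... + a_l` with
`a_1 < a_2 < ... < a_l`, all terms in `A`. -/
noncomputable def Rcnt (A : Set ℕ) (l n : ℕ) : ℕ :=
  {f : Fin l → ℕ | StrictMono f ∧ (∀ i, f i ∈ A) ∧ ∑ i, f i = n}.ncard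

/-- `fdisj A l n` : the maximum number of pairwise disjoint representations of `n`
as a sum of `l` distinct elements of `A` (a representation is identified with its
`l`-element set of summands). -/
noncomputable def fdisj (A : Set ℕ) (l n : ℕ) : ℕ :=
  sSup {m : ℕ | ∃ T : Finset (Finset ℕ),
    (∀ S ∈ T, ↑S ⊆ A ∧ S.card = l ∧ S.sum id = n) ∧
    (T : Set (Finset ℕ)).Pairwise Disjoint ∧ T.card = m}

open Classical in
/-- The `l`-element subsets of `A` with sum `n`. -/
noncomputable def sumReps (A : Set ℕ) (l n : ℕ) : Finset (Finset ℕ) :=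
  (Finset.range (n + 1)).powerset.filter fun S => ↑S ⊆ A ∧ S.card = l ∧ S.sum id = n

theorem mem_sumReps {A : Set ℕ} {l n : ℕ} {S : Finset ℕ} :
    S ∈ sumReps A l n ↔ ↑S ⊆ A ∧ S.card = l ∧ S.sum id = n := by
  simp only [sumReps, Finset.mem_filter, Finset.mem_powerset, and_iff_right_iff_imp]
  rintro ⟨-, -, rfl⟩ x hx
  exact Finset.mem_range_succ_iff.2 (Finset.single_le_sum (f := id) (fun _ _ => Nat.zero_le _) hx)

theorem Rcnt_eq_card_sumReps (A : Set ℕ) (l n : ℕ) : Rcnt A l n = (sumReps A l n).card := by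
  rw [Rcnt, ← Set.ncard_coe_finset]
  refine Set.ncard_congr (fun f _ => Finset.univ.image f) ?_ ?_ ?_
  · rintro f ⟨hf, hfA, hn⟩
    refine mem_sumReps.2 ⟨?_, ?_, ?_⟩
    · rintro x hx
      obtain ⟨i, -, rfl⟩ := Finset.mem_image.1 (Finset.mem_coe.1 hx)
      exact hfA i
    · simp [Finset.card_image_of_injective _ hf.injective]
    · rw [Finset.sum_image hf.injective.injOn]
      exact hn
  · rintro f g ⟨hf, -⟩ ⟨hg, -⟩ hfg
    have hrange : Set.range f = Set.range g := by
      simpa using congrArg (fun S : Finset ℕ => (S : Set ℕ)) hfg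
    exact (StrictMono.range_inj hf hg).1 hrange
  · intro S hS
    obtain ⟨hSA, hl, hn⟩ := mem_sumReps.1 hS
    have himage : Finset.univ.image (S.orderEmbOfFin hl) = S := by
      apply Finset.coe_injective
      simp
    refine ⟨S.orderEmbOfFin hl, ⟨(S.orderEmbOfFin hl).strictMono,
      fun i => hSA (S.orderEmbOfFin_mem hl i), ?_⟩, himage⟩
    rw [← hn]
    conv_rhs => rw [← himage]
    rw [Finset.sum_image (S.orderEmbOfFin hl).injective.injOn]
    rfl

theorem bddAbove_card_disjoint_reps (A : Set ℕ) (l n : ℕ) :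
    BddAbove {m : ℕ | ∃ T : Finset (Finset ℕ),
      (∀ S ∈ T, ↑S ⊆ A ∧ S.card = l ∧ S.sum id = n) ∧
      (T : Set (Finset ℕ)).Pairwise Disjoint ∧ T.card = m} := by
  refine ⟨(sumReps A l n).card, ?_⟩
  rintro m ⟨T, hT, -, rfl⟩
  exact Finset.card_le_card fun S hS => mem_sumReps.2 (hT S hS)

theorem card_le_fdisj {A : Set ℕ} {l n : ℕ} {T : Finset (Finset ℕ)} (hT : T ⊆ sumReps A l n)
    (hd : (T : Set (Finset ℕ)).Pairwise Disjoint) : T.card ≤ fdisj A l n :=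
  le_csSup (bddAbove_card_disjoint_reps A l n) ⟨T, fun _ hS => mem_sumReps.1 (hT hS), hd, rfl⟩

theorem exists_card_eq_fdisj (A : Set ℕ) (l n : ℕ) :
    ∃ T ⊆ sumReps A l n, (T : Set (Finset ℕ)).Pairwise Disjoint ∧ T.card = fdisj A l n := by
  obtain ⟨T, hT, hd, hc⟩ := Nat.sSup_mem (by exact ⟨0, ∅, by simp⟩)
    (bddAbove_card_disjoint_reps A l n)
  exact ⟨T, fun S hS => mem_sumReps.2 (hT S hS), hd, hc⟩

/-- The members of a largest disjoint family of representations meet every representation. -/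
theorem exists_small_transversal (A : Set ℕ) {l : ℕ} (hl : l ≠ 0) (n : ℕ) :
    ∃ U : Finset ℕ, U.card ≤ fdisj A l n * l ∧ ∀ S ∈ sumReps A l n, ∃ u ∈ U, u ∈ S := by
  obtain ⟨T, hT, hd, hc⟩ := exists_card_eq_fdisj A l n
  refine ⟨T.biUnion id, ?_, ?_⟩
  · rw [← hc]
    exact Finset.card_biUnion_le_card_mul _ _ _ fun S hS => (mem_sumReps.1 (hT hS)).2.1.le
  · intro S hS
    by_contra! hU
    have hdis : ∀ V ∈ T, Disjoint S V := fun V hV =>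
      Finset.disjoint_right.2 fun u hu => hU u (Finset.mem_biUnion.2 ⟨V, hV, hu⟩)
    have hST : S ∉ T := by
      intro h
      have hempty := disjoint_self.1 (hdis S h)
      have hcard := (mem_sumReps.1 hS).2.1
      rw [hempty] at hcard
      exact hl hcard.symm
    have hle : (insert S T).card ≤ fdisj A l n := by
      refine card_le_fdisj (Finset.insert_subset hS hT) ?_
      rw [Finset.coe_insert]
      exact hd.insert fun V hV _ => ⟨hdis V hV, (hdis V hV).symm⟩
    rw [Finset.card_insert_of_notMem hST] at hle
    omega

theorem card_sumReps_filter_mem_le (A : Set ℕ) (l n u : ℕ) :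
    ((sumReps A (l + 1) n).filter fun S => u ∈ S).card ≤ (sumReps A l (n - u)).card := by
  refine Finset.card_le_card_of_injOn (fun S => S.erase u) ?_ ?_
  · intro S hS
    obtain ⟨hS, hu⟩ := Finset.mem_filter.1 (Finset.mem_coe.1 hS)
    obtain ⟨hSA, hl, hn⟩ := mem_sumReps.1 hS
    refine mem_sumReps.2 ⟨?_, ?_, ?_⟩
    · exact fun x hx => hSA (Finset.mem_of_mem_erase (Finset.mem_coe.1 hx))
    · rw [Finset.card_erase_of_mem hu, hl, Nat.add_sub_cancel]
    · have := Finset.sum_erase_add S id hu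
      simp only [id] at this hn ⊢
      omega
  · intro S hS S' hS' he
    rw [← Finset.insert_erase (Finset.mem_filter.1 (Finset.mem_coe.1 hS)).2,
      ← Finset.insert_erase (Finset.mem_filter.1 (Finset.mem_coe.1 hS')).2]
    exact congrArg (insert u) he

theorem card_sumReps_succ_le (A : Set ℕ) (l n c : ℕ) (hc : ∀ m, (sumReps A l m).card ≤ c) :
    (sumReps A (l + 1) n).card ≤ fdisj A (l + 1) n * (l + 1) * c := by
  obtain ⟨U, hU, hmeet⟩ := exists_small_transversal A l.succ_ne_zero n
  have hsub : sumReps A (l + 1) n ⊆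
      U.biUnion fun u => (sumReps A (l + 1) n).filter fun S => u ∈ S := by
    intro S hS
    obtain ⟨u, hu, huS⟩ := hmeet S hS
    exact Finset.mem_biUnion.2 ⟨u, hu, Finset.mem_filter.2 ⟨hS, huS⟩⟩
  calc (sumReps A (l + 1) n).card ≤ U.card * c :=
        (Finset.card_le_card hsub).trans (Finset.card_biUnion_le_card_mul _ _ _ fun u _ =>
          (card_sumReps_filter_mem_le A l n u).trans (hc _))
    _ ≤ fdisj A (l + 1) n * (l + 1) * c := Nat.mul_le_mul_right c hU

theorem card_sumReps_one_le (A : Set ℕ) (n : ℕ) : (sumReps A 1 n).card ≤ 1 := by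
  refine Finset.card_le_one.2 fun S hS S' hS' => ?_
  obtain ⟨-, hl, hn⟩ := mem_sumReps.1 hS
  obtain ⟨-, hl', hn'⟩ := mem_sumReps.1 hS'
  obtain ⟨a, rfl⟩ := Finset.card_eq_one.1 hl
  obtain ⟨b, rfl⟩ := Finset.card_eq_one.1 hl'
  simp_all

theorem sumReps_zero_right {A : Set ℕ} (hA : ∀ a ∈ A, 1 ≤ a) {l : ℕ} (hl : l ≠ 0) :
    sumReps A l 0 = ∅ := by
  refine Finset.eq_empty_of_forall_notMem fun S hS => ?_
  obtain ⟨hSA, hcard, hn⟩ := mem_sumReps.1 hS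
  obtain ⟨a, ha⟩ := Finset.card_pos.1 (by omega : 0 < S.card)
  have h0 : a = 0 := Finset.sum_eq_zero_iff.1 hn a ha
  have := hA a (hSA ha)
  omega

theorem exists_card_sumReps_le {A : Set ℕ} (hA : ∀ a ∈ A, 1 ≤ a) {h : ℕ} (hh : 1 ≤ h)
    (hf : ∀ l : ℕ, 2 ≤ l → l ≤ h → ∃ c : ℕ, ∀ n : ℕ, 1 ≤ n → fdisj A l n ≤ c) :
    ∃ c : ℕ, ∀ n : ℕ, (sumReps A h n).card ≤ c := by
  induction h, hh using Nat.le_induction with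
  | base => exact ⟨1, card_sumReps_one_le A⟩
  | succ l hl ih =>
    obtain ⟨c, hc⟩ := ih fun k hk hkl => hf k hk (by omega)
    obtain ⟨d, hd⟩ := hf (l + 1) (by omega) le_rfl
    refine ⟨d * (l + 1) * c, fun n => ?_⟩
    rcases Nat.eq_zero_or_pos n with rfl | hn
    · simp [sumReps_zero_right hA l.succ_ne_zero]
    · have := hd n hn
      exact (card_sumReps_succ_le A l n c hc).trans (by gcongr)

/-- Adjoining a fixed set `B ⊆ A` to those members of a disjoint family of representations which
are disjoint from `B` gives distinct longer representations. -/
theorem fdisj_le_card_sumReps_add {A : Set ℕ} {B : Finset ℕ} (hB : ↑B ⊆ A) (l n : ℕ) :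
    fdisj A l n ≤ (sumReps A (l + B.card) (n + B.sum id)).card + B.card := by
  obtain ⟨T, hT, hd, hc⟩ := exists_card_eq_fdisj A l n
  rw [← hc, ← Finset.card_filter_add_card_filter_not (s := T) fun S => Disjoint S B]
  refine Nat.add_le_add ?_ ?_
  · refine Finset.card_le_card_of_injOn (fun S => S ∪ B) ?_ ?_
    · intro S hS
      obtain ⟨hS, hdis⟩ := Finset.mem_filter.1 (Finset.mem_coe.1 hS)
      obtain ⟨hSA, hl, hn⟩ := mem_sumReps.1 (hT hS)
      refine mem_sumReps.2 ⟨?_, ?_, ?_⟩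
      · rw [Finset.coe_union]
        exact Set.union_subset hSA hB
      · rw [Finset.card_union_of_disjoint hdis, hl]
      · rw [Finset.sum_union hdis, hn]
    · intro S hS S' hS' he
      rw [← Finset.union_sdiff_cancel_right (Finset.mem_filter.1 (Finset.mem_coe.1 hS)).2,
        ← Finset.union_sdiff_cancel_right (Finset.mem_filter.1 (Finset.mem_coe.1 hS')).2]
      exact congrArg (· \ B) he
  · have hex : ∀ S ∈ T.filter fun S => ¬Disjoint S B, ∃ b ∈ B, b ∈ S := by
      intro S hS
      obtain ⟨b, hbS, hbB⟩ := Finset.not_disjoint_iff.1 (Finset.mem_filter.1 hS).2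
      exact ⟨b, hbB, hbS⟩
    choose! g hgB hgS using hex
    refine Finset.card_le_card_of_injOn g hgB ?_
    intro S hS S' hS' he
    by_contra hne
    have hdis := hd (Finset.mem_filter.1 (Finset.mem_coe.1 hS)).1
      (Finset.mem_filter.1 (Finset.mem_coe.1 hS')).1 hne
    exact Finset.disjoint_left.1 hdis (hgS S hS) (he ▸ hgS S' hS')

theorem fdisj_le_of_finite {A : Set ℕ} (hA : A.Finite) (l n : ℕ) :
    fdisj A l n ≤ 2 ^ hA.toFinset.card := by
  obtain ⟨T, hT, -, hc⟩ := exists_card_eq_fdisj A l n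
  rw [← hc, ← Finset.card_powerset]
  refine Finset.card_le_card fun S hS => Finset.mem_powerset.2 fun x hx => ?_
  exact hA.mem_toFinset.2 ((mem_sumReps.1 (hT hS)).1 hx)

theorem stmt9 (A : Set ℕ) (hA : ∀ a ∈ A, 1 ≤ a) (h : ℕ) (hh : 2 ≤ h) :
    (∃ c : ℕ, ∀ n : ℕ, 1 ≤ n → Rcnt A h n ≤ c) ↔
    (∀ l : ℕ, 2 ≤ l → l ≤ h → ∃ c : ℕ, ∀ n : ℕ, 1 ≤ n → fdisj A l n ≤ c) := by
  constructor
  · rintro ⟨c, hc⟩ l - hlh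
    rcases A.finite_or_infinite with hfin | hinf
    · exact ⟨_, fun n _ => fdisj_le_of_finite hfin l n⟩
    · obtain ⟨B, hB, hcard⟩ := hinf.exists_subset_card_eq (h - l)
      refine ⟨c + (h - l), fun n hn => ?_⟩
      have hle := fdisj_le_card_sumReps_add hB l n
      rw [hcard, Nat.add_sub_cancel' hlh, ← Rcnt_eq_card_sumReps] at hle
      have := hc (n + B.sum id) (by omega)
      omega
  · intro hf
    obtain ⟨c, hc⟩ := exists_card_sumReps_le hA (by omega) hf
    exact ⟨c, fun n _ => (Rcnt_eq_card_sumReps A h n).trans_le (hc n)⟩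
end
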